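/- arXiv:1810.02183 — 7 statements merged into one kernel-verified Lean document; each statement's English description precedes it below -/
import Mathlib

section
/- Let (M,d) be a metric space, (Ω,F) a measurable space, ε > 0, and H a nonempty subset of M. Suppose Â assigns to each D ∈ H a probability measure Â(D) on (Ω,F) and is ε-differentially private on H, i.e. for all D, D' ∈ H and all measurable sets S, Â(D)(S) ≤ exp(ε·d(D,D'))·Â(D')(S). Then there exists an assignment A of a probability measure A(D) on (Ω,F) to every D ∈ M such that: (i) A is 2ε-differentially private on M, i.e. for all D, D' ∈ M and all measurable S, A(D)(S) ≤ exp(2ε·d(D,D'))·A(D')(S); and (ii) A(D) = Â(D) for every D ∈ H. -/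
open MeasureTheory

/-- **Extension of differentially private algorithms.**
If `Â` is an `ε`-differentially private algorithm (with respect to the metric `d`) defined on a
nonempty subset `H` of the input metric space `M`, outputting probability measures on a measurable
space `Ω`, then there is an algorithm `A` defined on all of `M` which is `2ε`-differentially
private and agrees with `Â` on `H`. -/
theorem extend_private_algorithm
    {M Ω : Type*} [MetricSpace M] [MeasurableSpace Ω]
    (ε : ℝ) (hε : 0 < ε) (H : Set M) (hH : H.Nonempty)
    (Ahat : M → Measure Ω)
    (hprob : ∀ D ∈ H, IsProbabilityMeasure (Ahat D))
    (hdp : ∀ D ∈ H, ∀ D' ∈ H, ∀ S : Set Ω, MeasurableSet S →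
      Ahat D S ≤ ENNReal.ofReal (Real.exp (ε * dist D D')) * Ahat D' S) :
    ∃ A : M → Measure Ω,
      (∀ D, IsProbabilityMeasure (A D)) ∧
      (∀ D D' : M, ∀ S : Set Ω, MeasurableSet S →
        A D S ≤ ENNReal.ofReal (Real.exp (2 * ε * dist D D')) * A D' S) ∧
      (∀ D ∈ H, A D = Ahat D) := by
  classical
  obtain ⟨c, hc⟩ : ∃ c : M → M → ENNReal,
      c = fun D D' => ENNReal.ofReal (Real.exp (ε * dist D D')) := ⟨_, rfl⟩
  have c0 : ∀ D D', c D D' ≠ 0 := by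
    intro D D'
    simp [hc, Real.exp_pos]
  have ct : ∀ D D', c D D' ≠ ⊤ := by
    intro D D'
    simp [hc]
  have cself : ∀ D, c D D = 1 := by
    intro D
    simp [hc]
  have csymm : ∀ D D', c D D' = c D' D := by
    intro D D'
    simp [hc, dist_comm]
  have ctri : ∀ D D' E, c D E ≤ c D D' * c D' E := by
    intro D D' E
    simp only [hc]
    rw [← ENNReal.ofReal_mul (Real.exp_pos _).le, ← Real.exp_add, ← mul_add]
    apply ENNReal.ofReal_le_ofReal
    apply Real.exp_le_exp.2
    exact mul_le_mul_of_nonneg_left (dist_triangle _ _ _) hε.le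
  have c2 : ∀ D D', ENNReal.ofReal (Real.exp (2 * ε * dist D D')) = c D D' * c D D' := by
    intro D D'
    simp only [hc]
    rw [← ENNReal.ofReal_mul (Real.exp_pos _).le, ← Real.exp_add]
    congr 2
    ring
  have hdp' : ∀ D ∈ H, ∀ D' ∈ H, ∀ S : Set Ω, MeasurableSet S →
      Ahat D S ≤ c D D' * Ahat D' S := by
    simpa only [hc] using hdp
  obtain ⟨μ, hμ⟩ : ∃ μ : M → Measure Ω, μ = fun D => ⨅ h : H, c D h • Ahat h := ⟨_, rfl⟩
  have μle : ∀ D, ∀ h ∈ H, ∀ S, μ D S ≤ c D h * Ahat h S := by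
    intro D h hh S
    have h1 : μ D ≤ c D h • Ahat h := by
      rw [hμ]
      exact iInf_le (fun h : H => c D h • Ahat h) ⟨h, hh⟩
    exact h1 S
  have leμ : ∀ D (ν : Measure Ω), (∀ h ∈ H, ∀ S, MeasurableSet S → ν S ≤ c D h * Ahat h S) →
      ν ≤ μ D := by
    intro D ν hν
    rw [hμ]
    refine le_iInf fun h => Measure.le_iff.2 fun S hS => ?_
    exact hν h h.2 S hS
  have μμ : ∀ D D' S, μ D S ≤ c D D' * μ D' S := by
    intro D D' S
    have h1 : (c D D')⁻¹ • μ D ≤ μ D' := by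
      apply leμ
      intro h hh S hS
      rw [Measure.smul_apply, smul_eq_mul, ENNReal.inv_mul_le_iff (c0 _ _) (ct _ _), ← mul_assoc]
      exact (μle D h hh S).trans (mul_le_mul_left (ctri _ _ _) _)
    have h2 := h1 S
    rwa [Measure.smul_apply, smul_eq_mul, ENNReal.inv_mul_le_iff (c0 _ _) (ct _ _)] at h2
  have μH : ∀ D ∈ H, μ D = Ahat D := by
    intro D hD
    apply le_antisymm
    · intro S
      simpa [cself] using μle D D hD S
    · exact leμ D _ fun h hh S hS => hdp' D hD h hh S hS
  obtain ⟨h₀, hh₀⟩ := hH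
  have Zh : μ h₀ Set.univ = 1 := by
    have := hprob h₀ hh₀
    rw [μH h₀ hh₀, measure_univ]
  have Z0 : ∀ D, μ D Set.univ ≠ 0 := by
    intro D h
    have := μμ h₀ D Set.univ
    simp [h, Zh] at this
  have Zt : ∀ D, μ D Set.univ ≠ ⊤ := by
    intro D h
    have := μμ D h₀ Set.univ
    rw [h, Zh, mul_one, top_le_iff] at this
    exact ct _ _ this
  refine ⟨fun D => (μ D Set.univ)⁻¹ • μ D, fun D => ⟨?_⟩, fun D D' S _ => ?_, fun D hD => ?_⟩
  · rw [Measure.smul_apply, smul_eq_mul, ENNReal.inv_mul_cancel (Z0 D) (Zt D)]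
  · rw [Measure.smul_apply, Measure.smul_apply, smul_eq_mul, smul_eq_mul, c2]
    have hZ : (μ D Set.univ)⁻¹ ≤ c D D' * (μ D' Set.univ)⁻¹ := by
      have h1 := μμ D' D Set.univ
      rw [csymm D' D] at h1
      rw [← ENNReal.inv_le_inv, ENNReal.mul_inv (Or.inl (c0 _ _)) (Or.inl (ct _ _)), inv_inv,
        inv_inv, ENNReal.inv_mul_le_iff (c0 _ _) (ct _ _)]
      exact h1
    calc (μ D Set.univ)⁻¹ * μ D S
        ≤ (c D D' * (μ D' Set.univ)⁻¹) * (c D D' * μ D' S) := mul_le_mul' hZ (μμ D D' S)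
      _ = _ := by ring
  · have := hprob D hD
    simp [μH D hD]
end

section
/- There exist constants c > 0 and n₀ ∈ ℕ such that for all n ≥ n₀ and all integers m with C(n,2)/3 ≤ m ≤ C(n,2), a graph G₀ sampled from G(n,m) satisfies P(the minimum degree of G₀ is at least n/5) ≥ 1 − 2^{−c·n}. -/
open MeasureTheory ProbabilityTheory

noncomputable section

instance {n : ℕ} : MeasurableSpace (SimpleGraph (Fin n)) := ⊤

/-- The number of edges of a simple graph on `n` vertices. -/
def edgeCount {n : ℕ} (G : SimpleGraph (Fin n)) : ℕ := G.edgeSet.ncard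

/-- The uniform distribution `G(n,m)` on graphs on `n` vertices with exactly `m` edges. -/
def gnm (n m : ℕ) : Measure (SimpleGraph (Fin n)) :=
  uniformOn {G : SimpleGraph (Fin n) | edgeCount G = m}

/-- The degree of a vertex. -/
def deg {n : ℕ} (G : SimpleGraph (Fin n)) (v : Fin n) : ℕ := (G.neighborSet v).ncard

lemma choose_step (M m : ℕ) (h : M + 1 ≤ 3 * m) : (M.choose m : ℝ) ≤ 2/3 * ((M+1).choose m : ℝ) := by
  rcases Nat.lt_or_ge M m with h1 | h1
  · rw [Nat.choose_eq_zero_of_lt h1]; simp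
  · have h2 := Nat.choose_mul_succ_eq M m
    have h3 : (M.choose m : ℝ) * (M+1) = ((M+1).choose m : ℝ) * ((M:ℝ)+1-m) := by
      have := congrArg (Nat.cast : ℕ → ℝ) h2
      push_cast [Nat.cast_sub (show m ≤ M+1 by omega)] at this
      exact this
    have h4 : (M:ℝ) + 1 ≤ 3 * m := by exact_mod_cast h
    have h5 : (0:ℝ) ≤ ((M+1).choose m : ℝ) := by positivity
    have h6 : (0:ℝ) < (M:ℝ)+1 := by positivity
    refine le_of_mul_le_mul_right ?_ h6
    rw [h3]
    nlinarith

lemma choose_iter (N m : ℕ) (h : N ≤ 3 * m) (j : ℕ) (hj : j ≤ N) :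
    ((N - j).choose m : ℝ) ≤ (2/3)^j * (N.choose m : ℝ) := by
  induction j with
  | zero => simp
  | succ j ih =>
    have h1 := ih (by omega)
    have h2 := choose_step (N - (j+1)) m (by omega)
    rw [show N - (j+1) + 1 = N - j by omega] at h2
    rw [pow_succ]
    linarith

lemma key_sum {α : Type*} [DecidableEq α] (U S : Finset α) (hS : S ⊆ U) (m : ℕ)
    (h : U.card ≤ 3 * m) :
    (∑ E ∈ U.powersetCard m, (2:ℝ)^((S \ E).card)) ≤ (5/3)^S.card * (U.card.choose m : ℝ) := by
  have e1 : ∀ E ∈ U.powersetCard m, (2:ℝ)^((S \ E).card)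
      = ∑ T ∈ S.powerset, if Disjoint T E then (1:ℝ) else 0 := by
    intro E _
    rw [Finset.sum_boole]
    have : S.powerset.filter (fun T => Disjoint T E) = (S \ E).powerset := by
      ext T
      simp [Finset.subset_sdiff]
    rw [this, Finset.card_powerset]; push_cast; rfl
  rw [Finset.sum_congr rfl e1, Finset.sum_comm]
  have e2 : ∀ T ∈ S.powerset, (∑ E ∈ U.powersetCard m, if Disjoint T E then (1:ℝ) else 0)
      ≤ (2/3)^T.card * 1^(S.card - T.card) * (U.card.choose m : ℝ) := by
    intro T hT
    have hTU : T ⊆ U := (Finset.mem_powerset.1 hT).trans hS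
    rw [Finset.sum_boole]
    have : (U.powersetCard m).filter (fun E => Disjoint T E) = (U \ T).powersetCard m := by
      ext E
      simp only [Finset.mem_filter, Finset.mem_powersetCard, Finset.subset_sdiff, disjoint_comm]
      tauto
    rw [this, Finset.card_powersetCard, Finset.card_sdiff_of_subset hTU, one_pow, mul_one]
    exact choose_iter _ _ h _ (Finset.card_le_card hTU)
  refine (Finset.sum_le_sum e2).trans ?_
  rw [← Finset.sum_mul, Finset.sum_pow_mul_eq_add_pow]
  norm_num

/-- Count of edge sets with few elements in `S`. -/
lemma key_count {α : Type*} [DecidableEq α] (U S : Finset α) (hS : S ⊆ U) (m n : ℕ)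
    (h : U.card ≤ 3 * m) (hn : S.card + 1 = n) :
    (((U.powersetCard m).filter (fun E => ((S ∩ E).card : ℝ) < (n:ℝ)/5)).card : ℝ)
      ≤ 2 * ((5/3) / (2:ℝ)^((4:ℝ)/5))^n * (U.card.choose m : ℝ) := by
  set F := (U.powersetCard m).filter (fun E => ((S ∩ E).card : ℝ) < (n:ℝ)/5) with hF
  have h1 : (F.card : ℝ) * ((2:ℝ)^((4:ℝ)/5 * n - 1)) ≤ (5/3)^S.card * (U.card.choose m : ℝ) := by
    refine le_trans ?_ (key_sum U S hS m h)
    refine le_trans ?_ (Finset.sum_le_sum_of_subset_of_nonneg (Finset.filter_subset _ _)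
      (fun _ _ _ => by positivity) : ∑ E ∈ F, (2:ℝ)^((S \ E).card) ≤ _)
    rw [← nsmul_eq_mul]
    apply Finset.card_nsmul_le_sum
    intro E hE
    have hE2 := (Finset.mem_filter.1 hE).2
    have hc : ((S \ E).card : ℝ) + (S ∩ E).card + 1 = n := by
      rw [← hn, ← Finset.card_sdiff_add_card_inter S E]; push_cast; ring
    rw [← Real.rpow_natCast]
    apply Real.rpow_le_rpow_of_exponent_le (by norm_num)
    linarith
  have h2 : ((5:ℝ)/3)^S.card ≤ (5/3)^n := pow_le_pow_right₀ (by norm_num) (by omega)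
  have h3 : (2:ℝ)^((4:ℝ)/5 * n - 1) = ((2:ℝ)^((4:ℝ)/5))^n / 2 := by
    rw [Real.rpow_sub_one (by norm_num), Real.rpow_mul (by norm_num), Real.rpow_natCast]
  rw [h3] at h1
  have h4 : (0:ℝ) < ((2:ℝ)^((4:ℝ)/5))^n := by positivity
  rw [div_pow, mul_div_assoc', div_mul_eq_mul_div, le_div_iff₀ h4]
  have h5 : (0:ℝ) ≤ (U.card.choose m : ℝ) := by positivity
  nlinarith [mul_le_mul_of_nonneg_right h2 h5]

lemma rho_lt : ((5:ℝ)/3) / (2:ℝ)^((4:ℝ)/5) < 1 := by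
  rw [div_lt_one (by positivity)]
  refine lt_of_pow_lt_pow_left₀ 5 (by positivity) ?_
  rw [← Real.rpow_natCast ((2:ℝ)^((4:ℝ)/5)), ← Real.rpow_mul (by norm_num)]
  norm_num

lemma exists_consts : ∃ c : ℝ, 0 < c ∧ ∃ n₀ : ℕ, ∀ n : ℕ, n₀ ≤ n →
    (n:ℝ) * (2 * ((5/3) / (2:ℝ)^((4:ℝ)/5))^n) ≤ (2:ℝ)^(-(c*n)) := by
  set ρ : ℝ := ((5:ℝ)/3) / (2:ℝ)^((4:ℝ)/5) with hρ
  have h0 : 0 < ρ := by positivity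
  have h1 : ρ < 1 := rho_lt
  set s := Real.sqrt ρ with hs
  have s0 : 0 < s := Real.sqrt_pos.2 h0
  have s1 : s < 1 := by rw [hs, Real.sqrt_lt' one_pos]; simpa using h1
  have ss : s * s = ρ := Real.mul_self_sqrt h0.le
  refine ⟨-Real.logb 2 s, neg_pos.2 (Real.logb_neg (by norm_num) s0 s1), ?_⟩
  have ht := (tendsto_self_mul_const_pow_of_lt_one s0.le s1).eventually_le_const
    (show (0:ℝ) < 1/2 by norm_num)
  obtain ⟨n₀, hn₀⟩ := Filter.eventually_atTop.1 ht
  refine ⟨n₀, fun n hn => ?_⟩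
  have e : (2:ℝ)^(-(-Real.logb 2 s * n)) = s^n := by
    rw [neg_mul, neg_neg, Real.rpow_mul (by norm_num), Real.rpow_logb (by norm_num) (by norm_num) s0,
      Real.rpow_natCast]
  rw [e, ← ss, mul_pow]
  have := hn₀ n hn
  have hp : 0 < s^n := by positivity
  nlinarith

open Classical in
lemma gnm_total (n m : ℕ) :
    (n.choose 2).choose m ≤ {G : SimpleGraph (Fin n) | edgeCount G = m}.ncard := by
  set U := (⊤ : SimpleGraph (Fin n)).edgeFinset with hU
  have hUc : U.card = n.choose 2 := by
    rw [hU]; convert SimpleGraph.card_edgeFinset_top_eq_card_choose_two (V := Fin n); simp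
  have h1 : (U.powersetCard m).card = (n.choose 2).choose m := by
    rw [Finset.card_powersetCard, hUc]
  rw [← h1, ← Set.ncard_coe_finset]
  have key : ∀ E ∈ U.powersetCard m, (SimpleGraph.fromEdgeSet (E : Set (Sym2 (Fin n)))).edgeSet = E := by
    intro E hE
    have hE' := (Finset.mem_powersetCard.1 hE).1
    rw [SimpleGraph.edgeSet_fromEdgeSet, sdiff_eq_left, Set.disjoint_left]
    intro e he hd
    have := hE' he
    rw [hU, SimpleGraph.mem_edgeFinset] at this
    exact SimpleGraph.not_isDiag_of_mem_edgeSet _ this hd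
  refine Set.ncard_le_ncard_of_injOn (fun E => SimpleGraph.fromEdgeSet (E : Set (Sym2 (Fin n)))) ?_ ?_ (Set.toFinite _)
  · intro E hE
    have hE := Finset.mem_coe.1 hE
    simp only [Set.mem_setOf_eq, edgeCount]
    rw [key E hE, Set.ncard_coe_finset]
    exact (Finset.mem_powersetCard.1 hE).2
  · intro E hE F hF hEF
    have h2 := congrArg SimpleGraph.edgeSet hEF
    simp only at h2
    rw [key E hE, key F hF] at h2
    exact_mod_cast h2

open Classical in
lemma gnm_bad (n m : ℕ) (hm : n.choose 2 ≤ 3 * m) (v : Fin n) :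
    (({G : SimpleGraph (Fin n) | edgeCount G = m ∧ (deg G v : ℝ) < (n:ℝ)/5}.ncard : ℕ) : ℝ)
      ≤ 2 * ((5/3) / (2:ℝ)^((4:ℝ)/5))^n * ((n.choose 2).choose m : ℝ) := by
  set U := (⊤ : SimpleGraph (Fin n)).edgeFinset with hU
  have hUc : U.card = n.choose 2 := by
    rw [hU]; convert SimpleGraph.card_edgeFinset_top_eq_card_choose_two (V := Fin n); simp
  set S := (⊤ : SimpleGraph (Fin n)).incidenceFinset v with hS
  have hSf : S = U.filter (fun e => v ∈ e) := SimpleGraph.incidenceFinset_eq_filter _ _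
  have hSc : S.card + 1 = n := by
    have h1 : S.card = n - 1 := by
      rw [hS, SimpleGraph.card_incidenceFinset_eq_degree]
      have := SimpleGraph.complete_graph_degree v
      simp only [Fintype.card_fin] at this
      rw [← this]
    have := v.pos
    omega
  have hk := key_count U S (by rw [hSf]; exact Finset.filter_subset _ _) m n (by omega) hSc
  rw [hUc] at hk
  refine le_trans ?_ hk
  rw [Nat.cast_le, ← Set.ncard_coe_finset]
  refine Set.ncard_le_ncard_of_injOn (fun G => G.edgeFinset) ?_ ?_ (Set.toFinite _)
  · rintro G ⟨hG1, hG2⟩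
    have hsub : G.edgeFinset ⊆ U := by
      rw [hU]; exact SimpleGraph.edgeFinset_mono le_top
    have hd : S ∩ G.edgeFinset = G.incidenceFinset v := by
      rw [SimpleGraph.incidenceFinset_eq_filter, hSf]
      ext e
      simp only [Finset.mem_inter, Finset.mem_filter]
      constructor
      · rintro ⟨⟨_, h2⟩, h3⟩; exact ⟨h3, h2⟩
      · rintro ⟨h3, h2⟩; exact ⟨⟨hsub h3, h2⟩, h3⟩
    rw [Finset.mem_coe, Finset.mem_filter, Finset.mem_powersetCard, hd,
      SimpleGraph.card_incidenceFinset_eq_degree]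
    refine ⟨⟨hsub, ?_⟩, ?_⟩
    · rw [← hG1, edgeCount, Set.ncard_eq_toFinset_card']; rfl
    · have : deg G v = G.degree v := by
        rw [deg, Set.ncard_eq_toFinset_card']; rfl
      rw [← this]; exact hG2
  · intro G _ H _ h
    exact SimpleGraph.edgeFinset_inj.1 h

instance instMSC {n : ℕ} : MeasurableSingletonClass (SimpleGraph (Fin n)) := ⟨fun _ => trivial⟩

/-- For `C(n,2)/3 ≤ m ≤ C(n,2)`, a graph sampled from `G(n,m)` has minimum degree at least
`n/5` with probability at least `1 - 2^{-c n}`. -/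
theorem gnm_min_degree :
    ∃ c : ℝ, 0 < c ∧ ∃ n₀ : ℕ, ∀ n : ℕ, n₀ ≤ n → ∀ m : ℕ,
      (n.choose 2 : ℝ) / 3 ≤ (m : ℝ) → m ≤ n.choose 2 →
      ENNReal.ofReal (1 - (2 : ℝ) ^ (-(c * n)))
        ≤ gnm n m {G : SimpleGraph (Fin n) | ∀ v : Fin n, (n : ℝ) / 5 ≤ (deg G v : ℝ)} := by
  obtain ⟨c, hc, n₀, hn₀⟩ := exists_consts
  refine ⟨c, hc, n₀, fun n hn m hm1 hm2 => ?_⟩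
  have hm : n.choose 2 ≤ 3 * m := by
    have : (n.choose 2 : ℝ) ≤ 3 * m := by linarith
    exact_mod_cast this
  set A : Set (SimpleGraph (Fin n)) := {G | edgeCount G = m} with hA
  have htot := gnm_total n m
  rw [← hA] at htot
  have hpos : 0 < (n.choose 2).choose m := Nat.choose_pos hm2
  have hApos : 0 < A.ncard := lt_of_lt_of_le hpos htot
  have hAne : A.Nonempty := (Set.ncard_pos (Set.toFinite _)).1 hApos
  have hcount : ∀ s : Set (SimpleGraph (Fin n)), Measure.count s = ENNReal.ofReal (s.ncard : ℝ) := by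
    intro s
    rw [Measure.count_apply (Set.toFinite s).measurableSet, ENNReal.ofReal_natCast, ← Set.Finite.cast_ncard_eq (Set.toFinite s)]
    rfl
  set Good : Set (SimpleGraph (Fin n)) := {G | ∀ v : Fin n, (n : ℝ) / 5 ≤ (deg G v : ℝ)} with hGood
  have hcompl := uniformOn_compl (s := A) Good (Set.toFinite _) hAne
  set B : Fin n → Set (SimpleGraph (Fin n)) :=
    fun v => {G | edgeCount G = m ∧ (deg G v : ℝ) < (n:ℝ)/5} with hB
  have hbadsub : A ∩ Goodᶜ ⊆ ⋃ v, B v := by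
    rintro G ⟨h1, h2⟩
    simp only [hGood, Set.mem_compl_iff, Set.mem_setOf_eq, not_forall, not_le] at h2
    obtain ⟨v, hv⟩ := h2
    exact Set.mem_iUnion.2 ⟨v, h1, hv⟩
  have hbad : uniformOn A Goodᶜ ≤ ENNReal.ofReal ((2:ℝ)^(-(c*n))) := by
    rw [uniformOn, cond_apply (Set.toFinite A).measurableSet, mul_comm, ← div_eq_mul_inv]
    have h1 : (Measure.count (A ∩ Goodᶜ)) ≤
        ENNReal.ofReal ((2:ℝ)^(-(c*n)) * A.ncard) := by
      refine (measure_mono hbadsub).trans ((measure_iUnion_fintype_le _ _).trans ?_)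
      simp only [hcount]
      rw [← ENNReal.ofReal_sum_of_nonneg (fun _ _ => by positivity)]
      apply ENNReal.ofReal_le_ofReal
      refine (Finset.sum_le_sum (fun v _ => gnm_bad n m hm v)).trans ?_
      rw [Finset.sum_const, Finset.card_univ, Fintype.card_fin, nsmul_eq_mul, ← mul_assoc]
      have htot' : ((n.choose 2).choose m : ℝ) ≤ A.ncard := by exact_mod_cast htot
      exact mul_le_mul (hn₀ n hn) htot' (by positivity) (by positivity)
    rw [hcount A]
    refine ENNReal.div_le_of_le_mul (h1.trans ?_)
    rw [ENNReal.ofReal_mul (by positivity)]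
  rw [ENNReal.ofReal_sub _ (by positivity), ENNReal.ofReal_one]
  change _ ≤ uniformOn A Good
  rw [tsub_le_iff_right, ← hcompl]
  gcongr

end
end

section
/- For every C > 48 there exists a constant K = K(C) such that for all n ≥ 2, all ρ ∈ [0,1], and all integers m with m ≤ ρ·C(n,2), a graph G sampled from the uniform distribution G(n,m) satisfies P(G ∉ H_{ρ,C}) ≤ K·n^{−(C/16 − 3)}. -/
open MeasureTheory ProbabilityTheory

noncomputable section

/-- The edge density `e(G)` of a graph on `n` vertices. -/
def eDens {n : ℕ} (G : SimpleGraph (Fin n)) : ℝ := (edgeCount G : ℝ) / (n.choose 2 : ℝ)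

/-- `E_G(S, Sᶜ)`: the number of edges of `G` between `S` and its complement. -/
def crossEdges {n : ℕ} (G : SimpleGraph (Fin n)) (S : Finset (Fin n)) : ℕ :=
  Set.ncard {p : Fin n × Fin n | p.1 ∈ S ∧ p.2 ∉ S ∧ G.Adj p.1 p.2}

/-- `E_G(S)`: the number of edges of `G` with both endpoints in `S`. -/
def insideEdges {n : ℕ} (G : SimpleGraph (Fin n)) (S : Finset (Fin n)) : ℕ :=
  Set.ncard {e ∈ G.edgeSet | ∀ v ∈ e, v ∈ S}

/-- The `S`-homogeneity condition at level `t`. -/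
def HomogCond {n : ℕ} (ρ C t : ℝ) (G : SimpleGraph (Fin n)) (S : Finset (Fin n)) : Prop :=
  |((crossEdges G S : ℝ) + (insideEdges G S : ℝ))
      - t * ((S.card : ℝ) * ((n : ℝ) - (S.card : ℝ)) + (S.card.choose 2 : ℝ))|
    ≤ C * max (Real.sqrt ρ) (Real.sqrt (Real.log n / n)) * (S.card : ℝ)
        * Real.sqrt ((n : ℝ) * Real.log n)

/-- The homogeneity set `H_{ρ,C}`: graphs of edge density at most `ρ` satisfying the
`S`-homogeneity condition at level `e(G)` for every nonempty `S`. -/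
def homogSet (n : ℕ) (ρ C : ℝ) : Set (SimpleGraph (Fin n)) :=
  {G | eDens G ≤ ρ ∧ ∀ S : Finset (Fin n), S.Nonempty → HomogCond ρ C (eDens G) G S}

lemma aux_choose (M N k : ℕ) (h : M ≤ N) : M.choose k * N ^ k ≤ N.choose k * M ^ k := by
  have key : M.descFactorial k * N ^ k ≤ N.descFactorial k * M ^ k := by
    induction k with
    | zero => simp
    | succ k ih =>
      rw [Nat.descFactorial_succ, Nat.descFactorial_succ, pow_succ, pow_succ]
      have h1 : (M - k) * N ≤ (N - k) * M := by
        rw [Nat.sub_mul, Nat.sub_mul, mul_comm M N]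
        exact Nat.sub_le_sub_left (Nat.mul_le_mul_left k h) _
      calc (M - k) * M.descFactorial k * (N ^ k * N)
          = ((M - k) * N) * (M.descFactorial k * N ^ k) := by ring
        _ ≤ ((N - k) * M) * (N.descFactorial k * M ^ k) := Nat.mul_le_mul h1 ih
        _ = _ := by ring
  rw [Nat.descFactorial_eq_factorial_mul_choose, Nat.descFactorial_eq_factorial_mul_choose,
    mul_assoc, mul_assoc] at key
  exact Nat.le_of_mul_le_mul_left key (Nat.factorial_pos k)

lemma aux_super {α : Type*} [DecidableEq α] (E T : Finset α) (m : ℕ) (hT : T ⊆ E) :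
    ((E.powersetCard m).filter (fun A => T ⊆ A)).card
      ≤ if T.card ≤ m then (E.card - T.card).choose (m - T.card) else 0 := by
  split_ifs with h
  · have : (E.card - T.card).choose (m - T.card)
        = ((E \ T).powersetCard (m - T.card)).card := by
      rw [Finset.card_powersetCard, Finset.card_sdiff_of_subset hT]
    rw [this]
    apply Finset.card_le_card_of_injOn (fun A => A \ T)
    · intro A hA
      simp only [Finset.coe_filter, Finset.mem_powersetCard, Set.mem_ofPred_eq] at hA
      simp only [Finset.mem_coe, Finset.mem_powersetCard]
      refine ⟨Finset.sdiff_subset_sdiff hA.1.1 (le_refl _), ?_⟩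
      rw [Finset.card_sdiff_of_subset hA.2, hA.1.2]
    · intro A hA A' hA' hh
      simp only [Finset.coe_filter, Finset.mem_powersetCard, Set.mem_ofPred_eq] at hA hA'
      simp only at hh
      rw [← Finset.sdiff_union_of_subset hA.2, hh, Finset.sdiff_union_of_subset hA'.2]
  · rw [Nat.le_zero, Finset.card_eq_zero, Finset.filter_eq_empty_iff]
    intro A hA hTA
    rw [Finset.mem_powersetCard] at hA
    have := Finset.card_le_card hTA
    omega

lemma aux_mgf {α : Type*} [DecidableEq α] (E B : Finset α) (m : ℕ) (hB : B ⊆ E)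
    (hm : m ≤ E.card) (hN : 0 < E.card) (y : ℝ) (hy : 0 ≤ y) :
    ∑ A ∈ E.powersetCard m, (1 + y) ^ (A ∩ B).card
      ≤ (E.card.choose m : ℝ) * (1 + y * (B.card / E.card : ℝ)) ^ m := by
  have h1 : ∀ A : Finset α, (1 + y) ^ (A ∩ B).card = ∑ T ∈ (A ∩ B).powerset, y ^ T.card := by
    intro A
    have := Finset.sum_pow_mul_eq_add_pow y 1 (A ∩ B)
    simp only [one_pow, mul_one] at this
    rw [this, add_comm]
  set g : ℕ → ℝ := fun k =>
    (((if k ≤ m then (E.card - k).choose (m - k) else 0 : ℕ) : ℝ)) * y ^ k with hg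
  set h : ℕ → ℝ := fun k =>
    (E.card.choose m : ℝ) * ((y * (B.card / E.card : ℝ)) ^ k * (m.choose k : ℝ)) with hh
  have hNr : (0 : ℝ) < E.card := by exact_mod_cast hN
  have hpos : ∀ k, 0 ≤ h k := fun k => by simp only [hh]; positivity
  calc ∑ A ∈ E.powersetCard m, (1 + y) ^ (A ∩ B).card
      = ∑ A ∈ E.powersetCard m, ∑ T ∈ (A ∩ B).powerset, y ^ T.card :=
        Finset.sum_congr rfl (fun A _ => h1 A)
    _ = ∑ T ∈ B.powerset, ∑ A ∈ (E.powersetCard m).filter (fun A => T ⊆ A), y ^ T.card := by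
        apply Finset.sum_comm'
        intro A T
        simp only [Finset.mem_powerset, Finset.mem_filter, Finset.subset_inter_iff]
        tauto
    _ ≤ ∑ T ∈ B.powerset, g T.card := by
        apply Finset.sum_le_sum
        intro T hT
        rw [Finset.sum_const, nsmul_eq_mul]
        simp only [hg]
        apply mul_le_mul_of_nonneg_right _ (pow_nonneg hy _)
        exact_mod_cast aux_super E T m ((Finset.mem_powerset.1 hT).trans hB)
    _ = ∑ k ∈ Finset.range (B.card + 1), B.card.choose k • g k :=
        Finset.sum_powerset_apply_card _
    _ ≤ ∑ k ∈ Finset.range (B.card + 1), h k := by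
        apply Finset.sum_le_sum
        intro k _
        simp only [hg, hh, nsmul_eq_mul]
        split_ifs with hk
        · have e1 := aux_choose B.card E.card k (Finset.card_le_card hB)
          have e2 := Nat.choose_mul (n := E.card) hk
          have e1' : (B.card.choose k : ℝ) ≤ E.card.choose k * (B.card / E.card : ℝ) ^ k := by
            rw [div_pow, ← mul_div_assoc, le_div_iff₀ (by positivity)]
            exact_mod_cast e1
          have e2' : (E.card.choose m : ℝ) * m.choose k
            = E.card.choose k * (E.card - k).choose (m - k) := by exact_mod_cast e2
          calc (B.card.choose k : ℝ) * (((E.card - k).choose (m - k) : ℕ) * y ^ k)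
              ≤ (E.card.choose k * (B.card / E.card : ℝ) ^ k)
                * (((E.card - k).choose (m - k) : ℕ) * y ^ k) := by gcongr
            _ = (E.card.choose k * (E.card - k).choose (m - k))
                * (y * (B.card / E.card : ℝ)) ^ k := by rw [mul_pow]; ring
            _ = _ := by rw [← e2']; ring
        · simpa using hpos k
    _ ≤ ∑ k ∈ Finset.range (B.card + m + 1), h k := by
        apply Finset.sum_le_sum_of_subset_of_nonneg
        · intro k; simp only [Finset.mem_range]; omega
        · intro k _ _; exact hpos k
    _ = ∑ k ∈ Finset.range (m + 1), h k := by
        symm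
        apply Finset.sum_subset
        · intro k; simp only [Finset.mem_range]; omega
        · intro k _ hk
          simp only [Finset.mem_range] at hk
          simp only [hh]
          rw [Nat.choose_eq_zero_of_lt (show m < k by omega)]
          simp
    _ = _ := by
        simp only [hh]
        rw [← Finset.mul_sum, add_comm (1 : ℝ), add_pow]
        simp

lemma aux_mgf_exp {α : Type*} [DecidableEq α] (E B : Finset α) (m : ℕ) (hB : B ⊆ E)
    (hm : m ≤ E.card) (hN : 0 < E.card) (u : ℝ) :
    ∑ A ∈ E.powersetCard m, Real.exp (u * (A ∩ B).card)
      ≤ (E.card.choose m : ℝ) * Real.exp (m * (B.card / E.card : ℝ) * (Real.exp u - 1)) := by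
  have hNr : (0 : ℝ) < E.card := by exact_mod_cast hN
  set p : ℝ := (B.card / E.card : ℝ) with hp
  have hp0 : 0 ≤ p := by positivity
  have hp1 : p ≤ 1 := by
    rw [hp, div_le_one hNr]; exact_mod_cast Finset.card_le_card hB
  have key : ∑ A ∈ E.powersetCard m, Real.exp (u * (A ∩ B).card)
      ≤ (E.card.choose m : ℝ) * (1 + p * (Real.exp u - 1)) ^ m := by
    rcases le_or_gt 0 u with hu | hu
    · have := aux_mgf E B m hB hm hN (Real.exp u - 1) (by linarith [Real.add_one_le_exp u])
      rw [← hp] at this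
      rw [mul_comm p]
      refine le_trans (le_of_eq ?_) this
      refine Finset.sum_congr rfl (fun A _ => ?_)
      rw [add_sub_cancel, ← Real.exp_nat_mul, mul_comm]
    · have := aux_mgf E (E \ B) m Finset.sdiff_subset hm hN (Real.exp (-u) - 1)
        (by linarith [Real.add_one_le_exp (-u)])
      have hq : (((E \ B).card : ℝ) / E.card) = 1 - p := by
        rw [Finset.card_sdiff_of_subset hB, Nat.cast_sub (Finset.card_le_card hB), hp]
        field_simp
      rw [hq] at this
      have e : ∑ A ∈ E.powersetCard m, Real.exp (u * (A ∩ B).card)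
          = Real.exp u ^ m *
            ∑ A ∈ E.powersetCard m, (1 + (Real.exp (-u) - 1)) ^ (A ∩ (E \ B)).card := by
        rw [Finset.mul_sum]
        refine Finset.sum_congr rfl (fun A hA => ?_)
        rw [Finset.mem_powersetCard] at hA
        have hc : (A ∩ B).card + (A ∩ (E \ B)).card = m := by
          have : A ∩ (E \ B) = A \ B := by
            ext x
            simp only [Finset.mem_inter, Finset.mem_sdiff]
            have := @hA.1 x
            tauto
          rw [this, Finset.card_inter_add_card_sdiff, hA.2]
        have hc' : (m : ℝ) = (A ∩ B).card + (A ∩ (E \ B)).card := by exact_mod_cast hc.symm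
        rw [add_sub_cancel, ← Real.exp_nat_mul, ← Real.exp_nat_mul, ← Real.exp_add, hc']
        congr 1
        ring
      rw [e]
      calc _ ≤ Real.exp u ^ m * ((E.card.choose m : ℝ) *
              (1 + (Real.exp (-u) - 1) * (1 - p)) ^ m) := by gcongr
        _ = (E.card.choose m : ℝ) *
              (Real.exp u * (1 + (Real.exp (-u) - 1) * (1 - p))) ^ m := by
            rw [mul_pow]; ring
        _ = _ := by
            have : Real.exp u * Real.exp (-u) = 1 := by rw [← Real.exp_add]; simp
            congr 2
            linear_combination (1 - p) * this
  refine key.trans ?_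
  gcongr
  rw [mul_assoc, Real.exp_nat_mul]
  have : 0 ≤ 1 + p * (Real.exp u - 1) := by
    nlinarith [Real.exp_pos u, mul_nonneg hp0 (Real.exp_pos u).le]
  gcongr
  linarith [Real.add_one_le_exp (p * (Real.exp u - 1))]

lemma aux_tail {α : Type*} [DecidableEq α] (E B : Finset α) (m : ℕ) (hB : B ⊆ E)
    (hm : m ≤ E.card) (hN : 0 < E.card) (t l : ℝ) (ht0 : 0 ≤ t) (ht : t ≤ 1) :
    ((((E.powersetCard m).filter (fun A =>
        l < |((A ∩ B).card : ℝ) - m * (B.card / E.card : ℝ)|)).card : ℕ) : ℝ)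
      ≤ 2 * (E.card.choose m : ℝ)
        * Real.exp (m * (B.card / E.card : ℝ) * t ^ 2 - t * l) := by
  have hNr : (0 : ℝ) < E.card := by exact_mod_cast hN
  set p : ℝ := (B.card / E.card : ℝ) with hp
  have hp0 : 0 ≤ m * p := by positivity
  have bd : ∀ u : ℝ, |u| ≤ 1 → ∑ A ∈ E.powersetCard m, Real.exp (u * ((A ∩ B).card - m * p))
      ≤ (E.card.choose m : ℝ) * Real.exp (m * p * u ^ 2) := by
    intro u hu
    have h1 := aux_mgf_exp E B m hB hm hN u
    rw [← hp] at h1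
    have h2 := (abs_le.1 (Real.abs_exp_sub_one_sub_id_le hu)).2
    calc ∑ A ∈ E.powersetCard m, Real.exp (u * ((A ∩ B).card - m * p))
        = Real.exp (-(u * (m * p))) * ∑ A ∈ E.powersetCard m, Real.exp (u * (A ∩ B).card) := by
          rw [Finset.mul_sum]
          refine Finset.sum_congr rfl (fun A _ => ?_)
          rw [← Real.exp_add]; congr 1; ring
      _ ≤ Real.exp (-(u * (m * p))) *
          ((E.card.choose m : ℝ) * Real.exp (m * p * (Real.exp u - 1))) := by gcongr
      _ = (E.card.choose m : ℝ) * Real.exp (m * p * (Real.exp u - 1 - u)) := by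
          rw [mul_left_comm, ← Real.exp_add]; congr 2; ring
      _ ≤ _ := by gcongr
  have b1 := bd t (by rw [abs_of_nonneg ht0]; exact ht)
  have b2 := bd (-t) (by rw [abs_neg, abs_of_nonneg ht0]; exact ht)
  rw [neg_sq] at b2
  have hsum : ((((E.powersetCard m).filter (fun A =>
        l < |((A ∩ B).card : ℝ) - m * p|)).card : ℕ) : ℝ) * Real.exp (t * l)
      ≤ ∑ A ∈ E.powersetCard m, (Real.exp (t * ((A ∩ B).card - m * p))
          + Real.exp (-t * ((A ∩ B).card - m * p))) := by
    rw [← nsmul_eq_mul, ← Finset.sum_const]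
    refine le_trans (Finset.sum_le_sum (g := fun A => (Real.exp (t * ((A ∩ B).card - m * p))
          + Real.exp (-t * ((A ∩ B).card - m * p)))) ?_) ?_
    · intro A hA
      have hA := (Finset.mem_filter.1 hA).2
      rcases lt_abs.1 hA with h | h
      · have : Real.exp (t * l) ≤ Real.exp (t * ((A ∩ B).card - m * p)) := by gcongr
        linarith [Real.exp_pos (-t * ((A ∩ B).card - m * p))]
      · have : Real.exp (t * l) ≤ Real.exp (-t * ((A ∩ B).card - m * p)) := by
          rw [neg_mul_comm]; gcongr
        linarith [Real.exp_pos (t * ((A ∩ B).card - m * p))]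
    · apply Finset.sum_le_sum_of_subset_of_nonneg (Finset.filter_subset _ _)
      intros; positivity
  rw [Finset.sum_add_distrib] at hsum
  have e : 2 * (E.card.choose m : ℝ) * Real.exp (m * p * t ^ 2 - t * l)
      = 2 * (E.card.choose m : ℝ) * Real.exp (m * p * t ^ 2) / Real.exp (t * l) := by
    rw [Real.exp_sub]; ring
  rw [e, le_div_iff₀ (Real.exp_pos _)]
  linarith

/-- all potential edges -/
def allE (n : ℕ) : Finset (Sym2 (Fin n)) := Finset.univ.filter (fun e => ¬ e.IsDiag)

open Classical in
/-- potential edges touching `S` -/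
def touchE {n : ℕ} (S : Finset (Fin n)) : Finset (Sym2 (Fin n)) :=
  (allE n).filter (fun e => ∃ v ∈ e, v ∈ S)

open Classical in
/-- edges as a finset -/
def edgeF {n : ℕ} (G : SimpleGraph (Fin n)) : Finset (Sym2 (Fin n)) :=
  Finset.univ.filter (fun e => e ∈ G.edgeSet)

lemma edgeF_subset {n : ℕ} (G : SimpleGraph (Fin n)) : edgeF G ⊆ allE n := by
  intro e he
  simp only [edgeF, allE, Finset.mem_filter, Finset.mem_univ, true_and] at *
  exact G.not_isDiag_of_mem_edgeSet he

lemma card_edgeF {n : ℕ} (G : SimpleGraph (Fin n)) : (edgeF G).card = edgeCount G := by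
  rw [edgeCount, ← Set.ncard_coe_finset]
  congr 1
  ext e; simp [edgeF]

lemma edgeF_inj {n : ℕ} : Function.Injective (edgeF (n := n)) := by
  intro G H h
  rw [← SimpleGraph.edgeSet_inj]
  ext e
  have := Finset.ext_iff.1 h e
  simpa [edgeF] using this

lemma edgeF_surj {n : ℕ} (A : Finset (Sym2 (Fin n))) (hA : A ⊆ allE n) :
    ∃ G : SimpleGraph (Fin n), edgeF G = A := by
  refine ⟨SimpleGraph.fromEdgeSet (A : Set (Sym2 (Fin n))), ?_⟩
  ext e
  simp only [edgeF, SimpleGraph.edgeSet_fromEdgeSet, Finset.mem_filter, Finset.mem_univ, true_and]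
  have := @hA e
  simp only [allE, Finset.mem_filter, Finset.mem_univ, true_and] at this
  simp only [Set.mem_sdiff, Finset.mem_coe, Sym2.mem_diagSet]
  tauto

lemma card_allE (n : ℕ) : (allE n).card = n.choose 2 := by
  have := Sym2.card_subtype_not_diag (α := Fin n)
  rw [Fintype.card_fin] at this
  rw [← this, Fintype.card_subtype]
  rfl

lemma cross_inside {n : ℕ} (G : SimpleGraph (Fin n)) (S : Finset (Fin n)) :
    crossEdges G S + insideEdges G S = (edgeF G ∩ touchE S).card := by
  have hinj : Set.InjOn (fun p : Fin n × Fin n => s(p.1, p.2))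
      {p : Fin n × Fin n | p.1 ∈ S ∧ p.2 ∉ S ∧ G.Adj p.1 p.2} := by
    rintro ⟨a, b⟩ h ⟨c, d⟩ h' hh
    simp only [Set.mem_ofPred_eq] at h h'
    simp only [Sym2.eq_iff] at hh
    rcases hh with ⟨rfl, rfl⟩ | ⟨rfl, rfl⟩
    · rfl
    · exact absurd h.1 h'.2.1
  rw [crossEdges, insideEdges, ← hinj.ncard_image, ← Set.ncard_union_eq,
    ← Set.ncard_coe_finset]
  · congr 1
    ext e
    induction e using Sym2.ind with
    | _ a b =>
    simp only [Set.mem_union, Set.mem_image, Set.mem_ofPred_eq, Prod.exists, Sym2.mem_iff,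
      edgeF, touchE, allE, Finset.coe_inter, Finset.coe_filter, Finset.mem_univ, true_and,
      Finset.mem_filter, Set.mem_inter_iff, SimpleGraph.mem_edgeSet, Sym2.mk_isDiag_iff,
      forall_eq_or_imp, forall_eq, exists_eq_or_imp, exists_eq_left]
    constructor
    · rintro (⟨x, y, ⟨hx, hy, hxy⟩, he⟩ | ⟨h, ha, hb⟩)
      · rw [Sym2.eq_iff] at he
        rcases he with ⟨rfl, rfl⟩ | ⟨rfl, rfl⟩
        · exact ⟨hxy, hxy.ne, Or.inl hx⟩
        · exact ⟨hxy.symm, hxy.ne.symm, Or.inr hx⟩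
      · exact ⟨h, h.ne, Or.inl ha⟩
    · rintro ⟨h, hne, hor⟩
      by_cases ha : a ∈ S <;> by_cases hb : b ∈ S
      · exact Or.inr ⟨h, ha, hb⟩
      · exact Or.inl ⟨a, b, ⟨ha, hb, h⟩, rfl⟩
      · exact Or.inl ⟨b, a, ⟨hb, ha, h.symm⟩, Sym2.eq_swap⟩
      · tauto
  · rw [Set.disjoint_left]
    rintro e ⟨⟨x, y⟩, hx, rfl⟩ he
    exact hx.2.1 (he.2 y (by simp))

lemma card_touchE {n : ℕ} (S : Finset (Fin n)) :
    (touchE S).card = S.card * (n - S.card) + S.card.choose 2 := by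
  have h := cross_inside (⊤ : SimpleGraph (Fin n)) S
  have e1 : edgeF (⊤ : SimpleGraph (Fin n)) ∩ touchE S = touchE S := by
    rw [Finset.inter_eq_right]
    intro e he
    simp only [touchE, allE, Finset.mem_filter, Finset.mem_univ, true_and] at he
    simp only [edgeF, Finset.mem_filter, Finset.mem_univ, true_and]
    simpa using he.1
  rw [e1] at h
  rw [← h]
  congr 1
  · rw [crossEdges]
    have : {p : Fin n × Fin n | p.1 ∈ S ∧ p.2 ∉ S ∧ (⊤ : SimpleGraph (Fin n)).Adj p.1 p.2}
        = ((S ×ˢ Sᶜ : Finset (Fin n × Fin n)) : Set (Fin n × Fin n)) := by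
      ext ⟨a, b⟩
      simp only [Set.mem_ofPred_eq, SimpleGraph.top_adj, Finset.mem_coe, Finset.mem_product,
        Finset.mem_compl]
      constructor
      · tauto
      · rintro ⟨ha, hb⟩
        exact ⟨ha, hb, fun h => hb (h ▸ ha)⟩
    rw [this, Set.ncard_coe_finset, Finset.card_product, Finset.card_compl, Fintype.card_fin]
  · rw [insideEdges, ← Sym2.card_image_offDiag, ← Set.ncard_coe_finset]
    congr 1
    ext e
    induction e using Sym2.ind with
    | _ a b =>
    simp only [Finset.coe_image, Set.mem_image, Finset.mem_coe, Finset.mem_offDiag, Prod.exists,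
      Set.mem_ofPred_eq, SimpleGraph.mem_edgeSet, SimpleGraph.top_adj, Sym2.mem_iff,
      forall_eq_or_imp, forall_eq]
    constructor
    · rintro ⟨h, ha, hb⟩
      exact ⟨a, b, ⟨ha, hb, h⟩, rfl⟩
    · rintro ⟨x, y, ⟨hx, hy, hxy⟩, he⟩
      rcases Sym2.eq_iff.1 he with ⟨rfl, rfl⟩ | ⟨rfl, rfl⟩
      · exact ⟨hxy, hx, hy⟩
      · exact ⟨hxy.symm, hy, hx⟩

lemma one_set {n : ℕ} (hn : 2 ≤ n) (C ρ : ℝ) (m : ℕ) (hρ : ρ ∈ Set.Icc (0 : ℝ) 1)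
    (hm : (m : ℝ) ≤ ρ * (n.choose 2 : ℝ)) (S : Finset (Fin n)) :
    (((((allE n).powersetCard m).filter (fun A =>
        C * max (Real.sqrt ρ) (Real.sqrt (Real.log n / n)) * (S.card : ℝ)
          * Real.sqrt ((n : ℝ) * Real.log n)
        < |((A ∩ touchE S).card : ℝ) - m * ((touchE S).card / (allE n).card : ℝ)|)).card : ℕ) : ℝ)
      ≤ 2 * ((n.choose 2).choose m : ℝ) * Real.exp (-(C - 1) * S.card * Real.log n) := by
  have hN : 0 < n.choose 2 := Nat.choose_pos hn
  have hNr : (0 : ℝ) < n.choose 2 := by exact_mod_cast hN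
  have hmN : m ≤ n.choose 2 := by
    have : (m : ℝ) ≤ n.choose 2 := hm.trans (by nlinarith [hρ.2])
    exact_mod_cast this
  have hn0 : (0 : ℝ) < n := by positivity
  have hL : 0 < Real.log n := Real.log_pos (by exact_mod_cast hn)
  set L := Real.log n with hLdef
  set a := max (Real.sqrt ρ) (Real.sqrt (L / n)) with ha
  have hq : 0 < Real.sqrt (L / n) := Real.sqrt_pos.2 (by positivity)
  have ha0 : 0 < a := lt_of_lt_of_le hq (le_max_right _ _)
  have hρa : ρ ≤ a ^ 2 := by
    rw [← Real.sqrt_le_left ha0.le]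
    exact le_max_left _ _
  have hB : touchE S ⊆ allE n := Finset.filter_subset _ _
  have hsn : S.card ≤ n := by simpa using Finset.card_le_univ S
  have hM : ((touchE S).card : ℝ) ≤ S.card * n := by
    have h1 : S.card.choose 2 ≤ S.card * S.card := by
      rw [Nat.choose_two_right]
      exact (Nat.div_le_self _ _).trans (Nat.mul_le_mul_left _ (Nat.sub_le _ _))
    have : (touchE S).card ≤ S.card * n := by
      rw [card_touchE]
      calc _ ≤ S.card * (n - S.card) + S.card * S.card := by omega
        _ = S.card * n := by rw [← Nat.mul_add, Nat.sub_add_cancel hsn]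
    exact_mod_cast this
  have h := aux_tail (allE n) (touchE S) m hB (by rw [card_allE]; exact hmN)
    (by rw [card_allE]; exact hN) (Real.sqrt (L / n) / a)
    (C * a * (S.card : ℝ) * Real.sqrt ((n : ℝ) * L)) (by positivity)
    ((div_le_one ha0).2 (le_max_right _ _))
  refine h.trans ?_
  rw [card_allE]
  gcongr
  have e1 : Real.sqrt (L / n) * Real.sqrt (n * L) = L := by
    rw [← Real.sqrt_mul (by positivity)]
    have : L / n * (n * L) = L ^ 2 := by field_simp
    rw [this, Real.sqrt_sq hL.le]
  have e2 : Real.sqrt (L / n) / a * (C * a * (S.card : ℝ) * Real.sqrt ((n : ℝ) * L))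
      = C * S.card * L := by
    calc _ = C * S.card * (Real.sqrt (L / n) * Real.sqrt (n * L)) := by field_simp
      _ = _ := by rw [e1]
  have e3 : (m : ℝ) * ((touchE S).card / (n.choose 2 : ℕ)) * (Real.sqrt (L / n) / a) ^ 2
      ≤ S.card * L := by
    have h1 : (m : ℝ) * ((touchE S).card / (n.choose 2 : ℕ)) ≤ a ^ 2 * (S.card * n) := by
      calc (m : ℝ) * ((touchE S).card / (n.choose 2 : ℕ))
          = (m / (n.choose 2 : ℕ)) * (touchE S).card := by ring
        _ ≤ a ^ 2 * (S.card * n) := by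
          gcongr
          rw [div_le_iff₀ hNr]
          exact hm.trans (by gcongr)
    calc _ ≤ a ^ 2 * (S.card * n) * (Real.sqrt (L / n) / a) ^ 2 := by gcongr
      _ = S.card * L := by
        rw [div_pow, Real.sq_sqrt (by positivity)]
        field_simp
  rw [e2]
  linarith

/-- For `C > 48` there is a constant `K = K(C)` such that for all `n ≥ 2`, `ρ ∈ [0,1]` and
`m ≤ ρ·C(n,2)`, a uniform graph `G ∼ G(n,m)` lies outside the homogeneity set `H_{ρ,C}`
with probability at most `K · n^{-(C/16 - 3)}`. -/
theorem gnm_homog_bound (C : ℝ) (hC : 48 < C) :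
    ∃ K : ℝ, ∀ n : ℕ, 2 ≤ n → ∀ ρ ∈ Set.Icc (0 : ℝ) 1, ∀ m : ℕ,
      (m : ℝ) ≤ ρ * (n.choose 2 : ℝ) →
      gnm n m (homogSet n ρ C)ᶜ
        ≤ ENNReal.ofReal (K * (n : ℝ) ^ (-(C / 16 - 3))) := by
  classical
  refine ⟨2 * Real.exp 1, ?_⟩
  intro n hn ρ hρ m hm
  have hN : 0 < n.choose 2 := Nat.choose_pos hn
  have hNr : (0 : ℝ) < n.choose 2 := by exact_mod_cast hN
  have hmN : m ≤ n.choose 2 := by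
    have : (m : ℝ) ≤ n.choose 2 := hm.trans (by nlinarith [hρ.2])
    exact_mod_cast this
  have hn0 : (0 : ℝ) < n := by positivity
  have hn1 : (1 : ℝ) ≤ n := by exact_mod_cast (by omega : 1 ≤ n)
  have hL : 0 < Real.log n := Real.log_pos (by exact_mod_cast hn)
  set s : Finset (SimpleGraph (Fin n)) := Finset.univ.filter (fun G => edgeCount G = m) with hs
  set t : Finset (SimpleGraph (Fin n)) := Finset.univ.filter (fun G => G ∉ homogSet n ρ C) with ht
  have hgs : gnm n m (homogSet n ρ C)ᶜ = (((s ∩ t).card : ℕ) : ENNReal) / (s.card : ℕ) := by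
    rw [← uniformOn_apply_finset, gnm]
    congr 1
    · congr 1
      ext G; simp [hs]
    · ext G; simp [ht]
  have himg : s.image edgeF = (allE n).powersetCard m := by
    ext A
    simp only [Finset.mem_image, hs, Finset.mem_filter, Finset.mem_univ, true_and,
      Finset.mem_powersetCard]
    constructor
    · rintro ⟨G, hG, rfl⟩
      exact ⟨edgeF_subset G, by rw [card_edgeF, hG]⟩
    · rintro ⟨h1, h2⟩
      obtain ⟨G, rfl⟩ := edgeF_surj A h1
      exact ⟨G, by rw [← card_edgeF, h2], rfl⟩
  have hscard : s.card = (n.choose 2).choose m := by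
    rw [← Finset.card_image_of_injective s edgeF_inj, himg, Finset.card_powersetCard, card_allE]
  set bad : Finset (Fin n) → Finset (Finset (Sym2 (Fin n))) := fun S =>
    ((allE n).powersetCard m).filter (fun A =>
        C * max (Real.sqrt ρ) (Real.sqrt (Real.log n / n)) * (S.card : ℝ)
          * Real.sqrt ((n : ℝ) * Real.log n)
        < |((A ∩ touchE S).card : ℝ) - m * ((touchE S).card / (allE n).card : ℝ)|) with hbad
  have hsub : (s ∩ t).image edgeF
      ⊆ (Finset.univ.filter (fun S : Finset (Fin n) => S.Nonempty)).biUnion bad := by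
    intro A hA
    obtain ⟨G, hG, rfl⟩ := Finset.mem_image.1 hA
    obtain ⟨hG1, hG2⟩ := Finset.mem_inter.1 hG
    have hGm : edgeCount G = m := (Finset.mem_filter.1 hG1).2
    have hGh : G ∉ homogSet n ρ C := (Finset.mem_filter.1 hG2).2
    have hAm : edgeF G ∈ (allE n).powersetCard m := by
      rw [← himg]; exact Finset.mem_image_of_mem _ hG1
    have hd : eDens G ≤ ρ := by
      rw [eDens, hGm, div_le_iff₀ hNr]; exact hm
    have : ∃ S : Finset (Fin n), S.Nonempty ∧ ¬ HomogCond ρ C (eDens G) G S := by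
      by_contra hcon
      push Not at hcon
      exact hGh ⟨hd, hcon⟩
    obtain ⟨S, hS, hSc⟩ := this
    have hsn : S.card ≤ n := by simpa using Finset.card_le_univ S
    rw [Finset.mem_biUnion]
    refine ⟨S, by simpa using hS, ?_⟩
    simp only [hbad, Finset.mem_filter]
    refine ⟨hAm, ?_⟩
    rw [HomogCond, not_le] at hSc
    refine lt_of_lt_of_eq hSc ?_
    have h1 : ((edgeF G ∩ touchE S).card : ℝ) = crossEdges G S + insideEdges G S := by
      exact_mod_cast (cross_inside G S).symm
    have h2 : ((touchE S).card : ℝ)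
        = (S.card : ℝ) * ((n : ℝ) - S.card) + (S.card.choose 2 : ℕ) := by
      rw [card_touchE]; push_cast [Nat.cast_sub hsn]; ring
    rw [h1, h2, eDens, hGm, card_allE]
    congr 2
    ring
  have hcount : ((s ∩ t).card : ℝ) ≤ (s.card : ℝ) * (2 * Real.exp 1 * (n : ℝ) ^ (-(C / 16 - 3))) := by
    have h1 : (s ∩ t).card
        ≤ ∑ S ∈ Finset.univ.filter (fun S : Finset (Fin n) => S.Nonempty), (bad S).card := by
      rw [← Finset.card_image_of_injective (s ∩ t) edgeF_inj]
      exact (Finset.card_le_card hsub).trans Finset.card_biUnion_le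
    have hsumx : ∑ S : Finset (Fin n), ((n : ℝ)⁻¹) ^ S.card ≤ Real.exp 1 := by
      have := Fintype.sum_pow_mul_eq_add_pow (Fin n) ((n : ℝ)⁻¹) 1
      simp only [one_pow, mul_one, Fintype.card_fin] at this
      rw [this]
      calc ((n : ℝ)⁻¹ + 1) ^ n ≤ (Real.exp ((n : ℝ)⁻¹)) ^ n := by
            gcongr; exact Real.add_one_le_exp _
        _ = Real.exp 1 := by
            rw [← Real.exp_nat_mul, mul_inv_cancel₀ hn0.ne']
    calc ((s ∩ t).card : ℝ)
        ≤ ∑ S ∈ Finset.univ.filter (fun S : Finset (Fin n) => S.Nonempty), ((bad S).card : ℝ) := by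
          exact_mod_cast h1
      _ ≤ ∑ S ∈ Finset.univ.filter (fun S : Finset (Fin n) => S.Nonempty),
            2 * (s.card : ℝ) * ((n : ℝ) ^ (-(C / 16 - 3)) * ((n : ℝ)⁻¹) ^ S.card) := by
          apply Finset.sum_le_sum
          intro S hS
          refine (one_set hn C ρ m hρ hm S).trans ?_
          rw [hscard]
          gcongr
          have hS1 : (1 : ℝ) ≤ S.card := by
            exact_mod_cast (Finset.mem_filter.1 hS).2.card_pos
          have e : ((n : ℝ)⁻¹) ^ S.card = Real.exp (-(S.card : ℝ) * Real.log n) := by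
            rw [inv_pow, neg_mul, Real.exp_neg, Real.exp_nat_mul, Real.exp_log hn0]
          rw [e, Real.rpow_def_of_pos hn0, ← Real.exp_add]
          apply Real.exp_le_exp.2
          have : 0 ≤ ((C - 2) * S.card - (C / 16 - 3)) * Real.log n := by
            apply mul_nonneg _ hL.le
            nlinarith
          linarith
      _ ≤ ∑ S : Finset (Fin n),
            2 * (s.card : ℝ) * ((n : ℝ) ^ (-(C / 16 - 3)) * ((n : ℝ)⁻¹) ^ S.card) := by
          apply Finset.sum_le_sum_of_subset_of_nonneg (Finset.filter_subset _ _)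
          intros; positivity
      _ = 2 * (s.card : ℝ) * ((n : ℝ) ^ (-(C / 16 - 3)) *
            ∑ S : Finset (Fin n), ((n : ℝ)⁻¹) ^ S.card) := by
          rw [← Finset.mul_sum, ← Finset.mul_sum]
      _ ≤ 2 * (s.card : ℝ) * ((n : ℝ) ^ (-(C / 16 - 3)) * Real.exp 1) := by gcongr
      _ = _ := by ring
  rw [hgs]
  apply ENNReal.div_le_of_le_mul
  rw [← ENNReal.ofReal_natCast, ← ENNReal.ofReal_natCast, ← ENNReal.ofReal_mul (by positivity)]
  apply ENNReal.ofReal_le_ofReal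
  linarith

end
end

section
/- Fix C > 48 and ρ ∈ [0,1], and for each n set r_n = n^{3/2}/(max{√ρ, √(log n / n)}·√(log n)). For ε > 0 define the algorithm Â on graphs G ∈ H_{ρ,C} that outputs a sample from the continuous distribution on [0,1] with density proportional to q ↦ exp(−(ε/2)·(1/(8C))·min{r_n·|e(G) − q|, n}). Then: (i) Â is (ε/2)-node differentially private on H_{ρ,C}, i.e. for all G, G' ∈ H_{ρ,C} and measurable S ⊆ [0,1], Â(G)(S) ≤ exp((ε/2)·d_v(G,G'))·Â(G')(S); and (ii) for any sequence ε_n ∈ (0,1) with ε_n·n/log n → ∞, there exist a constant K and n₀ such that for all n ≥ n₀ and all G ∈ H_{ρ,C}, E_{x ∼ Â(G)}[(x − e(G))²] ≤ K·max{ρ, (log n)/n}·(log n)/(n³·ε_n²). -/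
open MeasureTheory ProbabilityTheory

noncomputable section

/-- `G'` is obtained from `G` by rewiring a single vertex. -/
def Rewire {n : ℕ} (G G' : SimpleGraph (Fin n)) : Prop :=
  ∃ v : Fin n, ∀ a b : Fin n, a ≠ v → b ≠ v → (G.Adj a b ↔ G'.Adj a b)

/-- The node (rewiring) distance between two graphs on `n` vertices. -/
def nodeDist {n : ℕ} (G G' : SimpleGraph (Fin n)) : ℕ :=
  sInf {m : ℕ | ∃ f : ℕ → SimpleGraph (Fin n),
    f 0 = G ∧ f m = G' ∧ ∀ i < m, Rewire (f i) (f (i + 1))}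

/-- The sensitivity scale `r_n = n^{3/2} / (max{√ρ, √(log n / n)}·√(log n))`. -/
def rn (n : ℕ) (ρ : ℝ) : ℝ :=
  (n : ℝ) ^ ((3 : ℝ) / 2)
    / (max (Real.sqrt ρ) (Real.sqrt (Real.log n / n)) * Real.sqrt (Real.log n))

/-- The (unnormalized) output density of the algorithm `Â` on input `G`:
`q ↦ exp(−(ε/2)·(1/(8C))·min{r_n·|e(G) − q|, n})`. -/
def hatDens (n : ℕ) (ρ C ε : ℝ) (G : SimpleGraph (Fin n)) (q : ℝ) : ℝ :=
  Real.exp (-(ε / 2) * (1 / (8 * C)) * min (rn n ρ * |eDens G - q|) (n : ℝ))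

/-- The algorithm `Â`: on input `G` it outputs a sample from the continuous distribution on
`[0,1]` with density proportional to `hatDens`. -/
def hatA (n : ℕ) (ρ C ε : ℝ) (G : SimpleGraph (Fin n)) : Measure ℝ :=
  (∫⁻ q in Set.Icc (0 : ℝ) 1, ENNReal.ofReal (hatDens n ρ C ε G q))⁻¹ •
    ((volume.restrict (Set.Icc (0 : ℝ) 1)).withDensity
      fun q => ENNReal.ofReal (hatDens n ρ C ε G q))

lemma cross_image {n : ℕ} (G : SimpleGraph (Fin n)) (S : Finset (Fin n)) :
    crossEdges G S = Set.ncard {e ∈ G.edgeSet | (∃ v ∈ e, v ∈ S) ∧ ∃ v ∈ e, v ∉ S} := by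
  unfold crossEdges
  rw [← Set.InjOn.ncard_image (f := fun p : Fin n × Fin n => s(p.1, p.2))]
  · congr 1
    ext e
    induction e using Sym2.ind with
    | _ a b =>
      simp only [Set.mem_image, Set.mem_ofPred_eq, Prod.exists, SimpleGraph.mem_edgeSet,
        Sym2.mem_iff, exists_eq_or_imp, exists_eq_left]
      constructor
      · rintro ⟨c, d, ⟨h1, h2, h3⟩, h⟩
        rcases Sym2.eq_iff.1 h with ⟨rfl, rfl⟩ | ⟨rfl, rfl⟩
        · exact ⟨h3, Or.inl h1, Or.inr h2⟩
        · exact ⟨h3.symm, Or.inr h1, Or.inl h2⟩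
      · rintro ⟨h, h1, h2⟩
        by_cases ha : a ∈ S
        · exact ⟨a, b, ⟨ha, by tauto, h⟩, rfl⟩
        · exact ⟨b, a, ⟨by tauto, ha, h.symm⟩, Sym2.eq_swap⟩
  · rintro ⟨a, b⟩ ⟨h1, h2, h3⟩ ⟨c, d⟩ ⟨h4, h5, h6⟩ h
    simp only at h h1 h2 h4 h5
    rcases Sym2.eq_iff.1 h with ⟨rfl, rfl⟩ | ⟨rfl, rfl⟩
    · rfl
    · exact absurd h1 h5

lemma edge_split {n : ℕ} (G : SimpleGraph (Fin n)) (S : Finset (Fin n)) :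
    edgeCount G = crossEdges G S + insideEdges G S
      + Set.ncard {e ∈ G.edgeSet | ∀ v ∈ e, v ∉ S} := by
  classical
  rw [cross_image]
  unfold edgeCount insideEdges
  rw [← Set.ncard_union_eq _ (Set.toFinite _) (Set.toFinite _),
    ← Set.ncard_union_eq _ (Set.toFinite _) (Set.toFinite _)]
  · congr 1
    ext e
    simp only [Set.mem_union, Set.mem_ofPred_eq]
    by_cases h1 : ∃ v ∈ e, v ∈ S
    · by_cases h2 : ∃ v ∈ e, v ∉ S
      · refine ⟨fun h => Or.inl (Or.inl ⟨h, h1, h2⟩), ?_⟩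
        rintro ((h | h) | h) <;> exact h.1
      · push Not at h2
        tauto
    · push Not at h1
      tauto
  · rw [Set.disjoint_left]
    rintro e he ⟨_, h⟩
    rcases he with ⟨_, ⟨v, hv, hS⟩, _⟩ | ⟨_, h3⟩
    · exact h v hv hS
    · induction e using Sym2.ind with
      | _ a b => exact h a (by simp) (h3 a (by simp))
  · rw [Set.disjoint_left]
    rintro e ⟨_, _, v, hv, hS⟩ ⟨_, h⟩
    exact hS (h v hv)

lemma cross_le {n : ℕ} (G : SimpleGraph (Fin n)) (S : Finset (Fin n)) :
    (crossEdges G S : ℝ) ≤ (S.card : ℝ) * ((n : ℝ) - S.card) := by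
  classical
  have h : crossEdges G S ≤ (S ×ˢ Sᶜ).card := by
    rw [← Set.ncard_coe_finset]
    apply Set.ncard_le_ncard _ (Set.toFinite _)
    rintro ⟨a, b⟩ ⟨h1, h2, _⟩
    simp_all
  rw [Finset.card_product, Finset.card_compl, Fintype.card_fin] at h
  have h2 : S.card ≤ n := by simpa using Finset.card_le_univ S
  rw [← Nat.cast_sub h2]
  exact_mod_cast h

lemma inside_le {n : ℕ} (G : SimpleGraph (Fin n)) (S : Finset (Fin n)) :
    insideEdges G S ≤ S.card.choose 2 := by
  classical
  rw [← Sym2.card_image_offDiag, ← Set.ncard_coe_finset]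
  apply Set.ncard_le_ncard _ (Set.toFinite _)
  intro e
  induction e using Sym2.ind with
  | _ a b =>
    rintro ⟨h1, h2⟩
    have h3 : a ≠ b := G.ne_of_adj h1
    have ha : a ∈ S := h2 a (by simp)
    have hb : b ∈ S := h2 b (by simp)
    rw [Finset.mem_coe, Finset.mem_image]
    exact ⟨(a, b), by simp [ha, hb, h3], rfl⟩

lemma nodeDist_spec {n : ℕ} (G G' : SimpleGraph (Fin n)) :
    G = G' ∨ ∃ S : Finset (Fin n), S.Nonempty ∧ S.card ≤ nodeDist G G' ∧
      ∀ a b, a ∉ S → b ∉ S → (G.Adj a b ↔ G'.Adj a b) := by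
  classical
  have hne : {m : ℕ | ∃ f : ℕ → SimpleGraph (Fin n),
      f 0 = G ∧ f m = G' ∧ ∀ i < m, Rewire (f i) (f (i + 1))}.Nonempty := by
    refine ⟨n, fun i => SimpleGraph.mk
      (fun a b => if a.val < i ∨ b.val < i then G'.Adj a b else G.Adj a b) ?_ ?_, ?_, ?_, ?_⟩
    · refine ⟨?_⟩
      intro a b h
      simp only [or_comm (a := b.val < i), G.adj_comm b a, G'.adj_comm b a]
      exact h
    · refine ⟨?_⟩
      intro a h
      simp at h
    · ext a b
      simp
    · ext a b
      simp
    · intro i hi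
      refine ⟨⟨i, hi⟩, ?_⟩
      intro a b ha hb
      have ha' : a.val ≠ i := fun h => ha (Fin.ext h)
      have hb' : b.val ≠ i := fun h => hb (Fin.ext h)
      have e1 : a.val < i + 1 ↔ a.val < i := by omega
      have e2 : b.val < i + 1 ↔ b.val < i := by omega
      simp only [e1, e2]
  obtain ⟨f, h0, hm, hf⟩ := Nat.sInf_mem hne
  change f (nodeDist G G') = G' at hm
  change ∀ i < nodeDist G G', _ at hf
  generalize nodeDist G G' = m at hm hf
  rcases Nat.eq_zero_or_pos m with rfl | hpos
  · left; rw [← h0, hm]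
  right
  have hn : Nonempty (Fin n) := ⟨(hf 0 hpos).choose⟩
  choose! v hv using hf
  refine ⟨(Finset.range m).image v, ⟨v 0, Finset.mem_image_of_mem _ (by simpa using hpos)⟩,
    Finset.card_image_le.trans (by simp), ?_⟩
  intro a b ha hb
  have key : ∀ i ≤ m, (G.Adj a b ↔ (f i).Adj a b) := by
    intro i
    induction i with
    | zero => intro _; rw [h0]
    | succ k ih =>
      intro hk
      rw [ih (by omega)]
      apply hv k (by omega)
      · rintro rfl
        exact ha (Finset.mem_image_of_mem _ (by simp; omega))
      · rintro rfl
        exact hb (Finset.mem_image_of_mem _ (by simp; omega))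
  rw [key m le_rfl, hm]

lemma numeric_key {n s C x y r N D B X X' : ℝ} (hC : 48 < C) (hs : 1 ≤ s)
    (hns : 4 * C * s < n) (hr : 0 ≤ r) (hB : r * B = C * s * n ^ 2)
    (hN : N = n * (n - 1) / 2) (hD : D = s * (n - s) + s * (s - 1) / 2)
    (hX : |X - x * D| ≤ B) (hX' : |X' - y * D| ≤ B) (h0 : 0 ≤ X') (h1 : X ≤ D)
    (hdiff : N * (x - y) = X - X') (hy : 0 ≤ y) (hx : x ≤ 1) (hxy : y ≤ x) :
    r * (x - y) ≤ 4 * C * s ∨ (r * (x - y) ≤ 8 * C * s ∧ n ≤ r * y ∧ n ≤ r * (1 - x)) := by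
  have hsn : 192 * s < n := by nlinarith
  have hn : 0 < n := by linarith
  have hP : 0 ≤ r * (x - y) := mul_nonneg hr (by linarith)
  have hN' : 0.49 * n ^ 2 ≤ N - D := by
    have : N - D = (n - s) * (n - s - 1) / 2 := by rw [hN, hD]; ring
    rw [this]
    have h2 : 191 / 192 * n ≤ n - s := by linarith
    have h3 : 190 / 192 * n ≤ n - s - 1 := by linarith
    have := mul_le_mul h2 h3 (by positivity) (by linarith)
    nlinarith
  have hDn : D ≤ s * n := by rw [hD]; nlinarith
  have hPN : r * (x - y) * (N - D) = r * (X - x * D) + r * (y * D - X') := by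
    linear_combination r * hdiff
  have hlow := mul_le_mul_of_nonneg_left hN' hP
  have a1 : r * (X - x * D) ≤ C * s * n ^ 2 := by
    rw [← hB]; exact mul_le_mul_of_nonneg_left (le_of_abs_le hX) hr
  have a2 : r * (y * D - X') ≤ C * s * n ^ 2 := by
    rw [← hB]; apply mul_le_mul_of_nonneg_left _ hr
    have := (abs_le.1 hX').1
    linarith
  have b1 : r * (X - x * D) ≤ r * (1 - x) * (s * n) := by
    rw [mul_assoc]; apply mul_le_mul_of_nonneg_left _ hr
    nlinarith
  have b2 : r * (y * D - X') ≤ r * y * (s * n) := by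
    rw [mul_assoc]; apply mul_le_mul_of_nonneg_left _ hr
    nlinarith
  have hn2 : 0 < n ^ 2 := by positivity
  have fin : ∀ c : ℝ, r * (x - y) * (N - D) ≤ c * n ^ 2 → 0.49 * (r * (x - y)) ≤ c := by
    intro c hc
    have : 0.49 * (r * (x - y)) * n ^ 2 ≤ c * n ^ 2 := by linarith
    exact le_of_mul_le_mul_right this hn2
  have hsnpos : 0 ≤ s * n := by positivity
  rcases lt_or_ge (r * y) n with hlt | hge
  · left
    have := mul_le_mul_of_nonneg_right hlt.le hsnpos
    have := fin (C * s + s) (by rw [hPN]; linarith)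
    nlinarith
  · rcases lt_or_ge (r * (1 - x)) n with hlt | hge'
    · left
      have := mul_le_mul_of_nonneg_right hlt.le hsnpos
      have := fin (C * s + s) (by rw [hPN]; linarith)
      nlinarith
    · right
      have := fin (2 * C * s) (by rw [hPN]; linarith)
      refine ⟨?_, hge, hge'⟩
      nlinarith

lemma rn_nonneg (n : ℕ) (ρ : ℝ) : 0 ≤ rn n ρ := by
  unfold rn; positivity

lemma eDens_nonneg {n : ℕ} (G : SimpleGraph (Fin n)) : 0 ≤ eDens G := by
  unfold eDens; positivity

/-- Distances in the ordered case. -/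
lemma key_ordered {n : ℕ} {C ρ : ℝ} (hC : 48 < C) (hρ : ρ ≤ 1)
    {G G' : SimpleGraph (Fin n)} (hG : G ∈ homogSet n ρ C) (hG' : G' ∈ homogSet n ρ C)
    {S : Finset (Fin n)} (hS : S.Nonempty)
    (hadj : ∀ a b, a ∉ S → b ∉ S → (G.Adj a b ↔ G'.Adj a b)) (hxy : eDens G' ≤ eDens G)
    (hns : 4 * C * S.card < n) :
    rn n ρ * (eDens G - eDens G') ≤ 4 * C * S.card ∨
      (rn n ρ * (eDens G - eDens G') ≤ 8 * C * S.card ∧ (n : ℝ) ≤ rn n ρ * eDens G' ∧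
        (n : ℝ) ≤ rn n ρ * (1 - eDens G)) := by
  have hs : (1 : ℝ) ≤ S.card := by exact_mod_cast hS.card_pos
  have hn : (192 : ℝ) < n := by nlinarith
  have hlog : 0 < Real.log n := Real.log_pos (by linarith)
  have hM : 0 < max (Real.sqrt ρ) (Real.sqrt (Real.log n / n)) :=
    lt_max_of_lt_right (Real.sqrt_pos.2 (by positivity))
  have h1 := hG.2 S hS
  have h2 := hG'.2 S hS
  unfold HomogCond at h1 h2
  have hN : ((n.choose 2 : ℕ) : ℝ) = (n : ℝ) * (n - 1) / 2 := Nat.cast_choose_two ℝ n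
  have hNpos : (0 : ℝ) < (n.choose 2 : ℕ) := by rw [hN]; nlinarith
  have hins : (insideEdges G S : ℝ) ≤ (S.card.choose 2 : ℕ) := by exact_mod_cast inside_le G S
  refine numeric_key (N := (n.choose 2 : ℕ)) hC hs hns (rn_nonneg n ρ) ?_ hN
    (by rw [← Nat.cast_choose_two ℝ S.card]) h1 h2 (by positivity)
    (add_le_add (cross_le G S) hins) ?_ (eDens_nonneg G') (hG.1.trans hρ) hxy
  · unfold rn
    generalize max (Real.sqrt ρ) (Real.sqrt (Real.log n / n)) = M at *
    have hL : 0 < Real.sqrt (Real.log n) := Real.sqrt_pos.2 hlog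
    rw [Real.sqrt_mul (by positivity)]
    have e : (n : ℝ) ^ (3 / 2 : ℝ) * Real.sqrt n = (n : ℝ) ^ 2 := by
      rw [Real.sqrt_eq_rpow, ← Real.rpow_add (by positivity)]
      norm_num
    field_simp
    rw [← e]
  · have e1 := edge_split G S
    have e2 := edge_split G' S
    have e3 : {e ∈ G.edgeSet | ∀ v ∈ e, v ∉ S} = {e ∈ G'.edgeSet | ∀ v ∈ e, v ∉ S} := by
      ext e
      induction e using Sym2.ind with
      | _ a b =>
        simp only [Set.mem_ofPred_eq, SimpleGraph.mem_edgeSet]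
        refine and_congr_left fun h => hadj a b (h a (by simp)) (h b (by simp))
    rw [e3] at e1
    have e4 : (edgeCount G : ℝ) - edgeCount G' =
        (crossEdges G S + insideEdges G S) - (crossEdges G' S + insideEdges G' S) := by
      rw [e1, e2]; push_cast; ring
    unfold eDens
    rw [← e4]
    field_simp

lemma key_dist {n : ℕ} {C ρ : ℝ} (hC : 48 < C) (hρ : ρ ≤ 1)
    {G G' : SimpleGraph (Fin n)} (hG : G ∈ homogSet n ρ C) (hG' : G' ∈ homogSet n ρ C) :
    min (rn n ρ * |eDens G - eDens G'|) n ≤ 4 * C * nodeDist G G' ∨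
      (min (rn n ρ * |eDens G - eDens G'|) n ≤ 8 * C * nodeDist G G' ∧
        (n : ℝ) ≤ rn n ρ * eDens G ∧ (n : ℝ) ≤ rn n ρ * (1 - eDens G) ∧
        (n : ℝ) ≤ rn n ρ * eDens G' ∧ (n : ℝ) ≤ rn n ρ * (1 - eDens G')) := by
  rcases nodeDist_spec G G' with rfl | ⟨S, hS, hcard, hadj⟩
  · left
    rw [sub_self, abs_zero, mul_zero]
    exact (min_le_left _ _).trans (by positivity)
  have hc : (S.card : ℝ) ≤ nodeDist G G' := by exact_mod_cast hcard
  have hc4 : 4 * C * (S.card : ℝ) ≤ 4 * C * nodeDist G G' :=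
    mul_le_mul_of_nonneg_left hc (by linarith)
  have hc8 : 8 * C * (S.card : ℝ) ≤ 8 * C * nodeDist G G' :=
    mul_le_mul_of_nonneg_left hc (by linarith)
  rcases le_or_gt (n : ℝ) (4 * C * S.card) with hle | hns
  · left
    exact (min_le_right _ _).trans (hle.trans hc4)
  have hr := rn_nonneg n ρ
  rcases le_total (eDens G') (eDens G) with hxy | hxy
  · have hm := mul_le_mul_of_nonneg_left hxy hr
    rw [abs_of_nonneg (sub_nonneg.2 hxy)]
    rcases key_ordered hC hρ hG hG' hS hadj hxy hns with h | ⟨h, h1, h2⟩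
    · left; exact (min_le_left _ _).trans (h.trans hc4)
    · right; exact ⟨(min_le_left _ _).trans (h.trans hc8), by linarith, h2, h1, by linarith⟩
  · have hm := mul_le_mul_of_nonneg_left hxy hr
    rw [abs_sub_comm, abs_of_nonneg (sub_nonneg.2 hxy)]
    rcases key_ordered hC hρ hG' hG hS (fun a b ha hb => (hadj a b ha hb).symm) hxy hns with
      h | ⟨h, h1, h2⟩
    · left; exact (min_le_left _ _).trans (h.trans hc4)
    · right; exact ⟨(min_le_left _ _).trans (h.trans hc8), h1, by linarith, by linarith, h2⟩

lemma hatDens_cont (n : ℕ) (ρ C ε : ℝ) (G : SimpleGraph (Fin n)) :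
    Continuous (hatDens n ρ C ε G) := by
  unfold hatDens; fun_prop

lemma hatDens_pos (n : ℕ) (ρ C ε : ℝ) (G : SimpleGraph (Fin n)) (q : ℝ) :
    0 < hatDens n ρ C ε G q := Real.exp_pos _

lemma min_tri {r m x y q : ℝ} (hr : 0 ≤ r) (hm : 0 ≤ m) :
    min (r * |y - q|) m ≤ min (r * |x - q|) m + min (r * |x - y|) m := by
  have h : r * |y - q| ≤ r * |x - q| + r * |x - y| := by
    rw [← mul_add]
    apply mul_le_mul_of_nonneg_left _ hr
    have := abs_sub_le y x q
    rw [abs_sub_comm y x] at this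
    linarith
  have h1 : 0 ≤ r * |x - q| := by positivity
  have h2 : 0 ≤ r * |x - y| := by positivity
  rcases le_total (r * |x - q|) m with c | c <;> rcases le_total (r * |x - y|) m with d | d
  · rw [min_eq_left c, min_eq_left d]; exact (min_le_left _ _).trans h
  · rw [min_eq_right d]; exact (min_le_right _ _).trans (by have := le_min h1 hm; linarith)
  · rw [min_eq_right c]; exact (min_le_right _ _).trans (by have := le_min h2 hm; linarith)
  · rw [min_eq_right c]; exact (min_le_right _ _).trans (by have := le_min h2 hm; linarith)

lemma hatDens_le {n : ℕ} {ρ C ε : ℝ} (hC : 48 < C) (hε : 0 < ε) (G G' : SimpleGraph (Fin n))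
    (q : ℝ) : hatDens n ρ C ε G q ≤
      Real.exp ((ε / 2) * (1 / (8 * C)) * min (rn n ρ * |eDens G - eDens G'|) n)
        * hatDens n ρ C ε G' q := by
  unfold hatDens
  rw [← Real.exp_add, Real.exp_le_exp]
  have hC0 : 0 < C := by linarith
  have ha : 0 ≤ (ε / 2) * (1 / (8 * C)) := by positivity
  have := mul_le_mul_of_nonneg_left (min_tri (q := q) (x := eDens G) (y := eDens G')
    (rn_nonneg n ρ) (Nat.cast_nonneg (α := ℝ) n)) ha
  linarith

lemma hat_integrable (n : ℕ) (ρ C ε : ℝ) (G : SimpleGraph (Fin n)) :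
    Integrable (hatDens n ρ C ε G) (volume.restrict (Set.Icc (0 : ℝ) 1)) :=
  (hatDens_cont n ρ C ε G).continuousOn.integrableOn_Icc

lemma Z_eq_ofReal (n : ℕ) (ρ C ε : ℝ) (G : SimpleGraph (Fin n)) :
    (∫⁻ q in Set.Icc (0 : ℝ) 1, ENNReal.ofReal (hatDens n ρ C ε G q))
      = ENNReal.ofReal (∫ q in Set.Icc (0 : ℝ) 1, hatDens n ρ C ε G q) := by
  rw [ofReal_integral_eq_lintegral_ofReal (hat_integrable n ρ C ε G)]
  exact Filter.Eventually.of_forall fun q => (hatDens_pos n ρ C ε G q).le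

lemma Z_shift {n : ℕ} {ρ C ε : ℝ} (G : SimpleGraph (Fin n)) :
    (∫ q in Set.Icc (0 : ℝ) 1, hatDens n ρ C ε G q) =
      ∫ u in (eDens G - 1)..(eDens G),
        Real.exp (-(ε / 2) * (1 / (8 * C)) * min (rn n ρ * |u|) (n : ℝ)) := by
  rw [integral_Icc_eq_integral_Ioc, ← intervalIntegral.integral_of_le zero_le_one]
  unfold hatDens
  rw [intervalIntegral.integral_comp_sub_left
    (fun u => Real.exp (-(ε / 2) * (1 / (8 * C)) * min (rn n ρ * |u|) (n : ℝ))) (eDens G), sub_zero]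

lemma Z_eq {n : ℕ} {ρ C ε : ℝ} (G G' : SimpleGraph (Fin n))
    (h1 : (n : ℝ) ≤ rn n ρ * eDens G) (h2 : (n : ℝ) ≤ rn n ρ * (1 - eDens G))
    (h3 : (n : ℝ) ≤ rn n ρ * eDens G') (h4 : (n : ℝ) ≤ rn n ρ * (1 - eDens G')) :
    (∫ q in Set.Icc (0 : ℝ) 1, hatDens n ρ C ε G q) =
      ∫ q in Set.Icc (0 : ℝ) 1, hatDens n ρ C ε G' q := by
  rw [Z_shift, Z_shift]
  set k : ℝ → ℝ := fun u => Real.exp (-(ε / 2) * (1 / (8 * C)) * min (rn n ρ * |u|) (n : ℝ))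
    with hk
  have hc : Continuous k := by rw [hk]; fun_prop
  have hr := rn_nonneg n ρ
  have hconst : ∀ u, (n : ℝ) ≤ rn n ρ * |u| →
      k u = Real.exp (-(ε / 2) * (1 / (8 * C)) * n) := by
    intro u hu
    simp only [hk, min_eq_right hu]
  have i1 : ∫ u in (eDens G)..(eDens G'), k u =
      ∫ u in (eDens G)..(eDens G'), Real.exp (-(ε / 2) * (1 / (8 * C)) * n) := by
    apply intervalIntegral.integral_congr
    intro u hu
    apply hconst
    rw [Set.mem_uIcc] at hu
    have : eDens G ≤ |u| ∨ eDens G' ≤ |u| := by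
      rcases hu with h | h
      · left; exact h.1.trans (le_abs_self u)
      · right; exact h.1.trans (le_abs_self u)
    rcases this with h | h
    · exact h1.trans (mul_le_mul_of_nonneg_left h hr)
    · exact h3.trans (mul_le_mul_of_nonneg_left h hr)
  have i2 : ∫ u in (eDens G - 1)..(eDens G' - 1), k u =
      ∫ u in (eDens G - 1)..(eDens G' - 1), Real.exp (-(ε / 2) * (1 / (8 * C)) * n) := by
    apply intervalIntegral.integral_congr
    intro u hu
    apply hconst
    rw [Set.mem_uIcc] at hu
    have hu' := neg_le_abs u
    have : 1 - eDens G ≤ |u| ∨ 1 - eDens G' ≤ |u| := by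
      rcases hu with h | h
      · right; linarith [h.2]
      · left; linarith [h.2]
    rcases this with h | h
    · exact h2.trans (mul_le_mul_of_nonneg_left h hr)
    · exact h4.trans (mul_le_mul_of_nonneg_left h hr)
  have := intervalIntegral.integral_interval_sub_interval_comm
    (hc.intervalIntegrable (μ := volume) (eDens G - 1) (eDens G))
    (hc.intervalIntegrable (eDens G' - 1) (eDens G'))
    (hc.intervalIntegrable (eDens G - 1) (eDens G' - 1))
  rw [i1, i2, intervalIntegral.integral_const, intervalIntegral.integral_const] at this
  have e : eDens G' - 1 - (eDens G - 1) = eDens G' - eDens G := by ring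
  rw [e, sub_self] at this
  linarith

lemma Z_pos (n : ℕ) (ρ C ε : ℝ) (G : SimpleGraph (Fin n)) :
    0 < ∫ q in Set.Icc (0 : ℝ) 1, hatDens n ρ C ε G q := by
  rw [Z_shift]
  apply intervalIntegral.intervalIntegral_pos_of_pos
  · apply Continuous.intervalIntegrable; fun_prop
  · intro x; exact Real.exp_pos _
  · linarith

lemma hatA_le {n : ℕ} {ρ C ε c₁ c₂ : ℝ} (G G' : SimpleGraph (Fin n)) (hc₁ : 0 < c₁) (hc₂ : 0 < c₂)
    (h : ∀ q, hatDens n ρ C ε G q ≤ c₁ * hatDens n ρ C ε G' q)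
    (hZ : (∫ q in Set.Icc (0 : ℝ) 1, hatDens n ρ C ε G' q) ≤
      c₂ * ∫ q in Set.Icc (0 : ℝ) 1, hatDens n ρ C ε G q) (S : Set ℝ) (hS : MeasurableSet S) :
    hatA n ρ C ε G S ≤ ENNReal.ofReal (c₂ * c₁) * hatA n ρ C ε G' S := by
  unfold hatA
  rw [Z_eq_ofReal, Z_eq_ofReal, Measure.smul_apply, Measure.smul_apply, smul_eq_mul, smul_eq_mul,
    withDensity_apply _ hS, withDensity_apply _ hS, ← ENNReal.ofReal_inv_of_pos (Z_pos ..),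
    ← ENNReal.ofReal_inv_of_pos (Z_pos ..), ENNReal.ofReal_mul hc₂.le, mul_mul_mul_comm]
  have hp := Z_pos n ρ C ε G
  have hp' := Z_pos n ρ C ε G'
  apply mul_le_mul'
  · rw [← ENNReal.ofReal_mul hc₂.le]
    apply ENNReal.ofReal_le_ofReal
    rw [← div_eq_mul_inv, le_div_iff₀ hp', inv_mul_le_iff₀ hp, mul_comm]
    exact hZ
  · rw [← lintegral_const_mul _ ((hatDens_cont n ρ C ε G').measurable.ennreal_ofReal)]
    apply lintegral_mono
    intro q
    show ENNReal.ofReal _ ≤ ENNReal.ofReal _ * ENNReal.ofReal _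
    rw [← ENNReal.ofReal_mul hc₁.le]
    exact ENNReal.ofReal_le_ofReal (h q)

lemma part_one (C ρ : ℝ) (hC : 48 < C) (hρ : ρ ∈ Set.Icc (0 : ℝ) 1) (n : ℕ) (ε : ℝ) (hε : 0 < ε)
    (G : SimpleGraph (Fin n)) (hG : G ∈ homogSet n ρ C) (G' : SimpleGraph (Fin n))
    (hG' : G' ∈ homogSet n ρ C) (S : Set ℝ) (hS : MeasurableSet S) :
    hatA n ρ C ε G S
      ≤ ENNReal.ofReal (Real.exp ((ε / 2) * (nodeDist G G' : ℝ))) * hatA n ρ C ε G' S := by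
  have hC0 : 0 < C := by linarith
  have ha : 0 ≤ (ε / 2) * (1 / (8 * C)) := by positivity
  have hle := hatDens_le (ρ := ρ) hC hε G G'
  rcases key_dist hC hρ.2 hG hG' with h | ⟨h, h1, h2, h3, h4⟩
  · have hZ : (∫ q in Set.Icc (0 : ℝ) 1, hatDens n ρ C ε G' q) ≤
        Real.exp ((ε / 2) * (1 / (8 * C)) * min (rn n ρ * |eDens G - eDens G'|) n) *
          ∫ q in Set.Icc (0 : ℝ) 1, hatDens n ρ C ε G q := by
      rw [← integral_const_mul]
      apply integral_mono (hat_integrable ..) ((hat_integrable ..).const_mul _)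
      intro q
      have := hatDens_le (ρ := ρ) hC hε G' G q
      rwa [abs_sub_comm] at this
    refine (hatA_le G G' (Real.exp_pos _) (Real.exp_pos _) hle hZ S hS).trans ?_
    gcongr
    rw [← Real.exp_add, Real.exp_le_exp]
    have := mul_le_mul_of_nonneg_left h ha
    have e : ε / 2 * (1 / (8 * C)) * (4 * C * nodeDist G G') = ε / 2 * nodeDist G G' / 2 := by
      field_simp; ring
    linarith
  · refine (hatA_le G G' (Real.exp_pos _) one_pos hle
      (by rw [one_mul, Z_eq G G' h1 h2 h3 h4]) S hS).trans ?_
    gcongr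
    rw [one_mul, Real.exp_le_exp]
    have := mul_le_mul_of_nonneg_left h ha
    have e : ε / 2 * (1 / (8 * C)) * (8 * C * nodeDist G G') = ε / 2 * nodeDist G G' := by
      field_simp
    linarith

lemma gauss_int {b : ℝ} (hb : 0 < b) :
    ∫ u : ℝ, u ^ 2 * Real.exp (-(b * |u|)) = 4 / b ^ 3 := by
  have h := integral_comp_abs (f := fun u : ℝ => u ^ 2 * Real.exp (-(b * u)))
  simp only [sq_abs] at h
  rw [h]
  have h2 := Real.integral_rpow_mul_exp_neg_mul_Ioi (a := 3) (by norm_num) hb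
  have e : (3 : ℝ) - 1 = (2 : ℕ) := by norm_num
  have e3 : (3 : ℝ) = (3 : ℕ) := by norm_num
  have g : Real.Gamma 3 = 2 := by
    rw [show (3 : ℝ) = ((2 : ℕ) : ℝ) + 1 by norm_num, Real.Gamma_nat_eq_factorial 2]
    norm_num
  rw [g, e] at h2
  simp only [Real.rpow_natCast] at h2
  rw [h2, e3, Real.rpow_natCast]
  field_simp
  norm_num

lemma gauss_integrable {b : ℝ} (hb : 0 < b) :
    Integrable (fun u : ℝ => u ^ 2 * Real.exp (-(b * |u|))) := by
  apply Integrable.of_integral_ne_zero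
  rw [gauss_int hb]
  positivity

lemma exp_min_le {a A m : ℝ} :
    Real.exp (-a * min A m) ≤ Real.exp (-(a * A)) + Real.exp (-(a * m)) := by
  rcases min_choice A m with h | h <;> rw [h, neg_mul]
  · linarith [Real.exp_pos (-(a * m))]
  · linarith [Real.exp_pos (-(a * A))]

lemma hatDens_eq (n : ℕ) (ρ C ε : ℝ) (G : SimpleGraph (Fin n)) (q : ℝ) :
    hatDens n ρ C ε G q
      = Real.exp (-(ε / (16 * C)) * min (rn n ρ * |eDens G - q|) (n : ℝ)) := by
  unfold hatDens
  congr 2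
  rw [neg_mul, div_mul_div_comm, mul_one]
  congr 2
  ring

lemma num_le {n : ℕ} {ρ C ε : ℝ} (G : SimpleGraph (Fin n)) (hx : eDens G ∈ Set.Icc (0 : ℝ) 1)
    (hb : 0 < ε / (16 * C) * rn n ρ) :
    ∫ q in Set.Icc (0 : ℝ) 1, hatDens n ρ C ε G q * (q - eDens G) ^ 2
      ≤ 4 / (ε / (16 * C) * rn n ρ) ^ 3 + Real.exp (-(ε / (16 * C) * n)) := by
  set b := ε / (16 * C) * rn n ρ with hbdef
  set x := eDens G with hxdef
  have hIntegrable : Integrable (fun q : ℝ => (q - x) ^ 2 * Real.exp (-(b * |q - x|))) :=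
    (gauss_integrable hb).comp_sub_right x
  have hle : ∀ q ∈ Set.Icc (0 : ℝ) 1, hatDens n ρ C ε G q * (q - x) ^ 2 ≤
      (q - x) ^ 2 * Real.exp (-(b * |q - x|)) + Real.exp (-(ε / (16 * C) * n)) := by
    intro q hq
    have h1 : hatDens n ρ C ε G q ≤
        Real.exp (-(b * |q - x|)) + Real.exp (-(ε / (16 * C) * n)) := by
      rw [hatDens_eq]
      refine exp_min_le.trans (le_of_eq ?_)
      rw [hbdef, abs_sub_comm q x, mul_assoc]
    have h2 : (q - x) ^ 2 ≤ 1 := by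
      rw [sq_le_one_iff_abs_le_one, abs_le]
      constructor <;> linarith [hq.1, hq.2, hx.1, hx.2]
    have h3 := mul_le_mul_of_nonneg_right h1 (sq_nonneg (q - x))
    have h4 := mul_le_mul_of_nonneg_left h2 (Real.exp_pos (-(ε / (16 * C) * n))).le
    linarith
  have hc := hatDens_cont n ρ C ε G
  calc ∫ q in Set.Icc (0 : ℝ) 1, hatDens n ρ C ε G q * (q - x) ^ 2
      ≤ ∫ q in Set.Icc (0 : ℝ) 1, ((q - x) ^ 2 * Real.exp (-(b * |q - x|))
          + Real.exp (-(ε / (16 * C) * n))) := by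
        apply setIntegral_mono_on _ _ measurableSet_Icc hle
        · exact (Continuous.continuousOn (by fun_prop)).integrableOn_Icc
        · exact (Continuous.continuousOn (by fun_prop)).integrableOn_Icc
    _ = (∫ q in Set.Icc (0 : ℝ) 1, (q - x) ^ 2 * Real.exp (-(b * |q - x|)))
          + Real.exp (-(ε / (16 * C) * n)) := by
        rw [integral_add hIntegrable.integrableOn (integrable_const _)]
        simp
    _ ≤ (∫ q : ℝ, (q - x) ^ 2 * Real.exp (-(b * |q - x|)))
          + Real.exp (-(ε / (16 * C) * n)) := by
        apply add_le_add_left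
        apply setIntegral_le_integral hIntegrable
        exact Filter.Eventually.of_forall fun q => by positivity
    _ = _ := by
        rw [integral_sub_right_eq_self (fun u : ℝ => u ^ 2 * Real.exp (-(b * |u|))) x, gauss_int hb]

lemma Z_ge {n : ℕ} {ρ C ε : ℝ} (G : SimpleGraph (Fin n)) (hx : eDens G ∈ Set.Icc (0 : ℝ) 1)
    (ha : 0 ≤ ε / (16 * C)) (hb : 2 ≤ ε / (16 * C) * rn n ρ) :
    Real.exp (-1) * (1 / (ε / (16 * C) * rn n ρ))
      ≤ ∫ q in Set.Icc (0 : ℝ) 1, hatDens n ρ C ε G q := by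
  set b := ε / (16 * C) * rn n ρ with hbdef
  set x := eDens G with hxdef
  have hb0 : 0 < b := by linarith
  have hb2 : 1 / b ≤ 1 / 2 := one_div_le_one_div_of_le (by norm_num) hb
  have hbp : 0 < 1 / b := by positivity
  obtain ⟨l, hl0, hl1, hl2, hl3⟩ : ∃ l : ℝ, 0 ≤ l ∧ l + 1 / b ≤ 1 ∧ x - 1 / b ≤ l ∧ l ≤ x := by
    rcases le_total x (1 / 2) with h | h
    · exact ⟨x, hx.1, by linarith, by linarith, le_rfl⟩
    · exact ⟨x - 1 / b, by linarith, by linarith [hx.2], le_rfl, by linarith⟩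
  have hsub : Set.Icc l (l + 1 / b) ⊆ Set.Icc (0 : ℝ) 1 := Set.Icc_subset_Icc hl0 hl1
  have hlow : ∀ q ∈ Set.Icc l (l + 1 / b), Real.exp (-1) ≤ hatDens n ρ C ε G q := by
    intro q hq
    rw [hatDens_eq, Real.exp_le_exp]
    have h1 : |x - q| ≤ 1 / b := by
      rw [abs_le]; constructor <;> linarith [hq.1, hq.2]
    have h2 := mul_le_mul_of_nonneg_left (min_le_left (rn n ρ * |x - q|) (n : ℝ)) ha
    have h3 := mul_le_mul_of_nonneg_left h1 hb0.le
    rw [mul_one_div_cancel hb0.ne'] at h3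
    rw [← mul_assoc, ← hbdef] at h2
    linarith
  calc Real.exp (-1) * (1 / b) = ∫ q in Set.Icc l (l + 1 / b), Real.exp (-1) := by
        rw [setIntegral_const, Real.volume_real_Icc_of_le (by linarith), smul_eq_mul]; ring
    _ ≤ ∫ q in Set.Icc l (l + 1 / b), hatDens n ρ C ε G q := by
        apply setIntegral_mono_on _ _ measurableSet_Icc hlow
        · exact continuousOn_const.integrableOn_Icc
        · exact (hatDens_cont n ρ C ε G).continuousOn.integrableOn_Icc
    _ ≤ _ := by
        apply setIntegral_mono_set (hat_integrable n ρ C ε G)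
        · exact Filter.Eventually.of_forall fun q => (hatDens_pos n ρ C ε G q).le
        · exact hsub.eventuallyLE

lemma hatA_integral {n : ℕ} {ρ C ε : ℝ} (G : SimpleGraph (Fin n)) :
    ∫ x, (x - eDens G) ^ 2 ∂(hatA n ρ C ε G) =
      (∫ q in Set.Icc (0 : ℝ) 1, hatDens n ρ C ε G q)⁻¹ *
        ∫ q in Set.Icc (0 : ℝ) 1, hatDens n ρ C ε G q * (q - eDens G) ^ 2 := by
  unfold hatA
  rw [integral_smul_measure, Z_eq_ofReal, ← ENNReal.ofReal_inv_of_pos (Z_pos ..),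
    ENNReal.toReal_ofReal (inv_nonneg.2 (Z_pos ..).le), smul_eq_mul,
    integral_withDensity_eq_integral_toReal_smul
      ((hatDens_cont n ρ C ε G).measurable.ennreal_ofReal)
      (Filter.Eventually.of_forall fun q => ENNReal.ofReal_lt_top)]
  congr 2
  ext q
  rw [ENNReal.toReal_ofReal (hatDens_pos ..).le, smul_eq_mul]

lemma rn_sq {n : ℕ} {ρ : ℝ} (hρ : 0 ≤ ρ) :
    (rn n ρ) ^ 2 = (n : ℝ) ^ 3 / (max ρ (Real.log n / n) * Real.log n) := by
  have hL : 0 ≤ Real.log n := Real.log_natCast_nonneg n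
  unfold rn
  rw [← (Real.sqrt_monotone).map_max, div_pow, mul_pow, Real.sq_sqrt hL,
    Real.sq_sqrt (le_max_of_le_left hρ), ← Real.rpow_natCast, ← Real.rpow_mul (by positivity)]
  norm_num

lemma mse_le {n : ℕ} {ρ C ε : ℝ} (G : SimpleGraph (Fin n)) (hx : eDens G ∈ Set.Icc (0 : ℝ) 1)
    (ha : 0 ≤ ε / (16 * C)) (hb : 2 ≤ ε / (16 * C) * rn n ρ)
    (hexp : (ε / (16 * C) * rn n ρ) ^ 3 * Real.exp (-(ε / (16 * C) * n)) ≤ 1) :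
    ∫ x, (x - eDens G) ^ 2 ∂(hatA n ρ C ε G) ≤
      5 * Real.exp 1 / (ε / (16 * C) * rn n ρ) ^ 2 := by
  have h1 := num_le (ρ := ρ) G hx (by linarith)
  have h2 := Z_ge (ρ := ρ) G hx ha hb
  rw [hatA_integral, inv_mul_le_iff₀ (Z_pos ..)]
  set b := ε / (16 * C) * rn n ρ with hbdef
  have hb0 : 0 < b := by linarith
  have h3 : Real.exp (-(ε / (16 * C) * n)) ≤ 1 / b ^ 3 := by
    rw [le_div_iff₀ (by positivity), mul_comm]; exact hexp
  have h4 : 0 ≤ 5 * Real.exp 1 / b ^ 2 := by positivity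
  have h5 := mul_le_mul_of_nonneg_right h2 h4
  have e : Real.exp (-1) * (1 / b) * (5 * Real.exp 1 / b ^ 2) = 5 / b ^ 3 := by
    rw [Real.exp_neg]
    field_simp
  have e2 : 5 / b ^ 3 = 4 / b ^ 3 + 1 / b ^ 3 := by ring
  linarith

lemma part_two (C ρ : ℝ) (hC : 48 < C) (hρ : ρ ∈ Set.Icc (0 : ℝ) 1) (εseq : ℕ → ℝ)
    (hε : ∀ n, εseq n ∈ Set.Ioo (0 : ℝ) 1)
    (hlim : Filter.Tendsto (fun n : ℕ => εseq n * (n : ℝ) / Real.log n) Filter.atTop Filter.atTop) :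
      ∃ K : ℝ, ∃ n₀ : ℕ, ∀ n : ℕ, n₀ ≤ n → ∀ G ∈ homogSet n ρ C,
        ∫ x, (x - eDens G) ^ 2 ∂(hatA n ρ C (εseq n) G)
          ≤ K * max ρ (Real.log n / n) * Real.log n / ((n : ℝ) ^ 3 * (εseq n) ^ 2) := by
  have hC0 : 0 < C := by linarith
  obtain ⟨n₁, hn₁⟩ := Filter.eventually_atTop.1 (hlim.eventually_ge_atTop (96 * C))
  refine ⟨5 * Real.exp 1 * (256 * C ^ 2), max n₁ 3, fun n hn G hG => ?_⟩
  have hn3 : (3 : ℝ) ≤ n := by exact_mod_cast (le_max_right _ _).trans hn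
  have hlarge := hn₁ n ((le_max_left _ _).trans hn)
  obtain ⟨hε0, hε1⟩ := hε n
  generalize εseq n = ε at *
  have hn0 : (0 : ℝ) < n := by linarith
  have hL1 : 1 ≤ Real.log n := by
    rw [Real.le_log_iff_exp_le hn0]
    linarith [Real.exp_one_lt_d9]
  have hL0 : 0 < Real.log n := by linarith
  have hLn : Real.log n ≤ n := by linarith [Real.log_le_sub_one_of_pos hn0]
  rw [le_div_iff₀ hL0] at hlarge
  have ha0 : 0 < ε / (16 * C) := by positivity
  have ha1 : ε / (16 * C) ≤ 1 := by rw [div_le_one (by positivity)]; linarith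
  have han : 6 * Real.log n ≤ ε / (16 * C) * n := by
    rw [div_mul_eq_mul_div, le_div_iff₀ (by positivity)]
    linarith
  have hr0 := rn_nonneg n ρ
  have hr2 := rn_sq (n := n) hρ.1
  have hmax0 : 0 < max ρ (Real.log n / n) := lt_max_of_lt_right (by positivity)
  have hmax1 : max ρ (Real.log n / n) ≤ 1 := max_le hρ.2 (by rw [div_le_one hn0]; exact hLn)
  have hmaxL : Real.log n / n ≤ max ρ (Real.log n / n) := le_max_right _ _
  set W := max ρ (Real.log n / n) with hW
  have hrlow : (n : ℝ) ≤ rn n ρ := by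
    apply le_of_sq_le_sq _ hr0
    rw [hr2, le_div_iff₀ (by positivity)]
    have : W * Real.log n ≤ 1 * n := mul_le_mul hmax1 hLn hL0.le zero_le_one
    nlinarith [sq_nonneg (n : ℝ)]
  have hrup : rn n ρ ≤ (n : ℝ) ^ 2 := by
    apply le_of_sq_le_sq _ (by positivity)
    rw [hr2, div_le_iff₀ (by positivity)]
    have : 1 / n ≤ W * Real.log n := by
      have h1 : 1 / n ≤ Real.log n / n := by gcongr
      have := mul_le_mul (h1.trans hmaxL) hL1 zero_le_one hmax0.le
      linarith
    have h2 := mul_le_mul_of_nonneg_left this (show (0 : ℝ) ≤ ((n : ℝ) ^ 2) ^ 2 by positivity)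
    have e : ((n : ℝ) ^ 2) ^ 2 * (1 / n) = (n : ℝ) ^ 3 := by field_simp
    linarith
  have hrpos : 0 < rn n ρ := by linarith
  have hb : 2 ≤ ε / (16 * C) * rn n ρ := by
    have := mul_le_mul_of_nonneg_left hrlow ha0.le
    linarith
  have hexp : (ε / (16 * C) * rn n ρ) ^ 3 * Real.exp (-(ε / (16 * C) * n)) ≤ 1 := by
    have h1 : ε / (16 * C) * rn n ρ ≤ (n : ℝ) ^ 2 := by
      have := mul_le_mul ha1 hrup hr0 zero_le_one
      linarith
    have h2 : (ε / (16 * C) * rn n ρ) ^ 3 ≤ ((n : ℝ) ^ 2) ^ 3 := by gcongr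
    rw [Real.exp_neg, ← div_eq_mul_inv, div_le_one (Real.exp_pos _)]
    refine h2.trans (le_trans (le_of_eq ?_) (Real.exp_le_exp.2 han))
    rw [show (6 : ℝ) * Real.log n = ((6 : ℕ) : ℝ) * Real.log n by norm_num, Real.exp_nat_mul,
      Real.exp_log hn0]
    ring
  refine (mse_le G ⟨eDens_nonneg G, hG.1.trans hρ.2⟩ ha0.le hb hexp).trans (le_of_eq ?_)
  rw [mul_pow, hr2]
  field_simp
  ring

/-- (i) `Â` is `(ε/2)`-node differentially private on the homogeneity set `H_{ρ,C}`, and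
(ii) for any sequence `ε_n ∈ (0,1)` with `ε_n·n/log n → ∞`, for all large `n` and all
`G ∈ H_{ρ,C}`, `E_{x ∼ Â(G)}[(x − e(G))²] ≤ K·max{ρ, (log n)/n}·(log n)/(n³·ε_n²)`. -/
theorem hatA_private_and_accurate (C ρ : ℝ) (hC : 48 < C) (hρ : ρ ∈ Set.Icc (0 : ℝ) 1) :
    (∀ n : ℕ, ∀ ε : ℝ, 0 < ε →
      ∀ G ∈ homogSet n ρ C, ∀ G' ∈ homogSet n ρ C, ∀ S : Set ℝ, MeasurableSet S →
        hatA n ρ C ε G S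
          ≤ ENNReal.ofReal (Real.exp ((ε / 2) * (nodeDist G G' : ℝ))) * hatA n ρ C ε G' S) ∧
    (∀ εseq : ℕ → ℝ, (∀ n, εseq n ∈ Set.Ioo (0 : ℝ) 1) →
      Filter.Tendsto (fun n : ℕ => εseq n * (n : ℝ) / Real.log n) Filter.atTop Filter.atTop →
      ∃ K : ℝ, ∃ n₀ : ℕ, ∀ n : ℕ, n₀ ≤ n → ∀ G ∈ homogSet n ρ C,
        ∫ x, (x - eDens G) ^ 2 ∂(hatA n ρ C (εseq n) G)
          ≤ K * max ρ (Real.log n / n) * Real.log n / ((n : ℝ) ^ 3 * (εseq n) ^ 2)) := by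
  exact ⟨part_one C ρ hC hρ, part_two C ρ hC hρ⟩

end
end

section
/- Let ε > 0 be a constant, let k_n be a sequence of positive integers with k_n = o(√n), suppose C(n,2) − k_n is even, and set m_n = (C(n,2) − k_n)/2. Then for every sequence of ε-node differentially private algorithms A_n mapping graphs on n vertices to probability measures on a measurable space (Ω,F), and every sequence of measurable sets S_n ∈ F, liminf_{n→∞} |P_{G ∼ G(n,m_n)}(A_n(G) ∈ S_n) − P_{H ∼ G(n, m_n + k_n)}(A_n(H) ∈ S_n)| ≤ exp(ε) − 1. -/
open MeasureTheory ProbabilityTheory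

noncomputable section

theorem cb_upper (t : ℕ) : (t.centralBinom)^2 * (2*t+1) ≤ 16^t := by
  induction t with
  | zero => simp
  | succ t ih =>
    have h := Nat.succ_mul_centralBinom_succ t
    have h2 : (t+1)^2 * ((t+1).centralBinom^2 * (2*(t+1)+1)) ≤ (t+1)^2 * 16^(t+1) := by
      calc (t+1)^2 * ((t+1).centralBinom^2 * (2*(t+1)+1))
          = ((t+1) * (t+1).centralBinom)^2 * (2*(t+1)+1) := by ring
        _ = (t.centralBinom^2 * (2*t+1)) * (4 * ((2*t+1) * (2*t+3))) := by rw [h]; ring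
        _ ≤ 16^t * (16 * (t+1)^2) := by
          apply Nat.mul_le_mul ih
          nlinarith
        _ = _ := by ring
    exact Nat.le_of_mul_le_mul_left h2 (by positivity)

theorem cb_lower (t : ℕ) (ht : 1 ≤ t) : 16^t ≤ (t.centralBinom)^2 * (4*t) := by
  induction t, ht using Nat.le_induction with
  | base => simp [Nat.centralBinom]
  | succ t ht ih =>
    have h := Nat.succ_mul_centralBinom_succ t
    have h2 : (t+1)^2 * 16^(t+1) ≤ (t+1)^2 * ((t+1).centralBinom^2 * (4*(t+1))) := by
      calc (t+1)^2 * 16^(t+1) = 16 ^ t * (16 * (t+1)^2) := by ring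
        _ ≤ (t.centralBinom^2 * (4*t)) * (16 * (t+1)^2) := Nat.mul_le_mul_right _ ih
        _ = (t.centralBinom^2 * (16 * (t+1))) * (4*t * (t+1)) := by ring
        _ ≤ (t.centralBinom^2 * (16 * (t+1))) * (2*t+1)^2 := by
          apply Nat.mul_le_mul_left
          nlinarith
        _ = ((t+1) * (t+1).centralBinom)^2 * (4*(t+1)) := by rw [h]; ring
        _ = _ := by ring
    exact Nat.le_of_mul_le_mul_left h2 (by positivity)

theorem cb_odd (t : ℕ) : (t+1).centralBinom = 2 * (2*t+1).choose t := by
  rw [Nat.centralBinom_eq_two_mul_choose, show 2*(t+1) = (2*t+1)+1 by ring, Nat.choose_succ_succ,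
    ← Nat.choose_symm_half]
  ring

theorem mid_upper (N : ℕ) : (N.choose (N/2))^2 * (N+1) ≤ 4^N := by
  rcases Nat.even_or_odd' N with ⟨t, rfl | rfl⟩
  · have := cb_upper t
    rw [Nat.centralBinom_eq_two_mul_choose] at this
    rw [pow_mul]
    simpa using this
  · have := cb_upper (t+1)
    rw [cb_odd] at this
    rw [show (2*t+1)/2 = t by omega]
    have e : (16:ℕ)^(t+1) = 4 * 4^(2*t+1) := by rw [show (16:ℕ) = 4^2 by norm_num, ← pow_mul]; ring
    rw [e] at this
    nlinarith [sq_nonneg ((2*t+1).choose t)]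

theorem mid_lower (N : ℕ) : 4^N ≤ (N.choose (N/2))^2 * (2*(N+1)) := by
  rcases Nat.even_or_odd' N with ⟨t, rfl | rfl⟩
  · rcases Nat.eq_zero_or_pos t with rfl | ht
    · simp
    have := cb_lower t ht
    rw [Nat.centralBinom_eq_two_mul_choose] at this
    rw [pow_mul, show 2*t/2 = t by omega]
    norm_num
    nlinarith [sq_nonneg ((2*t).choose t)]
  · have := cb_lower (t+1) (by omega)
    rw [cb_odd] at this
    rw [show (2*t+1)/2 = t by omega]
    have e : (16:ℕ)^(t+1) = 4 * 4^(2*t+1) := by rw [show (16:ℕ) = 4^2 by norm_num, ← pow_mul]; ring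
    rw [e] at this
    nlinarith [sq_nonneg ((2*t+1).choose t)]

theorem near_mid_step (m k : ℕ) (hN : 0 < 2*m+k) (hk : 2 * k ≤ 2*m+k) (i : ℕ) (hi : m + i ≤ (2*m+k)/2) :
    ((2*m+k).choose (m+i) : ℝ) * (1 - 2*k/((2*m+k : ℕ):ℝ))^i ≤ (2*m+k).choose m := by
  induction i with
  | zero => simp
  | succ i ih =>
    have ih := ih (by omega)
    refine le_trans ?_ ih
    set N := 2*m+k with hNd
    have hNr : (0:ℝ) < N := by exact_mod_cast hN
    have hr : (0:ℝ) ≤ 1 - 2*k/(N:ℝ) := by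
      rw [sub_nonneg, div_le_one hNr]; exact_mod_cast hk
    have h := Nat.choose_succ_right_eq N (m+i)
    have hs : ((N.choose (m+i+1) : ℕ):ℝ) * (m+i+1) = N.choose (m+i) * (N - m - i) := by
      have : ((N - (m+i) : ℕ):ℝ) = N - m - i := by
        rw [Nat.cast_sub (by omega)]; push_cast; ring
      rw [← this]; exact_mod_cast h
    have hpos : (0:ℝ) < N - m - i := by
      have : ((m + i + 1 : ℕ):ℝ) ≤ N := by exact_mod_cast (by omega)
      push_cast at this; linarith
    have key : ((N.choose (m+i+1) : ℕ):ℝ) * (1 - 2*k/(N:ℝ)) ≤ N.choose (m+i) := by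
      have h1 : (1 - 2*k/(N:ℝ)) * (N - m - i) ≤ m+i+1 := by
        have h2 : (N:ℝ) = 2*m+k := by rw [hNd]; push_cast; ring
        have h3 : (N:ℝ) ≤ 2 * (N - m - i) := by
          have : ((2*(m+i):ℕ):ℝ) ≤ N := by exact_mod_cast (by omega)
          push_cast at this; linarith
        have h4 : (k:ℝ) ≤ 2*k/(N:ℝ) * (N - m - i) := by
          rw [div_mul_eq_mul_div, le_div_iff₀ hNr]
          nlinarith [Nat.cast_nonneg (α := ℝ) k]
        nlinarith [Nat.cast_nonneg (α := ℝ) i]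
      refine le_of_mul_le_mul_right ?_ hpos
      rw [← hs, mul_assoc]
      exact mul_le_mul_of_nonneg_left h1 (by positivity)
    calc (N.choose (m+(i+1)) : ℝ) * (1 - 2*k/(N:ℝ))^(i+1)
        = (N.choose (m+i+1) * (1 - 2*k/(N:ℝ))) * (1 - 2*k/(N:ℝ))^i := by rw [pow_succ, ← add_assoc]; ring
      _ ≤ _ := mul_le_mul_of_nonneg_right key (by positivity)

theorem near_mid (m k : ℕ) (hN : 0 < 2*m+k) (hk : 4 * k^2 ≤ 2*m+k) :
    ((2*m+k).choose ((2*m+k)/2) : ℝ) ≤ 2 * (2*m+k).choose m := by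
  have hk2 : 2 * k ≤ 2*m+k := by nlinarith
  have h := near_mid_step m k hN hk2 (k/2) (by omega)
  rw [show m + k/2 = (2*m+k)/2 by omega] at h
  set N := 2*m+k with hNd
  have hNr : (0:ℝ) < N := by exact_mod_cast hN
  have hq : (2*k/(N:ℝ)) ≤ 1 := by
    rw [div_le_one hNr]; exact_mod_cast hk2
  have hb := one_add_mul_le_pow (a := -(2*k/(N:ℝ))) (by linarith) (k/2)
  have hc : (((k/2:ℕ):ℝ)) * (2*k/(N:ℝ)) ≤ 1/2 := by
    have : ((k/2:ℕ):ℝ) ≤ k := by exact_mod_cast Nat.div_le_self _ _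
    have h4 : 4*(k:ℝ)^2 ≤ N := by exact_mod_cast hk
    rw [← mul_div_assoc, div_le_iff₀ hNr]
    nlinarith [Nat.cast_nonneg (α := ℝ) k]
  have hd : (1/2:ℝ) ≤ (1 - 2*k/(N:ℝ))^(k/2) := by
    rw [sub_eq_add_neg]; linarith
  have := mul_le_mul_of_nonneg_left hd (Nat.cast_nonneg (α := ℝ) (N.choose (N/2)))
  linarith

theorem unimodal_sum (u : ℕ → ℝ) (p : ℕ) (h1 : ∀ j < p, u j ≤ u (j+1))
    (h2 : ∀ j, p ≤ j → u (j+1) ≤ u j) (L : ℕ) :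
    ∑ j ∈ Finset.range L, |u (j+1) - u j| = if L ≤ p then u L - u 0 else 2 * u p - u 0 - u L := by
  induction L with
  | zero => simp
  | succ L ih =>
    rw [Finset.sum_range_succ, ih]
    rcases lt_trichotomy L p with h | h | h
    · rw [if_pos h.le, if_pos (by omega), abs_of_nonneg (by linarith [h1 L h])]; ring
    · subst h
      rw [if_pos le_rfl, if_neg (by omega), abs_of_nonpos (by linarith [h2 L le_rfl])]; ring
    · rw [if_neg (by omega), if_neg (by omega), abs_of_nonpos (by linarith [h2 L h.le])]; ring

/-- number of ways to complete a base of size `j` to size `m` using `d` elements -/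
def comp (d j m : ℕ) : ℝ := if j ≤ m then (d.choose (m - j) : ℝ) else 0

theorem comp_step (d M L : ℕ) :
    ∑ j ∈ Finset.range L, |comp d j M - comp d j (M+1)| ≤ 2 * d.choose (d/2) := by
  have hu := unimodal_sum (fun j => comp d j (M+1)) (M+1-d/2) ?_ ?_ L
  · have e : ∀ j, comp d j M = comp d (j+1) (M+1) := by
      intro j; simp [comp]
    simp_rw [e]
    rw [hu]
    have nn : ∀ j, 0 ≤ comp d j (M+1) := by
      intro j; unfold comp; split_ifs <;> positivity
    have ub : ∀ j, comp d j (M+1) ≤ d.choose (d/2) := by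
      intro j; unfold comp; split_ifs
      · exact_mod_cast Nat.choose_le_middle _ _
      · positivity
    split_ifs
    · linarith [nn 0, ub L, nn L]
    · linarith [nn 0, nn L, ub (M+1-d/2)]
  · intro j hj
    simp only [comp]
    rw [if_pos (by omega), if_pos (by omega)]
    obtain ⟨i, hi⟩ : ∃ i, M + 1 - j = i + 1 := ⟨M - j, by omega⟩
    rw [hi, show M+1-(j+1) = i by omega]
    have h := Nat.choose_succ_right_eq d i
    have : d.choose (i+1) ≤ d.choose i := by
      refine Nat.le_of_mul_le_mul_right (c := i+1) ?_ (by omega)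
      rw [h]
      exact Nat.mul_le_mul_left _ (by omega)
    exact_mod_cast this
  · intro j hj
    simp only [comp]
    by_cases hjM : j + 1 ≤ M + 1
    · rw [if_pos (by omega), if_pos (by omega)]
      obtain ⟨i, hi⟩ : ∃ i, M + 1 - j = i + 1 := ⟨M - j, by omega⟩
      rw [hi, show M+1-(j+1) = i by omega]
      exact_mod_cast Nat.choose_le_succ_of_lt_half_left (by omega)
    · rw [if_neg hjM]
      split_ifs <;> positivity

theorem comp_sum (d M k L : ℕ) :
    ∑ j ∈ Finset.range L, |comp d j M - comp d j (M+k)| ≤ k * (2 * d.choose (d/2)) := by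
  induction k with
  | zero => simp
  | succ k ih =>
    have h := comp_step d (M+k) L
    calc _ ≤ ∑ j ∈ Finset.range L, (|comp d j M - comp d j (M+k)| + |comp d j (M+k) - comp d j (M+k+1)|) :=
          Finset.sum_le_sum fun j _ => abs_sub_le _ _ _
      _ ≤ _ := by rw [Finset.sum_add_distrib]; push_cast; linarith

theorem fiber_card {α : Type*} [DecidableEq α] (U D Z : Finset α) (hD : D ⊆ U) (hZ : Z ⊆ U \ D) (m : ℕ) :
    (((Finset.powersetCard m U).filter (fun X => X \ D = Z)).card : ℝ) = comp D.card Z.card m := by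
  have hdisj : Disjoint Z D := by
    rw [Finset.disjoint_left]; intro a ha hb
    exact (Finset.mem_sdiff.1 (hZ ha)).2 hb
  unfold comp
  split_ifs with h
  · rw [← Finset.card_powersetCard]
    norm_cast
    symm
    apply Finset.card_bij (fun W _ => Z ∪ W)
    · intro W hW
      rw [Finset.mem_powersetCard] at hW
      simp only [Finset.mem_filter, Finset.mem_powersetCard]
      refine ⟨⟨Finset.union_subset (hZ.trans Finset.sdiff_subset) (hW.1.trans hD), ?_⟩, ?_⟩
      · rw [Finset.card_union_of_disjoint (hdisj.mono_right hW.1), hW.2]; omega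
      · rw [Finset.union_sdiff_distrib, Finset.sdiff_eq_empty_iff_subset.2 hW.1, Finset.union_empty,
          Finset.sdiff_eq_self_of_disjoint hdisj]
    · intro W hW W' hW' he
      rw [Finset.mem_powersetCard] at hW hW'
      ext a
      have := congrArg (fun s => a ∈ s) he
      simp only [Finset.mem_union, eq_iff_iff] at this
      constructor
      · intro ha
        have hz : a ∉ Z := fun hz => Finset.disjoint_left.1 hdisj hz (hW.1 ha)
        tauto
      · intro ha
        have hz : a ∉ Z := fun hz => Finset.disjoint_left.1 hdisj hz (hW'.1 ha)
        tauto
    · intro X hX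
      simp only [Finset.mem_filter, Finset.mem_powersetCard] at hX
      obtain ⟨⟨hXU, hXm⟩, hXZ⟩ := hX
      refine ⟨X ∩ D, ?_, ?_⟩
      · rw [Finset.mem_powersetCard]
        refine ⟨Finset.inter_subset_right, ?_⟩
        have := Finset.card_sdiff_add_card_inter X D
        rw [hXZ] at this; omega
      · rw [← hXZ, Finset.sdiff_union_inter]
  · norm_cast
    rw [Finset.card_eq_zero, Finset.filter_eq_empty_iff]
    intro X hX he
    rw [Finset.mem_powersetCard] at hX
    have := Finset.card_le_card (Finset.sdiff_subset (s := X) (t := D))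
    rw [he] at this; omega

theorem base_sum {α : Type*} [DecidableEq α] (U D : Finset α) (hD : D ⊆ U) (m : ℕ)
    (g : Finset α → ℝ) :
    ∑ X ∈ Finset.powersetCard m U, g (X \ D) =
      ∑ Z ∈ (U \ D).powerset, g Z * comp D.card Z.card m := by
  rw [← Finset.sum_fiberwise_of_maps_to (t := (U \ D).powerset) (g := fun X => X \ D)]
  · apply Finset.sum_congr rfl
    intro Z hZ
    rw [← fiber_card U D Z hD (Finset.mem_powerset.1 hZ) m, mul_comm, ← nsmul_eq_mul]
    apply Finset.sum_eq_card_nsmul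
    intro X hX
    rw [(Finset.mem_filter.1 hX).2]
  · intro X hX
    rw [Finset.mem_powersetCard] at hX
    exact Finset.mem_powerset.2 (Finset.sdiff_subset_sdiff hX.1 le_rfl)

theorem base_diff {α : Type*} [DecidableEq α] (U D : Finset α) (hD : D ⊆ U) (m k : ℕ)
    (g : Finset α → ℝ) (g0 : ∀ X, 0 ≤ g X) (g1 : ∀ X, g X ≤ 1) :
    |∑ X ∈ Finset.powersetCard m U, g (X \ D) - ∑ X ∈ Finset.powersetCard (m+k) U, g (X \ D)| ≤
      k * (2 * D.card.choose (D.card/2)) * (U \ D).card.choose ((U \ D).card/2) := by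
  rw [base_sum U D hD, base_sum U D hD, ← Finset.sum_sub_distrib]
  refine (Finset.abs_sum_le_sum_abs _ _).trans ?_
  calc _ ≤ ∑ Z ∈ (U \ D).powerset, |comp D.card Z.card m - comp D.card Z.card (m+k)| := by
        apply Finset.sum_le_sum
        intro Z _
        rw [← mul_sub, abs_mul, abs_of_nonneg (g0 Z)]
        exact mul_le_of_le_one_left (abs_nonneg _) (g1 Z)
    _ = ∑ j ∈ Finset.range ((U \ D).card + 1), (U \ D).card.choose j • |comp D.card j m - comp D.card j (m+k)| :=
        Finset.sum_powerset_apply_card (fun j => |comp D.card j m - comp D.card j (m+k)|)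
    _ ≤ ∑ j ∈ Finset.range ((U \ D).card + 1), ((U \ D).card.choose ((U \ D).card/2) : ℝ) * |comp D.card j m - comp D.card j (m+k)| := by
        apply Finset.sum_le_sum
        intro j _
        rw [nsmul_eq_mul]
        apply mul_le_mul_of_nonneg_right _ (abs_nonneg _)
        exact_mod_cast Nat.choose_le_middle _ _
    _ ≤ _ := by
        rw [← Finset.mul_sum, mul_comm]
        exact mul_le_mul_of_nonneg_right (comp_sum _ _ _ _) (by positivity)

theorem abstract_bound {α : Type*} [DecidableEq α] [Fintype α] (U D : Finset α) (hD : D ⊆ U) (m k : ℕ)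
    (F : Finset α → ℝ) (F0 : ∀ X, 0 ≤ F X) (F1 : ∀ X, F X ≤ 1) (c : ℝ)
    (hF : ∀ X Y, X \ D = Y \ D → F X ≤ c * F Y) :
    (∑ X ∈ Finset.powersetCard m U, F X ≤ c * ∑ X ∈ Finset.powersetCard (m+k) U, F X +
      k * (2 * D.card.choose (D.card/2)) * (U \ D).card.choose ((U \ D).card/2)) ∧
    (∑ X ∈ Finset.powersetCard (m+k) U, F X ≤ c * ∑ X ∈ Finset.powersetCard m U, F X +
      k * (2 * D.card.choose (D.card/2)) * (U \ D).card.choose ((U \ D).card/2)) := by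
  set g : Finset α → ℝ := fun Z => ⨆ W : Finset α, F (Z ∪ (W ∩ D)) with hg
  have bdd : ∀ Z, BddAbove (Set.range fun W : Finset α => F (Z ∪ (W ∩ D))) := fun Z =>
    ⟨1, by rintro _ ⟨W, rfl⟩; exact F1 _⟩
  have g0 : ∀ Z, 0 ≤ g Z := fun Z => Real.iSup_nonneg fun W => F0 _
  have g1 : ∀ Z, g Z ≤ 1 := fun Z => ciSup_le fun W => F1 _
  have hlow : ∀ X, F X ≤ g (X \ D) := by
    intro X
    have := le_ciSup (bdd (X \ D)) X
    simpa only [Finset.sdiff_union_inter] using this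
  have hup : ∀ X, g (X \ D) ≤ c * F X := by
    intro X
    apply ciSup_le
    intro W
    apply hF
    ext a; simp only [Finset.mem_sdiff, Finset.mem_union, Finset.mem_inter]; tauto
  have hb := abs_le.1 (base_diff U D hD m k g g0 g1)
  have l : ∀ m, ∑ X ∈ Finset.powersetCard m U, F X ≤ ∑ X ∈ Finset.powersetCard m U, g (X \ D) :=
    fun m => Finset.sum_le_sum fun X _ => hlow X
  have u : ∀ m, ∑ X ∈ Finset.powersetCard m U, g (X \ D) ≤ c * ∑ X ∈ Finset.powersetCard m U, F X := by
    intro m; rw [Finset.mul_sum]; exact Finset.sum_le_sum fun X _ => hup X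
  constructor
  · linarith [l m, u (m+k), hb.1, hb.2]
  · linarith [l (m+k), u m, hb.1, hb.2]

theorem nodeDist_le_one {n : ℕ} (G G' : SimpleGraph (Fin n)) (h : Rewire G G') : nodeDist G G' ≤ 1 := by
  apply Nat.sInf_le
  refine ⟨fun i => if i = 0 then G else G', by simp, by simp, ?_⟩
  intro i hi
  obtain rfl : i = 0 := by omega
  simpa using h

theorem edgeCount_fromEdgeSet {n : ℕ} (X : Finset (Sym2 (Fin n)))
    (hX : X ⊆ (⊤ : SimpleGraph (Fin n)).edgeFinset) :
    (SimpleGraph.fromEdgeSet (X : Set (Sym2 (Fin n)))).edgeSet = X := by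
  rw [SimpleGraph.edgeSet_fromEdgeSet, sdiff_eq_left, Set.disjoint_left]
  intro e he hd
  have := hX (Finset.mem_coe.1 he)
  rw [SimpleGraph.mem_edgeFinset] at this
  exact SimpleGraph.not_isDiag_of_mem_edgeSet _ this hd

open Classical in
theorem graph_sum (n m : ℕ) (f : SimpleGraph (Fin n) → ℝ) :
    ∑ G ∈ Finset.univ.filter (fun G : SimpleGraph (Fin n) => edgeCount G = m), f G =
      ∑ X ∈ Finset.powersetCard m (⊤ : SimpleGraph (Fin n)).edgeFinset,
        f (SimpleGraph.fromEdgeSet (X : Set (Sym2 (Fin n)))) := by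
  symm
  apply Finset.sum_bij (fun (X : Finset (Sym2 (Fin n))) _ =>
    SimpleGraph.fromEdgeSet (X : Set (Sym2 (Fin n))))
  · intro X hX
    rw [Finset.mem_powersetCard] at hX
    rw [Finset.mem_filter]
    refine ⟨Finset.mem_univ _, ?_⟩
    unfold edgeCount
    rw [edgeCount_fromEdgeSet X hX.1, Set.ncard_coe_finset, hX.2]
  · intro X hX Y hY h
    rw [Finset.mem_powersetCard] at hX hY
    have := congrArg SimpleGraph.edgeSet h
    rw [edgeCount_fromEdgeSet X hX.1, edgeCount_fromEdgeSet Y hY.1] at this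
    exact_mod_cast this
  · intro G hG
    have hG := (Finset.mem_filter.1 hG).2
    unfold edgeCount at hG
    refine ⟨G.edgeFinset, ?_, ?_⟩
    · rw [Finset.mem_powersetCard]
      refine ⟨SimpleGraph.edgeFinset_mono le_top, ?_⟩
      rw [← hG, ← SimpleGraph.coe_edgeFinset, Set.ncard_coe_finset]
    · rw [SimpleGraph.coe_edgeFinset, SimpleGraph.fromEdgeSet_edgeSet]
  · intro X hX
    rfl

open Classical in
theorem gnm_integral (n m : ℕ) (f : SimpleGraph (Fin n) → ℝ) :
    ∫ G, f G ∂(gnm n m) =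
      (∑ X ∈ Finset.powersetCard m (⊤ : SimpleGraph (Fin n)).edgeFinset,
        f (SimpleGraph.fromEdgeSet (X : Set (Sym2 (Fin n))))) / ((n.choose 2).choose m : ℝ) := by
  have : MeasurableSingletonClass (SimpleGraph (Fin n)) := ⟨fun _ => trivial⟩
  set s := Finset.univ.filter (fun G : SimpleGraph (Fin n) => edgeCount G = m) with hs
  have hgs : gnm n m = uniformOn (s : Set (SimpleGraph (Fin n))) := by
    unfold gnm; congr 1; ext G; simp [hs]
  have hcard : (s.card : ℝ) = (n.choose 2).choose m := by
    have := graph_sum n m (fun _ => 1)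
    simp only [Finset.sum_const, Finset.card_powersetCard, nsmul_eq_mul, mul_one] at this
    rw [hs, this, SimpleGraph.card_edgeFinset_top_eq_card_choose_two, Fintype.card_fin]
  have hfin : IsFiniteMeasure (uniformOn (s : Set (SimpleGraph (Fin n)))) := by
    unfold uniformOn; infer_instance
  rw [hgs, integral_fintype (Integrable.of_finite), ← hcard, ← graph_sum, ← hs, Finset.sum_div]
  rw [← Finset.sum_subset (Finset.subset_univ s)]
  · apply Finset.sum_congr rfl
    intro G hG
    rw [measureReal_def, ← Finset.coe_singleton, uniformOn_apply_finset,
      Finset.inter_singleton_of_mem hG]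
    simp [div_eq_inv_mul]
  · intro G _ hG
    rw [measureReal_def, ← Finset.coe_singleton, uniformOn_apply_finset,
      Finset.inter_singleton_of_notMem hG]
    simp

theorem numeric (d m k : ℕ) (hN : (d+1).choose 2 = 2*m+k) (hk : 4*k^2 ≤ 2*m+k) (hpos : 0 < 2*m+k) :
    ((k * (2 * d.choose (d/2)) * ((d+1).choose 2 - d).choose (((d+1).choose 2 - d)/2) : ℝ))^2 * (d+1)
      ≤ 128 * k^2 * ((d+1).choose 2).choose m ^ 2 := by
  have hmid := near_mid m k hpos hk
  have hlow := mid_lower (2*m+k)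
  have hd := mid_upper d
  have hdN : d * (d+1) = 2 * (2*m+k) := by
    rw [← hN, Nat.choose_two_right, Nat.add_sub_cancel, mul_comm d (d+1)]
    exact (Nat.mul_div_cancel' (by rw [mul_comm]; exact (Nat.even_mul_succ_self d).two_dvd)).symm
  have hdle : d ≤ 2*m+k := by
    rcases Nat.eq_zero_or_pos d with h | h
    · omega
    · nlinarith
  rw [hN]
  obtain ⟨N', hN'⟩ : ∃ N', 2*m+k = N' + d := ⟨2*m+k-d, by omega⟩
  have h4 : (2*m+k) + 1 ≤ 4 * (N'+1) := by
    have : 3 * (d*(d+1)) + 6 ≥ 8*d := by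
      rcases Nat.lt_or_ge d 2 with h | h
      · interval_cases d <;> norm_num
      · nlinarith
    omega
  have hu := mid_upper N'
  rw [hN'] at hmid hlow h4 ⊢
  have hm0 : (0:ℝ) ≤ (N'+d).choose ((N'+d)/2) := by positivity
  rw [Nat.add_sub_cancel]
  set c : ℝ := ((N'+d).choose m : ℝ)
  set M : ℝ := ((N'+d).choose ((N'+d)/2) : ℝ) with hM
  set x : ℝ := (d.choose (d/2) : ℝ) with hx
  set y : ℝ := (N'.choose (N'/2) : ℝ) with hy
  have hlow' : (4:ℝ)^(N'+d) ≤ M^2 * (2*(N'+d+1)) := by rw [hM]; exact_mod_cast hlow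
  have hd' : x^2 * (d+1) ≤ 4^d := by rw [hx]; exact_mod_cast hd
  have hu' : y^2 * (N'+1) ≤ 4^N' := by rw [hy]; exact_mod_cast hu
  have h4' : (N':ℝ)+d+1 ≤ 4 * (N'+1) := by exact_mod_cast h4
  have hM2 : M^2 ≤ 4 * c^2 := by
    calc M^2 ≤ (2*c)^2 := pow_le_pow_left₀ hm0 hmid 2
      _ = _ := by ring
  refine le_of_mul_le_mul_right ?_ (show (0:ℝ) < N'+1 by positivity)
  calc ((k:ℝ) * (2 * x) * y)^2 * (d+1) * ((N':ℝ)+1)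
      = 4 * (k:ℝ)^2 * ((x^2 * (d+1)) * (y^2 * (N'+1))) := by ring
    _ ≤ 4 * (k:ℝ)^2 * (4^d * 4^N') := by gcongr
    _ = 4 * (k:ℝ)^2 * 4^(N'+d) := by rw [pow_add]; ring
    _ ≤ 4 * (k:ℝ)^2 * (M^2 * (2*(N'+d+1))) := by gcongr
    _ ≤ 4 * (k:ℝ)^2 * ((4*c^2) * (2*(4*(N'+1)))) := by gcongr
    _ = _ := by ring

theorem one_n (d m k : ℕ) (hN : (d+1).choose 2 = 2*m+k) (hk : 4*k^2 ≤ 2*m+k) (hpos : 0 < 2*m+k)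
    (c : ℝ) (hc : 1 ≤ c) (f : SimpleGraph (Fin (d+1)) → ℝ) (f0 : ∀ G, 0 ≤ f G) (f1 : ∀ G, f G ≤ 1)
    (hf : ∀ G G', nodeDist G G' ≤ 1 → f G ≤ c * f G') (δ : ℝ) (hδ : 0 < δ)
    (hkδ : 128 * (k:ℝ)^2 ≤ δ^2 * (d+1)) :
    |∫ G, f G ∂(gnm (d+1) m) - ∫ G, f G ∂(gnm (d+1) (m+k))| ≤ c - 1 + δ := by
  classical
  set U := (⊤ : SimpleGraph (Fin (d+1))).edgeFinset with hU
  set D := (⊤ : SimpleGraph (Fin (d+1))).incidenceFinset 0 with hDd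
  have hDU : D ⊆ U := SimpleGraph.incidenceFinset_subset _ _
  have hDc : D.card = d := by
    rw [hDd, SimpleGraph.card_incidenceFinset_eq_degree, SimpleGraph.complete_graph_degree]; simp
  have hUc : U.card = (d+1).choose 2 := by
    rw [hU, SimpleGraph.card_edgeFinset_top_eq_card_choose_two, Fintype.card_fin]
  have hUD : (U \ D).card = (d+1).choose 2 - d := by
    rw [Finset.card_sdiff_of_subset hDU, hUc, hDc]
  have hab := abstract_bound U D hDU m k
    (fun X => f (SimpleGraph.fromEdgeSet (X : Set (Sym2 (Fin (d+1))))))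
    (fun X => f0 _) (fun X => f1 _) c (by
      intro X Y hXY
      apply hf
      apply nodeDist_le_one
      refine ⟨0, fun a b ha hb => ?_⟩
      rw [SimpleGraph.fromEdgeSet_adj, SimpleGraph.fromEdgeSet_adj]
      have hn : s(a, b) ∉ D := by
        rw [hDd, SimpleGraph.mem_incidenceFinset]
        intro h
        have := h.2
        rw [Sym2.mem_iff] at this
        rcases this with h | h
        · exact ha h.symm
        · exact hb h.symm
      have := congrArg (fun s => s(a,b) ∈ s) hXY
      simp only [Finset.mem_sdiff, hn, not_false_eq_true, and_true, eq_iff_iff] at this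
      simp only [Finset.mem_coe, this])
  rw [hDc, hUD] at hab
  have hnum := numeric d m k hN hk hpos
  set T : ℝ := (k * (2 * d.choose (d/2)) * ((d+1).choose 2 - d).choose (((d+1).choose 2 - d)/2) : ℝ)
  rw [gnm_integral, gnm_integral]
  have hsymm : ((d+1).choose 2).choose (m+k) = ((d+1).choose 2).choose m :=
    Nat.choose_symm_of_eq_add (by omega)
  rw [hsymm]
  have hCpos : (0:ℝ) < ((d+1).choose 2).choose m := by
    exact_mod_cast Nat.choose_pos (by omega)
  set C : ℝ := (((d+1).choose 2).choose m : ℝ) with hC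
  have hT : T ≤ δ * C := by
    refine (le_abs_self T).trans (abs_le_of_sq_le_sq ?_ (by positivity))
    refine le_of_mul_le_mul_right ?_ (show (0:ℝ) < d+1 by positivity)
    calc _ ≤ _ := hnum
      _ ≤ (δ^2 * (d+1)) * C^2 := by gcongr
      _ = _ := by ring
  have hb : ∀ j, ((d+1).choose 2).choose j = ((d+1).choose 2).choose m →
      ∑ X ∈ Finset.powersetCard j U, f (SimpleGraph.fromEdgeSet (X : Set (Sym2 (Fin (d+1))))) ≤ C := by
    intro j hj
    calc _ ≤ ∑ X ∈ Finset.powersetCard j U, (1:ℝ) := Finset.sum_le_sum fun X _ => f1 _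
      _ = C := by simp [hUc, hj, hC]
  have b1 := hb m rfl
  have b2 := hb (m+k) hsymm
  set P := ∑ X ∈ Finset.powersetCard m U, f (SimpleGraph.fromEdgeSet (X : Set (Sym2 (Fin (d+1)))))
  set Q := ∑ X ∈ Finset.powersetCard (m+k) U, f (SimpleGraph.fromEdgeSet (X : Set (Sym2 (Fin (d+1)))))
  obtain ⟨h1, h2⟩ := hab
  rw [← sub_div, abs_div, abs_of_pos hCpos, div_le_iff₀ hCpos, abs_le]
  constructor <;> nlinarith

/-- Lower bound: no sequence of `ε`-node differentially private algorithms can distinguish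
`G(n, m_n)` from `G(n, m_n + k_n)` (with `k_n = o(√n)`, `m_n = (C(n,2) − k_n)/2`) with
advantage asymptotically exceeding `exp(ε) − 1`. -/
theorem gnm_indistinguishability (ε : ℝ) (hε : 0 < ε)
    (k : ℕ → ℕ) (hkpos : ∀ n, 0 < k n)
    (hko : Asymptotics.IsLittleO Filter.atTop (fun n : ℕ => (k n : ℝ))
      (fun n : ℕ => Real.sqrt n))
    (heven : ∀ n : ℕ, 2 ∣ (n.choose 2 - k n))
    {Ω : Type*} [MeasurableSpace Ω]
    (A : (n : ℕ) → SimpleGraph (Fin n) → Measure Ω)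
    (hprob : ∀ n G, IsProbabilityMeasure (A n G))
    (hdp : ∀ n : ℕ, ∀ G G' : SimpleGraph (Fin n), ∀ S : Set Ω, MeasurableSet S →
      A n G S ≤ ENNReal.ofReal (Real.exp (ε * (nodeDist G G' : ℝ))) * A n G' S)
    (S : ℕ → Set Ω) (hS : ∀ n, MeasurableSet (S n)) :
    Filter.liminf (fun n : ℕ =>
        |(∫ G, ((A n G) (S n)).toReal ∂(gnm n ((n.choose 2 - k n) / 2)))
          - (∫ G, ((A n G) (S n)).toReal ∂(gnm n ((n.choose 2 - k n) / 2 + k n)))|)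
      Filter.atTop ≤ Real.exp ε - 1 := by
  have hexp : 1 ≤ Real.exp ε := Real.one_le_exp hε.le
  apply le_of_forall_pos_le_add
  intro δ hδ
  apply Filter.liminf_le_of_frequently_le
  swap
  · exact ⟨0, by simp⟩
  apply Filter.Eventually.frequently
  have e1 := hko.bound (show (0:ℝ) < δ/12 by positivity)
  have e2 := hko.bound (show (0:ℝ) < 1/4 by norm_num)
  filter_upwards [e1, e2, Filter.eventually_ge_atTop 2] with n h1 h2 hn
  obtain ⟨d, rfl⟩ : ∃ d, n = d + 1 := ⟨n - 1, by omega⟩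
  rw [Real.norm_of_nonneg (by positivity), Real.norm_of_nonneg (by positivity)] at h1 h2
  have hk0 : (0:ℝ) ≤ k (d+1) := by positivity
  have hsq : Real.sqrt ((d+1:ℕ):ℝ) ^ 2 = d+1 := by
    rw [Real.sq_sqrt (by positivity)]; push_cast; ring
  have h1s := pow_le_pow_left₀ hk0 h1 2
  have h2s := pow_le_pow_left₀ hk0 h2 2
  rw [mul_pow, hsq] at h1s h2s
  have h2n : 16 * (k (d+1))^2 ≤ d+1 := by
    have : (16:ℝ) * (k (d+1))^2 ≤ d+1 := by linarith
    exact_mod_cast this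
  have hdN : d + 1 ≤ 2 * (d+1).choose 2 := by
    have := Nat.add_one_mul_choose_eq d 1
    simp only [Nat.choose_one_right, Nat.succ_eq_add_one] at this
    nlinarith
  have h4 : 4 * (k (d+1))^2 ≤ (d+1).choose 2 := by omega
  have hkN : k (d+1) ≤ (d+1).choose 2 := by nlinarith [hkpos (d+1)]
  have hE := heven (d+1)
  set m := ((d+1).choose 2 - k (d+1)) / 2 with hm
  have hN : (d+1).choose 2 = 2*m + k (d+1) := by omega
  apply one_n d m (k (d+1)) hN (by omega) (by omega) (Real.exp ε) hexp
    (fun G => ((A (d+1) G) (S (d+1))).toReal) (fun G => ENNReal.toReal_nonneg) _ _ δ hδ _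
  · intro G
    have := hprob (d+1) G
    exact measureReal_le_one
  · intro G G' hGG
    have := hprob (d+1) G'
    have h := hdp (d+1) G G' (S (d+1)) (hS (d+1))
    have h' := ENNReal.toReal_mono (ENNReal.mul_ne_top ENNReal.ofReal_ne_top (measure_ne_top _ _)) h
    rw [ENNReal.toReal_mul, ENNReal.toReal_ofReal (Real.exp_pos _).le] at h'
    refine h'.trans (mul_le_mul_of_nonneg_right ?_ ENNReal.toReal_nonneg)
    apply Real.exp_le_exp.2
    have : (nodeDist G G' : ℝ) ≤ 1 := by exact_mod_cast hGG
    nlinarith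
  · nlinarith [sq_nonneg δ]

end
end

section
/- There is an absolute constant K such that the following holds. Let n ≥ k ≥ 2 be integers, r ∈ [1/n, 1], Q ∈ [0,r]^{n×n} a symmetric matrix with zero diagonal, and A ∼ Bern₀(Q). Then E[ sup_π ( ⟨Q − Q(π)_π, Q − A⟩ − (1/16)·‖Q(π)_π − Q‖₂² ) ] ≤ K·r·(log k)/n, and E[ sup_π ( ⟨Q(n,π)_π − Q, Q − A⟩ − (1/16)·‖Q(n,π)_π − Q‖₂² ) ] ≤ K·r·(log k)/n, where both suprema range over all k-equipartitions π of [n]. -/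
open MeasureTheory

noncomputable section

/-- A `k`-equipartition of `[n]`: each class has size within `1` of `n/k`. -/
def IsEquipartition (n k : ℕ) (π : Fin n → Fin k) : Prop :=
  ∀ i : Fin k, |((Finset.univ.filter fun j => π j = i).card : ℝ) - (n : ℝ) / (k : ℝ)| < 1

/-- `B_π`: the `n×n` matrix with `(B_π)_{ij} = B_{π(i)π(j)}`. -/
def liftPart {n k : ℕ} (π : Fin n → Fin k) (B : Matrix (Fin k) (Fin k) ℝ) :
    Matrix (Fin n) (Fin n) ℝ := fun i j => B (π i) (π j)

/-- `B(π)`: the `k×k` matrix of block averages of `B` along `π`. -/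
def blockAvg {n k : ℕ} (π : Fin n → Fin k) (B : Matrix (Fin n) (Fin n) ℝ) :
    Matrix (Fin k) (Fin k) ℝ := fun i j =>
  (∑ l ∈ Finset.univ.filter (fun l => π l = i),
      ∑ m ∈ Finset.univ.filter (fun m => π m = j), B l m) /
    (((Finset.univ.filter fun l => π l = i).card : ℝ) *
      ((Finset.univ.filter fun m => π m = j).card : ℝ))

/-- `B(n,π)`: block averages rounded down to multiples of `1/n`. -/
def blockRound {n k : ℕ} (π : Fin n → Fin k) (B : Matrix (Fin n) (Fin n) ℝ) :
    Matrix (Fin k) (Fin k) ℝ := fun i j => (⌊(n : ℝ) * blockAvg π B i j⌋ : ℝ) / (n : ℝ)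

/-- Normalized `ℓ₂` norm of an `n×n` matrix: `‖A‖₂ = ((1/n²)·Σ A_{ij}²)^{1/2}`. -/
def nnorm {n : ℕ} (A : Matrix (Fin n) (Fin n) ℝ) : ℝ :=
  Real.sqrt ((∑ i, ∑ j, A i j ^ 2) / (n : ℝ) ^ 2)

/-- Normalized inner product of `n×n` matrices. -/
def ninner {n : ℕ} (A B : Matrix (Fin n) (Fin n) ℝ) : ℝ :=
  (∑ i, ∑ j, A i j * B i j) / (n : ℝ) ^ 2

/-- Normalized `ℓ₂` norm of a `k×k` matrix (normalized by `k²`). -/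
def knorm {k : ℕ} (C : Matrix (Fin k) (Fin k) ℝ) : ℝ :=
  Real.sqrt ((∑ i, ∑ j, C i j ^ 2) / (k : ℝ) ^ 2)

instance matMeas {n : ℕ} : MeasurableSpace (Matrix (Fin n) (Fin n) ℝ) :=
  inferInstanceAs (MeasurableSpace (Fin n → Fin n → ℝ))

/-- The symmetric `0/1` matrix with zero diagonal determined by a choice of entries above the
diagonal. -/
def boolMatrix {n : ℕ} (f : {p : Fin n × Fin n // p.1 < p.2} → Bool) :
    Matrix (Fin n) (Fin n) ℝ := fun i j =>
  if h : i < j then (if f ⟨(i, j), h⟩ then (1 : ℝ) else 0)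
  else if h' : j < i then (if f ⟨(j, i), h'⟩ then (1 : ℝ) else 0) else 0

/-- `Bern₀(Q)`: the law of a random symmetric `0/1` matrix with zero diagonal whose
above-diagonal entries are independent Bernoulli with parameters `Q_{ij}`. -/
def bern0 {n : ℕ} (Q : Matrix (Fin n) (Fin n) ℝ) : Measure (Matrix (Fin n) (Fin n) ℝ) :=
  ∑ f : {p : Fin n × Fin n // p.1 < p.2} → Bool,
    (ENNReal.ofReal (∏ e : {p : Fin n × Fin n // p.1 < p.2},
        if f e then Q e.val.1 e.val.2 else 1 - Q e.val.1 e.val.2)) •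
      Measure.dirac (boolMatrix f)

/-- `B_r`: the set of `k×k` matrices with entries in `[0,r]` that are integer multiples
of `1/n`. -/
def Bset (n k : ℕ) (r : ℝ) : Set (Matrix (Fin k) (Fin k) ℝ) :=
  {B | ∀ i j, B i j ∈ Set.Icc (0 : ℝ) r ∧ ∃ z : ℤ, B i j = (z : ℝ) / (n : ℝ)}

/-- `Score(B, A) = max_π (‖A‖₂² − ‖A − B_π‖₂²)` over `k`-equipartitions `π` of `[n]`. -/
def score {n k : ℕ} (B : Matrix (Fin k) (Fin k) ℝ) (A : Matrix (Fin n) (Fin n) ℝ) : ℝ :=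
  sSup {x : ℝ | ∃ π : Fin n → Fin k, IsEquipartition n k π ∧
    x = nnorm A ^ 2 - nnorm (A - liftPart π B) ^ 2}

/-- `δ̂₂(B,Q) = min_π ‖B_π − Q‖₂` over `k`-equipartitions `π` of `[n]`. -/
def hatDelta2 {n k : ℕ} (B : Matrix (Fin k) (Fin k) ℝ) (Q : Matrix (Fin n) (Fin n) ℝ) : ℝ :=
  sInf {x : ℝ | ∃ π : Fin n → Fin k, IsEquipartition n k π ∧ x = nnorm (liftPart π B - Q)}

/-- `ε̂_k^{(O)}(Q)`: the oracle error `min_{π, B} ‖B_π − Q‖₂`. -/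
def oracleErr (k : ℕ) {n : ℕ} (Q : Matrix (Fin n) (Fin n) ℝ) : ℝ :=
  sInf {x : ℝ | ∃ π : Fin n → Fin k, ∃ B : Matrix (Fin k) (Fin k) ℝ,
    IsEquipartition n k π ∧ x = nnorm (liftPart π B - Q)}


lemma aux_edge (q s : ℝ) (hq0 : 0 ≤ q) (hq1 : q ≤ 1) (hs : |s| ≤ 1) :
    q * Real.exp (s * (q - 1)) + (1 - q) * Real.exp (s * (q - 0)) ≤ Real.exp (q * s ^ 2) := by
  have key : ∀ x : ℝ, |x| ≤ 1 → Real.exp x ≤ 1 + x + x ^ 2 := by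
    intro x hx
    have := (abs_le.mp (Real.abs_exp_sub_one_sub_id_le hx)).2
    linarith
  have h1 := key (s * (q - 1)) (by
    rw [abs_mul]
    exact mul_le_one₀ hs (abs_nonneg _) (abs_le.mpr ⟨by linarith, by linarith⟩))
  have h2 := key (s * (q - 0)) (by
    rw [abs_mul]
    exact mul_le_one₀ hs (abs_nonneg _) (abs_le.mpr ⟨by linarith, by linarith⟩))
  have h3 := Real.add_one_le_exp (q * s ^ 2)
  have h4 := mul_le_mul_of_nonneg_left h1 hq0
  have h5 := mul_le_mul_of_nonneg_left h2 (sub_nonneg.mpr hq1)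
  have h6 : 0 ≤ q ^ 2 * s ^ 2 := by positivity
  nlinarith

lemma aux_edges {n : ℕ} (G : Fin n → Fin n → ℝ) :
    ∑ i, ∑ j, G i j = ∑ e : {p : Fin n × Fin n // p.1 < p.2},
      (G e.val.1 e.val.2 + G e.val.2 e.val.1) + ∑ i, G i i := by
  have h1 : ∀ H : Fin n → Fin n → ℝ,
      ∑ e : {p : Fin n × Fin n // p.1 < p.2}, H e.val.1 e.val.2
        = ∑ i, ∑ j, if i < j then H i j else 0 := by
    intro H
    rw [← Fintype.sum_prod_type' (fun i j => if i < j then H i j else 0), ← Finset.sum_filter]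
    exact (Finset.sum_subtype (Finset.univ.filter fun p : Fin n × Fin n => p.1 < p.2)
      (by simp) (fun p => H p.1 p.2)).symm
  rw [Finset.sum_add_distrib, h1 G, h1 (fun i j => G j i)]
  rw [Finset.sum_comm (f := fun i j => if i < j then G j i else 0)]
  rw [← Finset.sum_add_distrib, ← Finset.sum_add_distrib]
  refine Finset.sum_congr rfl fun i _ => ?_
  have h2 : G i i = ∑ j, if i = j then G i j else 0 := by simp
  rw [h2, ← Finset.sum_add_distrib, ← Finset.sum_add_distrib]
  refine Finset.sum_congr rfl fun j _ => ?_
  rcases lt_trichotomy i j with h | h | h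
  · simp [h, h.ne, h.not_gt]
  · simp [h]
  · simp [h, h.ne', h.not_gt]

/-- weight of a configuration -/
def auxW {n : ℕ} (Q : Matrix (Fin n) (Fin n) ℝ)
    (f : {p : Fin n × Fin n // p.1 < p.2} → Bool) : ℝ :=
  ∏ e : {p : Fin n × Fin n // p.1 < p.2},
        if f e then Q e.val.1 e.val.2 else 1 - Q e.val.1 e.val.2

lemma auxW_nonneg {n : ℕ} (Q : Matrix (Fin n) (Fin n) ℝ)
    (hQ : ∀ i j, Q i j ∈ Set.Icc (0 : ℝ) 1) (f) : 0 ≤ auxW Q f := by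
  refine Finset.prod_nonneg fun e _ => ?_
  have := hQ e.val.1 e.val.2
  split_ifs
  · exact this.1
  · linarith [this.2]

lemma auxW_sum {n : ℕ} (Q : Matrix (Fin n) (Fin n) ℝ) : ∑ f, auxW Q f = 1 := by
  have := Finset.prod_univ_sum (fun _ : {p : Fin n × Fin n // p.1 < p.2} => (Finset.univ : Finset Bool))
    (fun e b => if b then Q e.val.1 e.val.2 else 1 - Q e.val.1 e.val.2)
  rw [Fintype.piFinset_univ] at this
  unfold auxW
  rw [← this]
  simp

lemma aux_integral {n : ℕ} (Q : Matrix (Fin n) (Fin n) ℝ)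
    (hQ : ∀ i j, Q i j ∈ Set.Icc (0 : ℝ) 1) (F : Matrix (Fin n) (Fin n) ℝ → ℝ) :
    ∫ A, F A ∂(bern0 Q) = ∑ f, auxW Q f * F (boolMatrix f) := by
  have : MeasurableSingletonClass (Matrix (Fin n) (Fin n) ℝ) :=
    inferInstanceAs (MeasurableSingletonClass (Fin n → Fin n → ℝ))
  unfold bern0
  rw [integral_finsetSum_measure]
  · refine Finset.sum_congr rfl fun f _ => ?_
    rw [integral_smul_measure, integral_dirac, smul_eq_mul]
    exact congrArg (· * F (boolMatrix f)) (ENNReal.toReal_ofReal (auxW_nonneg Q hQ f))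
  · intro f _
    refine Integrable.smul_measure ?_ ENNReal.ofReal_ne_top
    exact integrable_dirac (by simp)

lemma aux_mgf_s15 {n : ℕ} (hn : 0 < n) (r : ℝ) (hr : 0 < r) (hr1 : r ≤ 1)
    (Q : Matrix (Fin n) (Fin n) ℝ) (hS : Q.IsSymm) (hD : ∀ i, Q i i = 0)
    (hQ : ∀ i j, Q i j ∈ Set.Icc (0 : ℝ) r) (M : Matrix (Fin n) (Fin n) ℝ)
    (hM : ∀ i j, |M i j| ≤ r) :
    ∑ f, auxW Q f * Real.exp ((n : ℝ) ^ 2 / (32 * r) *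
      (ninner M (Q - boolMatrix f) - (1 / 16) * nnorm M ^ 2)) ≤ 1 := by
  have hn' : (0 : ℝ) < n := by exact_mod_cast hn
  set s : {p : Fin n × Fin n // p.1 < p.2} → ℝ :=
    fun e => (M e.val.1 e.val.2 + M e.val.2 e.val.1) / (32 * r) with hs
  have hs1 : ∀ e, |s e| ≤ 1 := by
    intro e
    rw [hs]
    simp only
    rw [abs_div, abs_of_pos (by positivity : 0 < 32 * r), div_le_one (by positivity)]
    have := abs_add_le (M e.val.1 e.val.2) (M e.val.2 e.val.1)
    have := hM e.val.1 e.val.2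
    have := hM e.val.2 e.val.1
    linarith
  have hin : ∀ f, (n : ℝ) ^ 2 / (32 * r) * ninner M (Q - boolMatrix f)
      = ∑ e, s e * (Q e.val.1 e.val.2 - if f e then 1 else 0) := by
    intro f
    unfold ninner
    rw [aux_edges]
    have h0 : ∑ i, M i i * (Q - boolMatrix f) i i = 0 := by
      refine Finset.sum_eq_zero fun i _ => ?_
      simp [hD, boolMatrix]
    rw [h0, add_zero, div_mul_div_comm, mul_comm, mul_div_mul_right _ _ (by positivity),
      Finset.sum_div]
    refine Finset.sum_congr rfl fun e _ => ?_
    have he := e.property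
    have e1 : boolMatrix f e.val.1 e.val.2 = if f e then 1 else 0 := by
      simp [boolMatrix, he]
    have e2 : boolMatrix f e.val.2 e.val.1 = if f e then 1 else 0 := by
      simp [boolMatrix, he, he.not_gt]
    have e3 : Q e.val.2 e.val.1 = Q e.val.1 e.val.2 := hS.apply _ _
    rw [Matrix.sub_apply, Matrix.sub_apply, e1, e2, e3, hs]
    ring
  have hnn : (n : ℝ) ^ 2 / (32 * r) * ((1 / 16) * nnorm M ^ 2)
      = (∑ i, ∑ j, M i j ^ 2) / (512 * r) := by
    unfold nnorm
    rw [Real.sq_sqrt (by positivity)]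
    field_simp
    ring
  have hquad : ∑ e : {p : Fin n × Fin n // p.1 < p.2}, Q e.val.1 e.val.2 * s e ^ 2
      ≤ (∑ i, ∑ j, M i j ^ 2) / (512 * r) := by
    rw [aux_edges, add_div, Finset.sum_div]
    have : 0 ≤ (∑ i, M i i ^ 2) / (512 * r) := by positivity
    refine le_trans (Finset.sum_le_sum fun e _ => ?_) (le_add_of_nonneg_right this)
    have h1 : Q e.val.1 e.val.2 * s e ^ 2 ≤ r * s e ^ 2 :=
      mul_le_mul_of_nonneg_right (hQ _ _).2 (sq_nonneg _)
    refine h1.trans ?_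
    rw [hs]
    simp only
    rw [div_pow, mul_div_assoc', div_le_div_iff₀ (by positivity) (by positivity)]
    have h2 : 0 ≤ (M e.val.1 e.val.2 - M e.val.2 e.val.1) ^ 2 * r ^ 2 := by positivity
    nlinarith
  have hfac : ∑ f, auxW Q f * Real.exp (∑ e, s e * (Q e.val.1 e.val.2 - if f e then 1 else 0))
      = ∏ e : {p : Fin n × Fin n // p.1 < p.2},
        (Q e.val.1 e.val.2 * Real.exp (s e * (Q e.val.1 e.val.2 - 1))
        + (1 - Q e.val.1 e.val.2) * Real.exp (s e * (Q e.val.1 e.val.2 - 0))) := by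
    have := Finset.prod_univ_sum
      (fun _ : {p : Fin n × Fin n // p.1 < p.2} => (Finset.univ : Finset Bool))
      (fun e b => (if b then Q e.val.1 e.val.2 else 1 - Q e.val.1 e.val.2) *
        Real.exp (s e * (Q e.val.1 e.val.2 - if b then 1 else 0)))
    rw [Fintype.piFinset_univ] at this
    simp only [Fintype.sum_bool, if_true, Bool.false_eq_true, if_false] at this
    rw [this]
    refine Finset.sum_congr rfl fun f _ => ?_
    rw [Finset.prod_mul_distrib, Real.exp_sum]
    rfl
  have hprod : ∑ f, auxW Q f * Real.exp (∑ e, s e * (Q e.val.1 e.val.2 - if f e then 1 else 0))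
      ≤ Real.exp ((∑ i, ∑ j, M i j ^ 2) / (512 * r)) := by
    rw [hfac]
    refine le_trans ?_ (Real.exp_le_exp.mpr hquad)
    rw [Real.exp_sum]
    refine Finset.prod_le_prod (fun e _ => ?_) (fun e _ => ?_)
    · have := hQ e.val.1 e.val.2
      have h1 : 0 ≤ 1 - Q e.val.1 e.val.2 := by linarith [this.2]
      have h0 := this.1
      positivity
    · have := hQ e.val.1 e.val.2
      exact aux_edge _ _ this.1 (this.2.trans hr1) (hs1 e)
  calc _ = (∑ f, auxW Q f * Real.exp (∑ e, s e * (Q e.val.1 e.val.2 - if f e then 1 else 0)))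
        * Real.exp (-((∑ i, ∑ j, M i j ^ 2) / (512 * r))) := by
        rw [Finset.sum_mul]
        refine Finset.sum_congr rfl fun f _ => ?_
        rw [mul_sub, hin, hnn, sub_eq_add_neg, Real.exp_add, mul_assoc]
    _ ≤ Real.exp ((∑ i, ∑ j, M i j ^ 2) / (512 * r))
        * Real.exp (-((∑ i, ∑ j, M i j ^ 2) / (512 * r))) :=
        mul_le_mul_of_nonneg_right hprod (Real.exp_pos _).le
    _ = 1 := by rw [← Real.exp_add]; simp

lemma aux_main {n k : ℕ} (hk : 2 ≤ k) (hkn : k ≤ n) (r : ℝ) (hr : 0 < r) (hr1 : r ≤ 1)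
    (Q : Matrix (Fin n) (Fin n) ℝ) (hS : Q.IsSymm) (hD : ∀ i, Q i i = 0)
    (hQ : ∀ i j, Q i j ∈ Set.Icc (0 : ℝ) r)
    (M : (Fin n → Fin k) → Matrix (Fin n) (Fin n) ℝ) (hM : ∀ π i j, |M π i j| ≤ r) :
    ∫ A, sSup {x : ℝ | ∃ π : Fin n → Fin k, IsEquipartition n k π ∧
            x = ninner (M π) (Q - A) - (1 / 16) * nnorm (M π) ^ 2} ∂(bern0 Q)
          ≤ 32 * r * Real.log k / n := by
  have hn : 0 < n := by omega
  have hn' : (0 : ℝ) < n := by exact_mod_cast hn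
  have hQ1 : ∀ i j, Q i j ∈ Set.Icc (0 : ℝ) 1 := fun i j => ⟨(hQ i j).1, (hQ i j).2.trans hr1⟩
  rw [aux_integral Q hQ1]
  set c : ℝ := (n : ℝ) ^ 2 / (32 * r) with hc
  have hcpos : 0 < c := by positivity
  set L : ℝ := n * Real.log k with hL
  have hkpos : (0 : ℝ) < k := by exact_mod_cast (by omega : 0 < k)
  have hexpL : Real.exp L = (k : ℝ) ^ n := by
    rw [hL, Real.exp_nat_mul, Real.exp_log hkpos]
  have hL1 : 1 ≤ L := by
    have h2 : Real.log 2 ≤ Real.log k := Real.log_le_log (by norm_num) (by exact_mod_cast hk)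
    have h3 := Real.log_two_gt_d9
    have h4 : (2 : ℝ) ≤ n := by exact_mod_cast hk.trans hkn
    rw [hL]
    nlinarith
  set X : (Fin n → Fin k) → ({p : Fin n × Fin n // p.1 < p.2} → Bool) → ℝ :=
    fun π f => ninner (M π) (Q - boolMatrix f) - (1 / 16) * nnorm (M π) ^ 2 with hX
  set Y : ({p : Fin n × Fin n // p.1 < p.2} → Bool) → ℝ :=
    fun f => ∑ π, Real.exp (c * X π f) with hY
  have hYpos : ∀ f, 0 ≤ Y f := fun f => Finset.sum_nonneg fun _ _ => (Real.exp_pos _).le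
  have hpt : ∀ f, sSup {x : ℝ | ∃ π : Fin n → Fin k, IsEquipartition n k π ∧
      x = ninner (M π) (Q - boolMatrix f) - (1 / 16) * nnorm (M π) ^ 2}
      ≤ (Y f * Real.exp (-L) - 1 + L) / c := by
    intro f
    refine Real.sSup_le ?_ ?_
    · rintro x ⟨π, -, rfl⟩
      rw [le_div_iff₀ hcpos]
      have h1 := Real.add_one_le_exp (c * X π f + -L)
      rw [Real.exp_add] at h1
      have h2 : Real.exp (c * X π f) ≤ Y f :=
        Finset.single_le_sum (f := fun π => Real.exp (c * X π f))
          (fun _ _ => (Real.exp_pos _).le) (Finset.mem_univ π)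
      have h3 := mul_le_mul_of_nonneg_right h2 (Real.exp_pos (-L)).le
      change X π f * c ≤ _
      linarith
    · have := mul_nonneg (hYpos f) (Real.exp_pos (-L)).le
      exact div_nonneg (by linarith) hcpos.le
  have hEY : ∑ f, auxW Q f * Y f ≤ Real.exp L := by
    simp only [hY, Finset.mul_sum]
    rw [Finset.sum_comm]
    calc _ ≤ ∑ π : Fin n → Fin k, (1 : ℝ) :=
          Finset.sum_le_sum fun π _ => aux_mgf_s15 hn r hr hr1 Q hS hD hQ (M π) (hM π)
      _ = Real.exp L := by rw [hexpL]; simp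
  calc _ ≤ ∑ f, auxW Q f * ((Y f * Real.exp (-L) - 1 + L) / c) :=
        Finset.sum_le_sum fun f _ => mul_le_mul_of_nonneg_left (hpt f) (auxW_nonneg Q hQ1 f)
    _ = ((∑ f, auxW Q f * Y f) * Real.exp (-L) + (∑ f, auxW Q f) * (L - 1)) / c := by
        rw [Finset.sum_mul, Finset.sum_mul, ← Finset.sum_add_distrib, Finset.sum_div]
        refine Finset.sum_congr rfl fun f _ => ?_
        ring
    _ ≤ (Real.exp L * Real.exp (-L) + 1 * (L - 1)) / c := by
        rw [auxW_sum]
        have := mul_le_mul_of_nonneg_right hEY (Real.exp_pos (-L)).le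
        gcongr
    _ = L / c := by rw [← Real.exp_add]; simp
    _ = 32 * r * Real.log k / n := by
        rw [hL, hc]; field_simp

lemma aux_blockAvg {n k : ℕ} (r : ℝ) (hr : 0 < r) (Q : Matrix (Fin n) (Fin n) ℝ)
    (hQ : ∀ i j, Q i j ∈ Set.Icc (0 : ℝ) r) (π : Fin n → Fin k) (i j : Fin k) :
    blockAvg π Q i j ∈ Set.Icc (0 : ℝ) r := by
  unfold blockAvg
  constructor
  · exact div_nonneg (Finset.sum_nonneg fun l _ => Finset.sum_nonneg fun m _ => (hQ l m).1)
      (by positivity)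
  · refine div_le_of_le_mul₀ (by positivity) hr.le ?_
    calc _ ≤ ∑ l ∈ Finset.univ.filter (fun l => π l = i),
          ∑ m ∈ Finset.univ.filter (fun m => π m = j), r :=
          Finset.sum_le_sum fun l _ => Finset.sum_le_sum fun m _ => (hQ l m).2
      _ = _ := by
          simp only [Finset.sum_const, nsmul_eq_mul]; ring

lemma aux_blockRound {n k : ℕ} (hn : 0 < n) (r : ℝ) (hr : 0 < r) (Q : Matrix (Fin n) (Fin n) ℝ)
    (hQ : ∀ i j, Q i j ∈ Set.Icc (0 : ℝ) r) (π : Fin n → Fin k) (i j : Fin k) :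
    blockRound π Q i j ∈ Set.Icc (0 : ℝ) r := by
  have hn' : (0 : ℝ) < n := by exact_mod_cast hn
  have h := aux_blockAvg r hr Q hQ π i j
  unfold blockRound
  constructor
  · refine div_nonneg ?_ hn'.le
    exact_mod_cast Int.floor_nonneg.mpr (mul_nonneg hn'.le h.1)
  · rw [div_le_iff₀ hn']
    have := Int.floor_le ((n : ℝ) * blockAvg π Q i j)
    nlinarith [h.2]

lemma aux_nnorm_sub {n : ℕ} (A B : Matrix (Fin n) (Fin n) ℝ) : nnorm (A - B) = nnorm (B - A) := by
  unfold nnorm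
  congr 2
  refine Finset.sum_congr rfl fun i _ => Finset.sum_congr rfl fun j _ => ?_
  simp only [Matrix.sub_apply]
  ring

/-- There is an absolute constant `K` such that for `n ≥ k ≥ 2`, `r ∈ [1/n, 1]`, a symmetric
matrix `Q ∈ [0,r]^{n×n}` with zero diagonal, and `A ∼ Bern₀(Q)`, both
`E[sup_π (⟨Q − Q(π)_π, Q − A⟩ − (1/16)‖Q(π)_π − Q‖₂²)]` and
`E[sup_π (⟨Q(n,π)_π − Q, Q − A⟩ − (1/16)‖Q(n,π)_π − Q‖₂²)]` are at most `K·r·(log k)/n`. -/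
theorem blockAvg_oscillation_bound :
    ∃ K : ℝ, ∀ n k : ℕ, 2 ≤ k → k ≤ n → ∀ r : ℝ, 1 / (n : ℝ) ≤ r → r ≤ 1 →
      ∀ Q : Matrix (Fin n) (Fin n) ℝ, Q.IsSymm → (∀ i, Q i i = 0) →
        (∀ i j, Q i j ∈ Set.Icc (0 : ℝ) r) →
      (∫ A, sSup {x : ℝ | ∃ π : Fin n → Fin k, IsEquipartition n k π ∧
            x = ninner (Q - liftPart π (blockAvg π Q)) (Q - A)
              - (1 / 16) * nnorm (liftPart π (blockAvg π Q) - Q) ^ 2} ∂(bern0 Q)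
          ≤ K * r * Real.log k / n) ∧
      (∫ A, sSup {x : ℝ | ∃ π : Fin n → Fin k, IsEquipartition n k π ∧
            x = ninner (liftPart π (blockRound π Q) - Q) (Q - A)
              - (1 / 16) * nnorm (liftPart π (blockRound π Q) - Q) ^ 2} ∂(bern0 Q)
          ≤ K * r * Real.log k / n) := by
  refine ⟨32, ?_⟩
  intro n k hk hkn r hr hr1 Q hS hD hQ
  have hn : 0 < n := by omega
  have hn' : (0 : ℝ) < n := by exact_mod_cast hn
  have hr0 : 0 < r := lt_of_lt_of_le (by positivity) hr
  constructor
  · simp only [aux_nnorm_sub (liftPart _ _) Q]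
    refine aux_main hk hkn r hr0 hr1 Q hS hD hQ
      (fun π => Q - liftPart π (blockAvg π Q)) fun π i j => ?_
    have h1 := aux_blockAvg r hr0 Q hQ π (π i) (π j)
    have h2 := hQ i j
    simp only [Matrix.sub_apply, liftPart]
    exact abs_le.mpr ⟨by linarith [h1.2, h2.1], by linarith [h1.1, h2.2]⟩
  · refine aux_main hk hkn r hr0 hr1 Q hS hD hQ
      (fun π => liftPart π (blockRound π Q) - Q) fun π i j => ?_
    have h1 := aux_blockRound hn r hr0 Q hQ π (π i) (π j)
    have h2 := hQ i j
    simp only [Matrix.sub_apply, liftPart]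
    exact abs_le.mpr ⟨by linarith [h1.1, h2.2], by linarith [h1.2, h2.1]⟩

end
end

section
/- There is an absolute constant K such that the following holds. Let n ≥ k ≥ 2 be integers, r ∈ [1/n, 1], Q ∈ [0,r]^{n×n} a symmetric matrix with zero diagonal, and A ∼ Bern₀(Q). Then E[ sup_{C ∈ B_r, π} ( ⟨C_π, Q − A⟩ − (1/16)·‖C‖₂² ) ] ≤ K·r·( (log k)/n + k²/n² ), where the supremum ranges over all matrices C ∈ B_r and all k-equipartitions π of [n], and ‖C‖₂ = ((1/k²)·Σ_{i,j} C_{ij}²)^{1/2}. -/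
open MeasureTheory

noncomputable section

lemma mgf1 (q x : ℝ) (hq : 0 ≤ q) (hx : 0 ≤ x) :
    q * Real.exp (x * (q - 1)) + (1 - q) * Real.exp (x * q) ≤ Real.exp (q * x ^ 2) := by
  have h1 : Real.exp (-x) ≤ 1 - x + x ^ 2 := by
    have h2 : 1 + x ≤ Real.exp x := by linarith [Real.add_one_le_exp x]
    rw [Real.exp_neg]
    rw [inv_le_iff_one_le_mul₀ (Real.exp_pos x)]
    have h3 : 0 ≤ 1 - x + x ^ 2 := by nlinarith [sq_nonneg (x - 1), sq_nonneg x]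
    have h4 : (1 - x + x ^ 2) * (1 + x) ≤ (1 - x + x ^ 2) * Real.exp x :=
      mul_le_mul_of_nonneg_left h2 h3
    nlinarith [pow_nonneg hx 3]
  have e1 : Real.exp (x * (q - 1)) = Real.exp (x * q) * Real.exp (-x) := by
    rw [← Real.exp_add]; congr 1; ring
  have e2 : q * Real.exp (x * (q - 1)) + (1 - q) * Real.exp (x * q)
      = Real.exp (x * q) * (q * (Real.exp (-x) - 1) + 1) := by rw [e1]; ring
  rw [e2]
  have h5 : q * (Real.exp (-x) - 1) + 1 ≤ Real.exp (q * (x ^ 2 - x)) := by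
    have := Real.add_one_le_exp (q * (x ^ 2 - x))
    have h6 : q * (Real.exp (-x) - 1) ≤ q * (x ^ 2 - x) :=
      mul_le_mul_of_nonneg_left (by linarith) hq
    linarith
  calc Real.exp (x * q) * (q * (Real.exp (-x) - 1) + 1)
      ≤ Real.exp (x * q) * Real.exp (q * (x ^ 2 - x)) :=
        mul_le_mul_of_nonneg_left h5 (Real.exp_pos _).le
    _ = Real.exp (q * x ^ 2) := by rw [← Real.exp_add]; congr 1; ring

def bw {ι : Type*} [Fintype ι] (q : ι → ℝ) (f : ι → Bool) : ℝ :=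
  ∏ e, if f e then q e else 1 - q e

lemma bw_nonneg {ι : Type*} [Fintype ι] (q : ι → ℝ) (h : ∀ e, 0 ≤ q e ∧ q e ≤ 1)
    (f : ι → Bool) : 0 ≤ bw q f := by
  unfold bw
  refine Finset.prod_nonneg fun e _ => ?_
  split_ifs
  · exact (h e).1
  · linarith [(h e).2]

lemma sum_prod_bool {ι : Type*} [Fintype ι] [DecidableEq ι] (g : ι → Bool → ℝ) :
    ∑ f : ι → Bool, ∏ e, g e (f e) = ∏ e, (g e true + g e false) := by
  have := Finset.prod_univ_sum (fun _ : ι => (Finset.univ : Finset Bool)) g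
  rw [Fintype.piFinset_univ] at this
  rw [← this]
  simp

lemma bw_sum {ι : Type*} [Fintype ι] [DecidableEq ι] (q : ι → ℝ) :
    ∑ f : ι → Bool, bw q f = 1 := by
  unfold bw
  rw [sum_prod_bool (fun e b => if b then q e else 1 - q e)]
  simp

lemma bw_mgf {ι : Type*} [Fintype ι] [DecidableEq ι] (q x : ι → ℝ)
    (h : ∀ e, 0 ≤ q e ∧ q e ≤ 1) (hx : ∀ e, 0 ≤ x e) :
    ∑ f : ι → Bool, bw q f * Real.exp (∑ e, x e * (q e - if f e then 1 else 0))
      ≤ Real.exp (∑ e, q e * x e ^ 2) := by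
  have h1 : ∀ f : ι → Bool, bw q f * Real.exp (∑ e, x e * (q e - if f e then 1 else 0))
      = ∏ e, (fun (e : ι) (b : Bool) => (if b then q e else 1 - q e) *
          Real.exp (x e * (q e - if b then 1 else 0))) e (f e) := by
    intro f
    rw [Real.exp_sum, bw, ← Finset.prod_mul_distrib]
  rw [Finset.sum_congr rfl fun f _ => h1 f, sum_prod_bool (fun (e : ι) (b : Bool) =>
    (if b then q e else 1 - q e) * Real.exp (x e * (q e - if b then 1 else 0))), Real.exp_sum]
  refine Finset.prod_le_prod (fun e _ => ?_) (fun e _ => ?_)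
  · have := (h e).1
    have := (h e).2
    have : 0 ≤ 1 - q e := by linarith
    simp only [if_true]
    simp
    positivity
  · have := mgf1 (q e) (x e) (h e).1 (hx e)
    simpa using this

instance matSing {n : ℕ} : MeasurableSingletonClass (Matrix (Fin n) (Fin n) ℝ) :=
  inferInstanceAs (MeasurableSingletonClass (Fin n → Fin n → ℝ))

lemma integral_bern0 {n : ℕ} (Q : Matrix (Fin n) (Fin n) ℝ)
    (h : ∀ i j, 0 ≤ Q i j ∧ Q i j ≤ 1) (g : Matrix (Fin n) (Fin n) ℝ → ℝ) :
    ∫ A, g A ∂(bern0 Q) = ∑ f : {p : Fin n × Fin n // p.1 < p.2} → Bool,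
      bw (fun e => Q e.val.1 e.val.2) f * g (boolMatrix f) := by
  unfold bern0
  rw [integral_finsetSum_measure]
  · refine Finset.sum_congr rfl fun f _ => ?_
    rw [integral_smul_measure, integral_dirac, smul_eq_mul]
    congr 1
    exact ENNReal.toReal_ofReal (bw_nonneg
      (fun e : {p : Fin n × Fin n // p.1 < p.2} => Q e.val.1 e.val.2) (fun e => h _ _) f)
  · intro f _
    exact (integrable_dirac (by simp)).smul_measure ENNReal.ofReal_ne_top

lemma sum_offdiag {n : ℕ} (G : Fin n → Fin n → ℝ) (h0 : ∀ i, G i i = 0) :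
    ∑ i, ∑ j, G i j = ∑ e : {p : Fin n × Fin n // p.1 < p.2},
      (G e.val.1 e.val.2 + G e.val.2 e.val.1) := by
  have e1 : ∀ H : Fin n → Fin n → ℝ, ∑ e : {p : Fin n × Fin n // p.1 < p.2}, H e.val.1 e.val.2
      = ∑ i, ∑ j, if i < j then H i j else 0 := by
    intro H
    rw [← Finset.sum_product', Finset.univ_product_univ, ← Finset.sum_filter,
      Finset.sum_subtype (p := fun p : Fin n × Fin n => p.1 < p.2) _ (by simp)]
  rw [Finset.sum_add_distrib, e1 G, e1 (fun i j => G j i)]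
  rw [Finset.sum_comm (f := fun i j => if i < j then G j i else 0), ← Finset.sum_add_distrib]
  refine Finset.sum_congr rfl fun i _ => ?_
  rw [← Finset.sum_add_distrib]
  refine Finset.sum_congr rfl fun j _ => ?_
  rcases lt_trichotomy i j with h | h | h
  · simp [h, h.not_gt]
  · subst h; simp [h0]
  · simp [h, h.not_gt]

lemma lift_sum_eq {n k : ℕ} (π : Fin n → Fin k) (g : Fin k → ℝ) :
    ∑ i, g (π i) = ∑ a, ((Finset.univ.filter fun j => π j = a).card : ℝ) * g a := by
  rw [← Finset.sum_fiberwise Finset.univ π]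
  refine Finset.sum_congr rfl fun a _ => ?_
  rw [Finset.sum_congr rfl (g := fun _ => g a)]
  · simp
  · intro i hi; simp at hi; rw [hi]

lemma lift_sum_le {n k : ℕ} (hk : 2 ≤ k) (hkn : k ≤ n) (π : Fin n → Fin k)
    (hπ : IsEquipartition n k π) (g : Fin k → ℝ) (hg : ∀ a, 0 ≤ g a) :
    ∑ i, g (π i) ≤ (2 * n / k) * ∑ a, g a := by
  rw [lift_sum_eq, Finset.mul_sum]
  refine Finset.sum_le_sum fun a _ => mul_le_mul_of_nonneg_right ?_ (hg a)
  have h := (abs_lt.1 (hπ a)).2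
  have hk0 : (0 : ℝ) < k := by exact_mod_cast (by omega : 0 < k)
  have h1 : (1 : ℝ) ≤ n / k := by rw [le_div_iff₀ hk0]; simpa using (by exact_mod_cast hkn : (k:ℝ) ≤ n)
  rw [mul_div_assoc]
  linarith

lemma lift_sum2_le {n k : ℕ} (hk : 2 ≤ k) (hkn : k ≤ n) (π : Fin n → Fin k)
    (hπ : IsEquipartition n k π) (g : Fin k → Fin k → ℝ) (hg : ∀ a b, 0 ≤ g a b) :
    ∑ i, ∑ j, g (π i) (π j) ≤ (2 * n / k) ^ 2 * ∑ a, ∑ b, g a b := by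
  calc ∑ i, ∑ j, g (π i) (π j) ≤ ∑ i, (2 * n / k) * ∑ b, g (π i) b :=
        Finset.sum_le_sum fun i _ => lift_sum_le hk hkn π hπ _ (hg _)
    _ = (2 * n / k) * ∑ i, ∑ b, g (π i) b := by rw [Finset.mul_sum]
    _ ≤ (2 * n / k) * ((2 * n / k) * ∑ a, ∑ b, g a b) := by
        refine mul_le_mul_of_nonneg_left ?_ (by positivity)
        exact lift_sum_le hk hkn π hπ (fun a => ∑ b, g a b)
          fun a => Finset.sum_nonneg fun b _ => hg _ _
    _ = _ := by ring

lemma lift_inner {n k : ℕ} (π : Fin n → Fin k) (C : Fin k × Fin k → ℝ)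
    (B : Fin n → Fin n → ℝ) :
    ∑ i, ∑ j, C (π i, π j) * B i j
      = ∑ p, C p * ∑ i, ∑ j, if (π i, π j) = p then B i j else 0 := by
  simp_rw [Finset.mul_sum]
  symm
  rw [Finset.sum_comm]
  refine Finset.sum_congr rfl fun i _ => ?_
  rw [Finset.sum_comm]
  refine Finset.sum_congr rfl fun j _ => ?_
  simp

lemma rounding (c w α δ r : ℝ) (N : ℕ) (hc : 0 ≤ c) (hcr : c ≤ r) (hα : 0 ≤ α) (hδ : 0 < δ)
    (hN : ⌈r / δ⌉₊ < N) :
    ∃ z : Fin N, c * w - α * c ^ 2 ≤ α * δ ^ 2 + (δ * (z : ℕ)) * w - α / 2 * (δ * (z : ℕ)) ^ 2 := by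
  by_cases hw : 0 ≤ w
  · have hz : ⌈c / δ⌉₊ < N := lt_of_le_of_lt (Nat.ceil_mono (by gcongr)) hN
    refine ⟨⟨_, hz⟩, ?_⟩
    simp only
    set z : ℝ := (⌈c / δ⌉₊ : ℝ) with hzdef
    have h1 : c ≤ δ * z := by
      have := Nat.le_ceil (c / δ)
      rw [div_le_iff₀ hδ] at this; linarith
    have h2 : δ * z ≤ c + δ := by
      have := (Nat.ceil_lt_add_one (div_nonneg hc hδ.le)).le
      have h3 := mul_le_mul_of_nonneg_left this hδ.le
      have : δ * (c / δ + 1) = c + δ := by field_simp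
      linarith
    have h3 : (δ * z) ^ 2 ≤ 2 * c ^ 2 + 2 * δ ^ 2 := by
      nlinarith [sq_nonneg (c - δ)]
    have h4 : c * w ≤ δ * z * w := mul_le_mul_of_nonneg_right h1 hw
    nlinarith [mul_le_mul_of_nonneg_left h3 hα]
  · refine ⟨⟨0, by omega⟩, ?_⟩
    simp only [Nat.cast_zero, mul_zero, zero_mul]
    have : c * w ≤ 0 := mul_nonpos_of_nonneg_of_nonpos hc (by linarith)
    have : 0 ≤ α * c ^ 2 := by positivity
    have : 0 ≤ α * δ ^ 2 := by positivity
    norm_num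
    linarith

lemma grid_sum (N m : ℕ) (ι : Type*) [Fintype ι] [DecidableEq ι] (hm : Fintype.card ι = m) :
    ∑ Z : ι → Fin N, Real.exp (-∑ p, ((Z p : ℕ) : ℝ) ^ 2) ≤ 2 ^ m := by
  have h1 := Finset.prod_univ_sum (fun _ : ι => (Finset.univ : Finset (Fin N)))
    (fun _ z => Real.exp (-((z : ℕ) : ℝ) ^ 2))
  rw [Fintype.piFinset_univ] at h1
  simp_rw [← Finset.sum_neg_distrib, Real.exp_sum]
  rw [← h1, Finset.prod_const, Finset.card_univ, hm]
  refine pow_le_pow_left₀ (Finset.sum_nonneg fun _ _ => (Real.exp_pos _).le) ?_ m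
  rw [Fin.sum_univ_eq_sum_range (fun z => Real.exp (-(z : ℝ) ^ 2)) N]
  refine le_trans (Finset.sum_le_sum fun z _ => ?_) (sum_geometric_two_le N)
  have h2 : Real.exp (-1) ≤ 1 / 2 := by
    rw [Real.exp_neg, one_div]
    exact inv_anti₀ (by norm_num) (by linarith [Real.add_one_le_exp 1])
  calc Real.exp (-(z : ℝ) ^ 2) ≤ Real.exp ((z : ℝ) * (-1)) := by
        apply Real.exp_le_exp.2
        have : (z : ℝ) ≤ (z : ℝ) ^ 2 := by exact_mod_cast Nat.le_self_pow (by norm_num) z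
        linarith
    _ = Real.exp (-1) ^ z := Real.exp_nat_mul _ _
    _ ≤ (1 / 2) ^ z := pow_le_pow_left₀ (Real.exp_pos _).le h2 z

/-- exponent for a fixed partition and a fixed nonnegative block matrix -/
def Yfun {n k : ℕ} (Q A : Matrix (Fin n) (Fin n) ℝ) (π : Fin n → Fin k)
    (M : Fin k × Fin k → ℝ) (s : ℝ) : ℝ :=
  (∑ i, ∑ j, M (π i, π j) * (Q i j - A i j)) - s * ∑ p, M p ^ 2

lemma Y_mgf {n k : ℕ} (hk : 2 ≤ k) (hkn : k ≤ n) (r t s : ℝ) (hr1 : r ≤ 1) (ht : 0 ≤ t)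
    (Q : Matrix (Fin n) (Fin n) ℝ) (hQs : Q.IsSymm) (hQ0 : ∀ i, Q i i = 0)
    (hQ : ∀ i j, 0 ≤ Q i j ∧ Q i j ≤ r) (π : Fin n → Fin k) (hπ : IsEquipartition n k π)
    (M : Fin k × Fin k → ℝ) (hM : ∀ p, 0 ≤ M p) :
    ∑ f : {p : Fin n × Fin n // p.1 < p.2} → Bool, bw (fun e => Q e.val.1 e.val.2) f *
      Real.exp (t * Yfun Q (boolMatrix f) π M s)
      ≤ Real.exp ((2 * r * t ^ 2 * (2 * n / k) ^ 2 - t * s) * ∑ p, M p ^ 2) := by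
  have hrep : ∀ f : {p : Fin n × Fin n // p.1 < p.2} → Bool,
      t * Yfun Q (boolMatrix f) π M s = (∑ e : {p : Fin n × Fin n // p.1 < p.2},
        (t * (M (π e.val.1, π e.val.2) + M (π e.val.2, π e.val.1))) *
          (Q e.val.1 e.val.2 - if f e then 1 else 0)) + -(t * s * ∑ p, M p ^ 2) := by
    intro f
    unfold Yfun
    rw [sum_offdiag _ (by intro i; simp [hQ0, boolMatrix]), mul_sub, sub_eq_add_neg]
    congr 1
    · rw [Finset.mul_sum]
      refine Finset.sum_congr rfl fun e _ => ?_
      have h1 : boolMatrix f e.val.1 e.val.2 = if f e then 1 else 0 := by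
        simp [boolMatrix, e.2]
      have h2 : boolMatrix f e.val.2 e.val.1 = if f e then 1 else 0 := by
        simp [boolMatrix, e.2, (e.2).not_gt]
      have h3 : Q e.val.2 e.val.1 = Q e.val.1 e.val.2 := hQs.apply _ _
      rw [h1, h2, h3]; ring
    · ring
  simp_rw [hrep, Real.exp_add, ← mul_assoc]
  rw [← Finset.sum_mul]
  have hm := bw_mgf (fun e : {p : Fin n × Fin n // p.1 < p.2} => Q e.val.1 e.val.2)
    (fun e => t * (M (π e.val.1, π e.val.2) + M (π e.val.2, π e.val.1)))
    (fun e => ⟨(hQ _ _).1, (hQ _ _).2.trans hr1⟩)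
    (fun e => mul_nonneg ht (add_nonneg (hM _) (hM _)))
  have hr0 : 0 ≤ r := by
    have i : Fin n := ⟨0, by omega⟩
    exact (hQ i i).1.trans (hQ i i).2
  have hb : ∑ e : {p : Fin n × Fin n // p.1 < p.2}, Q e.val.1 e.val.2 *
      (t * (M (π e.val.1, π e.val.2) + M (π e.val.2, π e.val.1))) ^ 2
      ≤ 2 * r * t ^ 2 * (2 * n / k) ^ 2 * ∑ p, M p ^ 2 := by
    set G : Fin n → Fin n → ℝ := fun i j => if i = j then 0 else M (π i, π j) ^ 2 with hG
    have h1 : ∑ e : {p : Fin n × Fin n // p.1 < p.2}, Q e.val.1 e.val.2 *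
      (t * (M (π e.val.1, π e.val.2) + M (π e.val.2, π e.val.1))) ^ 2
      ≤ ∑ e : {p : Fin n × Fin n // p.1 < p.2}, 2 * r * t ^ 2 * (G e.val.1 e.val.2 + G e.val.2 e.val.1) := by
      refine Finset.sum_le_sum fun e _ => ?_
      simp only [hG, (e.2).ne, (e.2).ne', if_false]
      set a := M (π e.val.1, π e.val.2)
      set b := M (π e.val.2, π e.val.1)
      calc Q e.val.1 e.val.2 * (t * (a + b)) ^ 2 ≤ r * (t * (a + b)) ^ 2 :=
            mul_le_mul_of_nonneg_right (hQ _ _).2 (sq_nonneg _)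
        _ = r * t ^ 2 * (a + b) ^ 2 := by ring
        _ ≤ r * t ^ 2 * (2 * (a ^ 2 + b ^ 2)) :=
            mul_le_mul_of_nonneg_left (by nlinarith [sq_nonneg (a - b)]) (by positivity)
        _ = _ := by ring
    refine h1.trans ?_
    rw [← Finset.mul_sum, ← sum_offdiag G (by simp [hG]), mul_assoc (2 * r * t ^ 2)]
    refine mul_le_mul_of_nonneg_left ?_ (by positivity)
    calc ∑ i, ∑ j, G i j ≤ ∑ i, ∑ j, M (π i, π j) ^ 2 := by
          refine Finset.sum_le_sum fun i _ => Finset.sum_le_sum fun j _ => ?_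
          simp only [hG]; split_ifs
          · positivity
          · exact le_rfl
      _ ≤ (2 * n / k) ^ 2 * ∑ a, ∑ b, M (a, b) ^ 2 :=
          lift_sum2_le hk hkn π hπ (fun a b => M (a, b) ^ 2) (fun a b => sq_nonneg _)
      _ = _ := by rw [Fintype.sum_prod_type]
  calc _ ≤ Real.exp (∑ e : {p : Fin n × Fin n // p.1 < p.2}, Q e.val.1 e.val.2 *
      (t * (M (π e.val.1, π e.val.2) + M (π e.val.2, π e.val.1))) ^ 2)
        * Real.exp (-(t * s * ∑ p, M p ^ 2)) :=
        mul_le_mul_of_nonneg_right hm (Real.exp_pos _).le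
    _ ≤ _ := by
        rw [← Real.exp_add]
        apply Real.exp_le_exp.2
        rw [sub_mul]
        linarith

lemma pathwise {n k : ℕ} (r t δ Λ : ℝ) (N : ℕ) (hk : 2 ≤ k) (hkn : k ≤ n) (hr : 0 ≤ r)
    (ht : 0 < t) (hδ : 0 < δ) (hδ2 : δ ^ 2 = 64 * k ^ 2 / (t * n ^ 2)) (hN : ⌈r / δ⌉₊ < N)
    (hΛ : 0 ≤ Λ) (P : Finset (Fin n → Fin k)) (hP : ∀ π, π ∈ P ↔ IsEquipartition n k π)
    (Q A : Matrix (Fin n) (Fin n) ℝ) :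
    sSup {x : ℝ | ∃ C ∈ Bset n k r, ∃ π : Fin n → Fin k, IsEquipartition n k π ∧
            x = ninner (liftPart π C) (Q - A) - (1 / 16) * knorm C ^ 2}
      ≤ (4 * k ^ 2 + Λ + Real.exp (-Λ) * ∑ π ∈ P, ∑ Z : Fin k × Fin k → Fin N,
          Real.exp (t * Yfun Q A π (fun p => δ * ((Z p : ℕ) : ℝ)) (n ^ 2 / (32 * k ^ 2))))
          / (t * n ^ 2) := by
  have hk0 : (0 : ℝ) < k := by exact_mod_cast (by omega : 0 < k)
  have hn0 : (0 : ℝ) < n := by exact_mod_cast (by omega : 0 < n)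
  apply Real.sSup_le
  swap
  · have : 0 ≤ ∑ π ∈ P, ∑ Z : Fin k × Fin k → Fin N,
          Real.exp (t * Yfun Q A π (fun p => δ * ((Z p : ℕ) : ℝ)) (n ^ 2 / (32 * k ^ 2))) :=
      Finset.sum_nonneg fun _ _ => Finset.sum_nonneg fun _ _ => (Real.exp_pos _).le
    positivity
  rintro x ⟨C, hC, π, hπ, rfl⟩
  set W : Fin k × Fin k → ℝ := fun p => ∑ i, ∑ j, if (π i, π j) = p then Q i j - A i j else 0
    with hW
  have hα : (0 : ℝ) ≤ n ^ 2 / (16 * k ^ 2) := by positivity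
  have hround : ∀ p : Fin k × Fin k, ∃ z : Fin N, C p.1 p.2 * W p
      - (n ^ 2 / (16 * k ^ 2) : ℝ) * C p.1 p.2 ^ 2 ≤ (n ^ 2 / (16 * k ^ 2) : ℝ) * δ ^ 2
        + (δ * (z : ℕ)) * W p - (n ^ 2 / (16 * k ^ 2) : ℝ) / 2 * (δ * (z : ℕ)) ^ 2 := fun p =>
    rounding _ _ _ _ r N (hC p.1 p.2).1.1 (hC p.1 p.2).1.2 hα hδ hN
  choose Z hZ using hround
  have hsum := Finset.sum_le_sum fun p (_ : p ∈ Finset.univ) => hZ p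
  have hY : Yfun Q A π (fun p => δ * ((Z p : ℕ) : ℝ)) (n ^ 2 / (32 * k ^ 2))
      = ∑ p, (δ * (Z p : ℕ)) * W p
        - (n ^ 2 / (16 * k ^ 2) : ℝ) / 2 * ∑ p, (δ * (Z p : ℕ)) ^ 2 := by
    unfold Yfun
    rw [lift_inner π (fun p => δ * ((Z p : ℕ) : ℝ)) (fun i j => Q i j - A i j)]
    congr 2
    field_simp
    norm_num
  have hCn : (n : ℝ) ^ 2 * (ninner (liftPart π C) (Q - A) - (1 / 16) * knorm C ^ 2)
      = ∑ p : Fin k × Fin k, (C p.1 p.2 * W p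
        - (n ^ 2 / (16 * k ^ 2) : ℝ) * C p.1 p.2 ^ 2) := by
    rw [Finset.sum_sub_distrib, ← Finset.mul_sum,
      ← lift_inner π (fun p => C p.1 p.2) (fun i j => Q i j - A i j)]
    unfold ninner knorm liftPart
    rw [Real.sq_sqrt (by positivity), Fintype.sum_prod_type]
    simp only [Matrix.sub_apply]
    field_simp
  have hαδ : (n ^ 2 / (16 * k ^ 2) : ℝ) * δ ^ 2 = 4 / t := by
    rw [hδ2]; field_simp; norm_num
  rw [← hCn, Finset.sum_sub_distrib, Finset.sum_add_distrib, hαδ, ← Finset.mul_sum,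
    add_sub_assoc, ← hY] at hsum
  simp only [Finset.sum_const, Finset.card_univ, Fintype.card_prod, Fintype.card_fin,
    nsmul_eq_mul, Nat.cast_mul] at hsum
  set Y := Yfun Q A π (fun p => δ * ((Z p : ℕ) : ℝ)) (n ^ 2 / (32 * k ^ 2)) with hYdef
  have hexp : t * Y ≤ Λ + Real.exp (-Λ) * Real.exp (t * Y) := by
    rw [← Real.exp_add]
    linarith [Real.add_one_le_exp (-Λ + t * Y)]
  have hle : Real.exp (t * Y) ≤ ∑ π ∈ P, ∑ Z : Fin k × Fin k → Fin N,
          Real.exp (t * Yfun Q A π (fun p => δ * ((Z p : ℕ) : ℝ)) (n ^ 2 / (32 * k ^ 2))) := by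
    refine le_trans ?_ (Finset.single_le_sum (f := fun π => ∑ Z : Fin k × Fin k → Fin N,
          Real.exp (t * Yfun Q A π (fun p => δ * ((Z p : ℕ) : ℝ)) (n ^ 2 / (32 * k ^ 2))))
      (fun _ _ => Finset.sum_nonneg fun _ _ => (Real.exp_pos _).le) ((hP π).2 hπ))
    exact Finset.single_le_sum (f := fun Z : Fin k × Fin k → Fin N =>
          Real.exp (t * Yfun Q A π (fun p => δ * ((Z p : ℕ) : ℝ)) (n ^ 2 / (32 * k ^ 2))))
      (fun _ _ => (Real.exp_pos _).le) (Finset.mem_univ Z)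
  have hle2 := mul_le_mul_of_nonneg_left hle (Real.exp_pos (-Λ)).le
  rw [le_div_iff₀ (by positivity)]
  have h3 := mul_le_mul_of_nonneg_left hsum ht.le
  have h4 : t * (k * k * (4 / t) + Y) = 4 * (k : ℝ) ^ 2 + t * Y := by field_simp
  rw [h4] at h3
  linarith

/-- There is an absolute constant `K` such that for `n ≥ k ≥ 2`, `r ∈ [1/n, 1]`, a symmetric
matrix `Q ∈ [0,r]^{n×n}` with zero diagonal, and `A ∼ Bern₀(Q)`,
`E[sup_{C ∈ B_r, π} (⟨C_π, Q − A⟩ − (1/16)‖C‖₂²)] ≤ K·r·((log k)/n + k²/n²)`. -/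
theorem Bset_oscillation_bound :
    ∃ K : ℝ, ∀ n k : ℕ, 2 ≤ k → k ≤ n → ∀ r : ℝ, 1 / (n : ℝ) ≤ r → r ≤ 1 →
      ∀ Q : Matrix (Fin n) (Fin n) ℝ, Q.IsSymm → (∀ i, Q i i = 0) →
        (∀ i j, Q i j ∈ Set.Icc (0 : ℝ) r) →
      ∫ A, sSup {x : ℝ | ∃ C ∈ Bset n k r, ∃ π : Fin n → Fin k, IsEquipartition n k π ∧
            x = ninner (liftPart π C) (Q - A) - (1 / 16) * knorm C ^ 2} ∂(bern0 Q)
        ≤ K * r * (Real.log k / n + (k : ℝ) ^ 2 / (n : ℝ) ^ 2) := by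
  refine ⟨3072, ?_⟩
  intro n k hk hkn r hr1 hr2 Q hQs hQ0 hQ
  have hk0 : (0 : ℝ) < k := by exact_mod_cast (by omega : 0 < k)
  have hn0 : (0 : ℝ) < n := by exact_mod_cast (by omega : 0 < n)
  have hr : 0 < r := lt_of_lt_of_le (by positivity) hr1
  classical
  obtain ⟨t, htdef⟩ : ∃ t : ℝ, t = 1 / (512 * r) := ⟨_, rfl⟩
  have ht : 0 < t := by rw [htdef]; positivity
  obtain ⟨δ, hδdef⟩ : ∃ δ : ℝ, δ = Real.sqrt (64 * k ^ 2 / (t * n ^ 2)) := ⟨_, rfl⟩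
  have hδ : 0 < δ := by rw [hδdef]; apply Real.sqrt_pos.2; positivity
  have hδ2 : δ ^ 2 = 64 * k ^ 2 / (t * n ^ 2) := by
    rw [hδdef]; exact Real.sq_sqrt (by positivity)
  have hlogk : 0 ≤ Real.log k := Real.log_nonneg (by exact_mod_cast (by omega : 1 ≤ k))
  obtain ⟨Λ, hΛdef⟩ : ∃ Λ : ℝ, Λ = n * Real.log k + (k * k : ℕ) * Real.log 2 := ⟨_, rfl⟩
  have hΛ : 0 ≤ Λ := by rw [hΛdef]; have := Real.log_nonneg (x := 2) (by norm_num); positivity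
  set N := ⌈r / δ⌉₊ + 1 with hN
  set P : Finset (Fin n → Fin k) := Finset.univ.filter fun π => IsEquipartition n k π with hPdef
  have hP : ∀ π, π ∈ P ↔ IsEquipartition n k π := by simp [hPdef]
  have hQ1 : ∀ i j, 0 ≤ Q i j ∧ Q i j ≤ 1 := fun i j => ⟨(hQ i j).1, (hQ i j).2.trans hr2⟩
  rw [integral_bern0 Q hQ1]
  set b := bw (fun e : {p : Fin n × Fin n // p.1 < p.2} => Q e.val.1 e.val.2) with hb
  have hb0 : ∀ f, 0 ≤ b f := bw_nonneg _ (fun e => hQ1 _ _)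
  have hb1 : ∑ f, b f = 1 := bw_sum _
  have hexpΛ : Real.exp Λ = (k : ℝ) ^ n * 2 ^ (k * k) := by
    rw [hΛdef, Real.exp_add, Real.exp_nat_mul, Real.exp_nat_mul, Real.exp_log hk0,
      Real.exp_log (by norm_num)]
  have hES : ∑ f, b f * ∑ π ∈ P, ∑ Z : Fin k × Fin k → Fin N,
      Real.exp (t * Yfun Q (boolMatrix f) π (fun p => δ * ((Z p : ℕ) : ℝ))
        (n ^ 2 / (32 * k ^ 2))) ≤ Real.exp Λ := by
    simp_rw [Finset.mul_sum]
    rw [Finset.sum_comm]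
    have hin : ∀ π ∈ P, ∑ f, ∑ Z : Fin k × Fin k → Fin N, b f *
      Real.exp (t * Yfun Q (boolMatrix f) π (fun p => δ * ((Z p : ℕ) : ℝ))
        (n ^ 2 / (32 * k ^ 2))) ≤ 2 ^ (k * k) := by
      intro π hπ
      rw [Finset.sum_comm]
      refine le_trans (Finset.sum_le_sum fun Z _ => ?_)
        (grid_sum N (k * k) (Fin k × Fin k) (by simp))
      refine (Y_mgf hk hkn r t (n ^ 2 / (32 * k ^ 2)) hr2 ht.le Q hQs hQ0 hQ π ((hP π).1 hπ)
        (fun p => δ * ((Z p : ℕ) : ℝ)) (fun p => by positivity)).trans ?_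
      apply Real.exp_le_exp.2
      simp_rw [mul_pow]
      rw [← Finset.mul_sum, ← mul_assoc, hδ2]
      have : (2 * r * t ^ 2 * (2 ^ 2 * n ^ 2 / k ^ 2) - t * (n ^ 2 / (32 * k ^ 2)))
          * (64 * k ^ 2 / (t * n ^ 2)) = (-1 : ℝ) := by
        rw [htdef]; field_simp; norm_num
      have e2 : ((2 : ℝ) * n / k) ^ 2 = 2 ^ 2 * n ^ 2 / k ^ 2 := by rw [div_pow, mul_pow]
      rw [e2, this]
      linarith
    refine (Finset.sum_le_sum hin).trans ?_
    rw [Finset.sum_const, nsmul_eq_mul, hexpΛ]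
    refine mul_le_mul_of_nonneg_right ?_ (by positivity)
    have : P.card ≤ k ^ n := by
      refine (Finset.card_le_univ P).trans ?_
      simp
    exact_mod_cast this
  have hstep := Finset.sum_le_sum fun f (_ : f ∈ Finset.univ) => mul_le_mul_of_nonneg_left
    (pathwise r t δ Λ N hk hkn hr.le ht hδ hδ2 (by omega) hΛ P hP Q (boolMatrix f)) (hb0 f)
  refine hstep.trans ?_
  have hrw : ∀ S : ({p : Fin n × Fin n // p.1 < p.2} → Bool) → ℝ,
      ∑ f, b f * ((4 * k ^ 2 + Λ + Real.exp (-Λ) * S f) / (t * n ^ 2))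
        = (4 * k ^ 2 + Λ + Real.exp (-Λ) * ∑ f, b f * S f) / (t * n ^ 2) := by
    intro S
    have : ∀ f, b f * ((4 * k ^ 2 + Λ + Real.exp (-Λ) * S f) / (t * n ^ 2))
      = b f * ((4 * k ^ 2 + Λ) / (t * n ^ 2)) + Real.exp (-Λ) / (t * n ^ 2) * (b f * S f) := by
      intro f; ring
    simp_rw [this]
    rw [Finset.sum_add_distrib, ← Finset.sum_mul, ← Finset.mul_sum, hb1]
    ring
  rw [hrw]
  have h1 : Real.exp (-Λ) * ∑ f, b f * ∑ π ∈ P, ∑ Z : Fin k × Fin k → Fin N,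
      Real.exp (t * Yfun Q (boolMatrix f) π (fun p => δ * ((Z p : ℕ) : ℝ))
        (n ^ 2 / (32 * k ^ 2))) ≤ 1 := by
    have := mul_le_mul_of_nonneg_left hES (Real.exp_pos (-Λ)).le
    rwa [← Real.exp_add, neg_add_cancel, Real.exp_zero] at this
  have hl2 : Real.log 2 ≤ 1 := by linarith [Real.log_le_sub_one_of_pos (x := 2) (by norm_num)]
  have hk1 : (1 : ℝ) ≤ (k : ℝ) ^ 2 := by
    have : (1 : ℝ) ≤ k := by exact_mod_cast (by omega : 1 ≤ k)
    nlinarith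
  have hΛ2 : Λ ≤ n * Real.log k + k ^ 2 := by
    rw [hΛdef]; push_cast
    nlinarith
  have hfin : (3072 : ℝ) * r * (Real.log k / n + (k : ℝ) ^ 2 / (n : ℝ) ^ 2)
      = (6 * (n * Real.log k + k ^ 2)) / (t * n ^ 2) := by
    rw [htdef]; field_simp; norm_num
  rw [hfin]
  have : 0 ≤ n * Real.log k := by positivity
  gcongr
  linarith

end
end
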